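/- arXiv:2512.19167 — 3 statements merged into one kernel-verified Lean document; each statement's English description precedes it below -/
import Mathlib

section
/- Let J₀ be the Bessel function of the first kind of order zero. There exist a real number R and a sequence {λ_k} of complex roots of (iλ − λ²)J₀(λ) + λJ₀′(λ) = 0 satisfying λ_k = kπ − π/4 + 1/(8(kπ − π/4)) + (kπ − π/4)/(1 + (kπ − π/4)²) + i/(1 + (kπ − π/4)²) + O(k^{-3}) as k → +∞. -/
open Complex Filter Asymptotics Real

noncomputable section

/-- Bessel function of the first kind of order zero. -/
def J0 (z : ℂ) : ℂ :=
  ∑' m : ℕ, ((-1 : ℂ)) ^ m / ((Nat.factorial m : ℂ)) ^ 2 * (z / 2) ^ (2 * m)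

lemma hasSum_of_eq {f g : ℕ → ℂ} {a : ℂ} (h : ∀ n, g n = f n) (hf : HasSum f a) :
    HasSum g a := by
  rw [funext h]; exact hf

/-- the general term of the Bessel series -/
def J0term (m : ℕ) (z : ℂ) : ℂ :=
  ((-1 : ℂ)) ^ m / ((Nat.factorial m : ℂ)) ^ 2 * (z / 2) ^ (2 * m)

lemma norm_J0term (m : ℕ) (z : ℂ) :
    ‖J0term m z‖ = (‖z‖ ^ 2 / 4) ^ m / (m.factorial : ℝ) / (m.factorial : ℝ) := by
  unfold J0term
  simp only [norm_mul, norm_div, norm_pow, norm_neg, norm_one, one_pow, Complex.norm_natCast,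
    Complex.norm_ofNat]
  rw [pow_mul]
  field_simp
  ring

lemma norm_J0term_le (m : ℕ) (z : ℂ) (R : ℝ) (hz : ‖z‖ ≤ R) :
    ‖J0term m z‖ ≤ (R ^ 2 / 4) ^ m / (m.factorial : ℝ) := by
  rw [norm_J0term]
  have h1 : (1 : ℝ) ≤ m.factorial := by exact_mod_cast m.factorial_pos
  have h0 := norm_nonneg z
  calc _ ≤ (‖z‖ ^ 2 / 4) ^ m / (m.factorial : ℝ) := div_le_self (by positivity) h1
    _ ≤ _ := by gcongr

lemma norm_J0term_le' (m : ℕ) (z : ℂ) (R : ℝ) (hz : ‖z‖ ≤ R) :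
    ‖(2 * m : ℂ) * J0term m z‖ ≤ 2 * ((R ^ 2 / 4) ^ m / (m.factorial : ℝ)) := by
  rw [norm_mul, norm_J0term]
  have h1 : (m : ℝ) ≤ m.factorial := by exact_mod_cast m.self_le_factorial
  have h2 : (0 : ℝ) < m.factorial := by exact_mod_cast m.factorial_pos
  have h0 := norm_nonneg z
  have : ‖(2 * m : ℂ)‖ = 2 * m := by simp
  rw [this, mul_assoc]
  gcongr 2 * ?_
  calc (m : ℝ) * ((‖z‖ ^ 2 / 4) ^ m / (m.factorial : ℝ) / m.factorial)
      ≤ m.factorial * ((‖z‖ ^ 2 / 4) ^ m / (m.factorial : ℝ) / m.factorial) := by gcongr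
    _ = (‖z‖ ^ 2 / 4) ^ m / (m.factorial : ℝ) := by field_simp
    _ ≤ _ := by gcongr

lemma hasDerivAt_J0term (m : ℕ) (z : ℂ) (hz : z ≠ 0) :
    HasDerivAt (J0term m) ((2 * m : ℂ) * J0term m z / z) z := by
  unfold J0term
  have h := (((hasDerivAt_id z).div_const 2).pow (2 * m)).const_mul
    (((-1 : ℂ)) ^ m / ((Nat.factorial m : ℂ)) ^ 2)
  refine h.congr_deriv ?_
  rcases m with _ | m
  · simp
  · have : 2 * (m + 1) - 1 = 2 * m + 1 := by omega
    rw [this]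
    simp only [id]
    have h2 : (z / 2) ^ (2 * (m + 1)) = (z / 2) ^ (2 * m + 1) * (z / 2) := by
      rw [← pow_succ]; congr 1
    rw [h2]
    push_cast
    field_simp

lemma differentiable_J0term (m : ℕ) : Differentiable ℂ (J0term m) := by
  unfold J0term
  fun_prop

lemma J0_eq : J0 = fun z => ∑' m, J0term m z := rfl

lemma summ_bound (R : ℝ) : Summable fun m : ℕ => (R ^ 2 / 4) ^ m / (m.factorial : ℝ) :=
  Real.summable_pow_div_factorial _

lemma hasSum_J0 (z : ℂ) : HasSum (fun m => J0term m z) (J0 z) :=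
  (Summable.of_norm_bounded (summ_bound ‖z‖) (fun m => norm_J0term_le m z _ le_rfl)).hasSum

lemma differentiable_J0 : Differentiable ℂ J0 := by
  intro z
  have h := Complex.differentiableOn_tsum_of_summable_norm (U := Metric.ball (0 : ℂ) (‖z‖ + 1))
    (F := J0term) (summ_bound (‖z‖ + 1))
    (fun i => (differentiable_J0term i).differentiableOn) Metric.isOpen_ball
    (fun i w hw => norm_J0term_le i w _ (mem_ball_zero_iff.1 hw).le)
  exact h.differentiableAt (Metric.isOpen_ball.mem_nhds (by simp))

lemma hasSum_J0' (z : ℂ) (hz : z ≠ 0) :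
    HasSum (fun m : ℕ => (2 * m : ℂ) * J0term m z) (z * deriv J0 z) := by
  have h := Complex.hasSum_deriv_of_summable_norm (U := Metric.ball (0 : ℂ) (‖z‖ + 1)) (z := z)
    (F := J0term) (summ_bound (‖z‖ + 1))
    (fun i => (differentiable_J0term i).differentiableOn) Metric.isOpen_ball
    (fun i w hw => norm_J0term_le i w _ (mem_ball_zero_iff.1 hw).le) (by simp)
  have h2 := h.mul_left z
  rw [J0_eq]
  refine hasSum_of_eq (fun m => ?_) h2
  rw [(hasDerivAt_J0term m z hz).deriv]
  field_simp

lemma differentiable_J0' : Differentiable ℂ (deriv J0) := by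
  have := differentiable_J0.contDiff (n := 2)
  exact (((contDiff_succ_iff_deriv (n := 1)).1 this).2.2).differentiable (by norm_num)

lemma J0_ode (z : ℂ) (hz : z ≠ 0) :
    HasDerivAt (deriv J0) (-J0 z - deriv J0 z / z) z := by
  have h := Complex.hasSum_deriv_of_summable_norm (U := Metric.ball (0 : ℂ) (‖z‖ + 1)) (z := z)
    (F := fun (m : ℕ) z => (2 * m : ℂ) * J0term m z) ((summ_bound (‖z‖ + 1)).mul_left 2)
    (fun i => ((differentiable_J0term i).const_mul _).differentiableOn) Metric.isOpen_ball
    (fun i w hw => norm_J0term_le' i w _ (mem_ball_zero_iff.1 hw).le) (by simp)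
  have h1 : deriv (fun w => ∑' m : ℕ, (2 * m : ℂ) * J0term m w) z
      = deriv (fun w => w * deriv J0 w) z := by
    apply Filter.EventuallyEq.deriv_eq
    filter_upwards [isOpen_ne.mem_nhds hz] with w hw
    exact (hasSum_J0' w hw).tsum_eq
  have hd := (differentiable_J0' z).hasDerivAt
  have h2 := ((hasDerivAt_id z).mul hd).deriv
  have h3 : deriv (fun w => w * deriv J0 w) z = deriv J0 z + z * deriv (deriv J0) z := by
    have e : (fun w => w * deriv J0 w) = id * deriv J0 := rfl
    rw [e, h2]; simp
  rw [h1, h3] at h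
  have h4 := h.mul_left z
  have h5 : HasSum (fun m : ℕ => z * deriv (fun z => (2 * m : ℂ) * J0term m z) z)
      (-z ^ 2 * J0 z) := by
    rw [← hasSum_nat_add_iff' 1]
    have h6 := (hasSum_J0 z).mul_left (-z ^ 2)
    have h0 : -z ^ 2 * J0 z - ∑ i ∈ Finset.range 1,
        z * deriv (fun z => (2 * i : ℂ) * J0term i z) z = -z ^ 2 * J0 z := by simp
    rw [h0]
    refine hasSum_of_eq (fun m => ?_) h6
    · rw [((hasDerivAt_J0term (m + 1) z hz).const_mul _).deriv]
      unfold J0term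
      rw [Nat.factorial_succ]
      have : ((m : ℂ) + 1) ≠ 0 := by exact_mod_cast Nat.succ_ne_zero m
      have : ((m.factorial : ℕ) : ℂ) ≠ 0 := by exact_mod_cast m.factorial_ne_zero
      have e : (z / 2) ^ (2 * (m + 1)) = (z / 2) ^ (2 * m) * (z / 2) ^ 2 := by
        rw [← pow_add]; congr 1
      rw [e, pow_succ (-1 : ℂ) m]
      push_cast
      field_simp
  have h7 := h4.unique h5
  have h8 : deriv (deriv J0) z = -J0 z - deriv J0 z / z := by
    field_simp
    have : z * (deriv J0 z + z * deriv (deriv J0) z + z * J0 z) = 0 := by linear_combination h7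
    rcases mul_eq_zero.1 this with h | h
    · exact absurd h hz
    · linear_combination h
  rw [← h8]
  exact hd

lemma J0_neg (z : ℂ) : J0 (-z) = J0 z := by
  unfold J0
  refine tsum_congr fun m => ?_
  rw [neg_div, (even_two_mul m).neg_pow]

lemma deriv_J0_neg (z : ℂ) : deriv J0 (-z) = - deriv J0 z := by
  have h : (fun z => J0 (-z)) = J0 := funext J0_neg
  have h2 := deriv_comp_neg J0 z
  rw [h] at h2
  rw [h2]; simp

lemma J0_zero : J0 0 = 1 := by
  unfold J0
  rw [tsum_eq_single 0]
  · simp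
  · intro m hm
    simp [hm]

lemma prod_aux (m : ℕ) : ∏ i ∈ Finset.range m, ((2 * (i : ℝ) + 1) / (2 * i + 2))
    = (2 * m).factorial / (4 ^ m * (m.factorial : ℝ) ^ 2) := by
  induction m with
  | zero => simp
  | succ m ih =>
    rw [Finset.prod_range_succ, ih]
    have : 2 * (m + 1) = (2 * m + 1) + 1 := by ring
    rw [this, Nat.factorial_succ, Nat.factorial_succ, Nat.factorial_succ]
    have : ((m.factorial : ℕ) : ℝ) ≠ 0 := by exact_mod_cast m.factorial_ne_zero
    push_cast
    field_simp
    ring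

lemma J0_integral (z : ℂ) :
    J0 z = (1 / π : ℂ) * ∫ θ in (0 : ℝ)..π, Complex.cos (z * (Real.sin θ : ℝ)) := by
  have h := intervalIntegral.hasSum_integral_of_dominated_convergence
    (μ := MeasureTheory.volume) (a := 0) (b := π)
    (F := fun (n : ℕ) (θ : ℝ) => (-1 : ℂ) ^ n * (z * (Real.sin θ : ℝ)) ^ (2 * n)
      / ((2 * n).factorial : ℂ))
    (f := fun θ => Complex.cos (z * (Real.sin θ : ℝ)))
    (bound := fun n _ => (‖z‖ ^ 2) ^ n / (n.factorial : ℝ))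
    (fun n => by
      apply Continuous.aestronglyMeasurable
      fun_prop)
    (fun n => by
      refine Filter.Eventually.of_forall fun θ _ => ?_
      simp only [norm_mul, norm_div, norm_pow, norm_neg, norm_one, one_pow, Complex.norm_natCast,
        Complex.norm_real, Real.norm_eq_abs, one_mul]
      have h1 : |Real.sin θ| ≤ 1 := Real.abs_sin_le_one θ
      have h2 : ‖z‖ * |Real.sin θ| ≤ ‖z‖ := mul_le_of_le_one_right (norm_nonneg z) h1
      have h3 : (n.factorial : ℝ) ≤ (2 * n).factorial := by
        exact_mod_cast Nat.factorial_le (by omega)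
      have h4 : (0 : ℝ) < n.factorial := by exact_mod_cast n.factorial_pos
      rw [← pow_mul]
      gcongr)
    (Filter.Eventually.of_forall fun θ _ => Real.summable_pow_div_factorial _)
    (by simp)
    (Filter.Eventually.of_forall fun θ _ => Complex.hasSum_cos _)
  have h2 := h.mul_left (1 / π : ℂ)
  refine ((hasSum_J0 z).unique ?_)
  refine hasSum_of_eq (fun n => ?_) h2
  have e : ∀ θ : ℝ, (-1 : ℂ) ^ n * (z * (Real.sin θ : ℝ)) ^ (2 * n) / ((2 * n).factorial : ℂ)
      = ((-1 : ℂ) ^ n * z ^ (2 * n) / ((2 * n).factorial : ℂ)) * ((Real.sin θ ^ (2 * n) : ℝ) : ℂ) := by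
    intro θ; push_cast; ring
  simp_rw [e]
  rw [intervalIntegral.integral_const_mul, intervalIntegral.integral_ofReal, integral_sin_pow_even,
    prod_aux]
  unfold J0term
  have : ((n.factorial : ℕ) : ℂ) ≠ 0 := by exact_mod_cast n.factorial_ne_zero
  have : (((2 * n).factorial : ℕ) : ℂ) ≠ 0 := by exact_mod_cast (2 * n).factorial_ne_zero
  have : (π : ℂ) ≠ 0 := by exact_mod_cast Real.pi_ne_zero
  push_cast
  rw [div_pow, pow_mul 2 2 n]
  field_simp
  norm_num

lemma norm_cos_le (w : ℂ) : ‖Complex.cos w‖ ≤ Real.exp |w.im| := by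
  unfold Complex.cos
  rw [norm_div, Complex.norm_ofNat]
  have h1 : ‖Complex.exp (w * I)‖ ≤ Real.exp |w.im| := by
    rw [Complex.norm_exp]; apply Real.exp_le_exp.2; simp [neg_le_abs]
  have h2 : ‖Complex.exp (-w * I)‖ ≤ Real.exp |w.im| := by
    rw [Complex.norm_exp]; apply Real.exp_le_exp.2; simp [le_abs_self]
  have := norm_add_le (Complex.exp (w * I)) (Complex.exp (-w * I))
  linarith

lemma norm_J0_le (z : ℂ) : ‖J0 z‖ ≤ Real.exp |z.im| := by
  rw [J0_integral, norm_mul]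
  have h := intervalIntegral.norm_integral_le_of_norm_le_const (a := 0) (b := π)
    (f := fun θ => Complex.cos (z * (Real.sin θ : ℝ))) (C := Real.exp |z.im|) (by
      intro θ _
      refine (norm_cos_le _).trans (Real.exp_le_exp.2 ?_)
      rw [Complex.im_mul_ofReal, abs_mul]
      exact mul_le_of_le_one_right (abs_nonneg _) (Real.abs_sin_le_one θ))
  rw [sub_zero, abs_of_pos Real.pi_pos] at h
  have e : ‖(1 / π : ℂ)‖ = 1 / π := by
    rw [norm_div, norm_one, Complex.norm_real, Real.norm_eq_abs, abs_of_pos Real.pi_pos]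
  rw [e]
  have hp := Real.pi_pos
  calc _ ≤ 1 / π * (Real.exp |z.im| * π) := by gcongr
    _ = _ := by field_simp

/-- a branch of the square root, cut along the negative imaginary axis -/
def Sq (z : ℂ) : ℂ := (-I * z) ^ (1 / 2 : ℂ)

/-- the domain of `Sq` -/
def Dom (z : ℂ) : Prop := 0 < z.im ∨ z.re ≠ 0

lemma Dom.ne {z : ℂ} (h : Dom z) : z ≠ 0 := by
  rintro rfl
  rcases h with h | h <;> simp at h

lemma Sq_sq {z : ℂ} (h : z ≠ 0) : Sq z ^ 2 = -I * z := by
  unfold Sq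
  have h1 : -I * z ≠ 0 := mul_ne_zero (by simp) h
  rw [sq, ← Complex.cpow_add _ _ h1]
  norm_num

lemma Sq_ne {z : ℂ} (h : z ≠ 0) : Sq z ≠ 0 := by
  intro h0
  have := Sq_sq h
  rw [h0] at this
  simp [h] at this

lemma norm_Sq_sq (z : ℂ) (h : z ≠ 0) : ‖Sq z‖ ^ 2 = ‖z‖ := by
  rw [← norm_pow, Sq_sq h]; simp

lemma norm_Sq_le (z : ℂ) (h : 1 ≤ ‖z‖) : ‖Sq z‖ ≤ ‖z‖ := by
  have h0 : z ≠ 0 := by rintro rfl; simp at h; linarith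
  have := norm_Sq_sq z h0
  have := norm_nonneg (Sq z)
  by_contra! hc
  nlinarith

lemma hasDerivAt_Sq {z : ℂ} (h : Dom z) : HasDerivAt Sq (Sq z / (2 * z)) z := by
  have h0 := h.ne
  have h1 : -I * z ≠ 0 := mul_ne_zero (by simp) h0
  have hs : -I * z ∈ Complex.slitPlane := by
    rw [Complex.mem_slitPlane_iff]
    rcases h with h | h
    · left; simpa using h
    · right; simpa using h
  have h2 := ((hasDerivAt_id z).const_mul (-I)).cpow_const (c := (1 / 2 : ℂ)) hs
  refine h2.congr_deriv ?_
  unfold Sq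
  simp only [id]
  rw [Complex.cpow_sub _ _ h1, Complex.cpow_one]
  field_simp

lemma Sq_neg {x : ℝ} (hx : 0 < x) : Sq (-(x : ℂ)) = I * Sq x := by
  unfold Sq
  have h1 : -I * -(x : ℂ) = (x : ℂ) * I := by ring
  have h2 : -I * (x : ℂ) = (x : ℂ) * (-I) := by ring
  have hx0 : (x : ℂ) ≠ 0 := by exact_mod_cast hx.ne'
  rw [h1, h2, Complex.cpow_def_of_ne_zero (mul_ne_zero hx0 I_ne_zero),
    Complex.cpow_def_of_ne_zero (mul_ne_zero hx0 (neg_ne_zero.2 I_ne_zero)),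
    Complex.log_ofReal_mul hx I_ne_zero, Complex.log_ofReal_mul hx (neg_ne_zero.2 I_ne_zero),
    Complex.log_I, Complex.log_neg_I]
  have h3 : Complex.exp (π / 2 * I) = I := Complex.exp_pi_div_two_mul_I
  nth_rewrite 2 [← h3]
  rw [← Complex.exp_add]
  congr 1
  ring

/-- the normalised Bessel function -/
def uu (z : ℂ) : ℂ := Sq z * J0 z

def uD (z : ℂ) : ℂ := Sq z * (deriv J0 z + J0 z / (2 * z))

lemma hasDerivAt_uu {z : ℂ} (h : Dom z) : HasDerivAt uu (uD z) z := by
  have h1 := (hasDerivAt_Sq h).mul (differentiable_J0 z).hasDerivAt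
  refine h1.congr_deriv ?_
  have := h.ne
  unfold uD
  field_simp
  ring

lemma hasDerivAt_uD {z : ℂ} (h : Dom z) : HasDerivAt uD (-(1 + 1 / (4 * z ^ 2)) * uu z) z := by
  have h0 := h.ne
  have h1 := (hasDerivAt_Sq h).mul ((J0_ode z h0).add
    ((differentiable_J0 z).hasDerivAt.div ((hasDerivAt_id z).const_mul 2)
      (by simpa using h0)))
  refine h1.congr_deriv ?_
  unfold uu
  simp only [id, Pi.add_apply, Pi.div_apply]
  field_simp
  ring

/-- the asymptotic amplitude -/
def pp (σ z : ℂ) : ℂ := 1 - σ / (8 * z) - 9 / (128 * z ^ 2) + 75 * σ / (1024 * z ^ 3)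

def pD (σ z : ℂ) : ℂ := σ / (8 * z ^ 2) + 9 / (64 * z ^ 3) - 225 * σ / (1024 * z ^ 4)

def pDD (σ z : ℂ) : ℂ := - σ / (4 * z ^ 3) - 27 / (64 * z ^ 4) + 225 * σ / (256 * z ^ 5)

lemma hasDerivAt_inv_pow (c z : ℂ) (n : ℕ) (hz : z ≠ 0) :
    HasDerivAt (fun w : ℂ => c / w ^ n) (-n * c / z ^ (n + 1)) z := by
  have h := (hasDerivAt_const z c).div (hasDerivAt_pow n z) (pow_ne_zero n hz)
  refine h.congr_deriv ?_
  rcases n with _ | n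
  · simp
  · simp only [Nat.add_sub_cancel]
    field_simp
    ring

lemma hasDerivAt_pp (σ : ℂ) {z : ℂ} (hz : z ≠ 0) : HasDerivAt (pp σ) (pD σ z) z := by
  have h := (((hasDerivAt_const z (1 : ℂ)).sub (hasDerivAt_inv_pow (σ / 8) z 1 hz)).sub
    (hasDerivAt_inv_pow (9 / 128) z 2 hz)).add (hasDerivAt_inv_pow (75 * σ / 1024) z 3 hz)
  refine (h.congr_deriv ?_).congr_of_eventuallyEq ?_
  · unfold pD
    push_cast
    field_simp
    ring
  · refine Filter.Eventually.of_forall fun w => ?_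
    simp only [pp, Pi.add_apply, Pi.sub_apply, div_div, pow_one]

lemma hasDerivAt_pD (σ : ℂ) {z : ℂ} (hz : z ≠ 0) : HasDerivAt (pD σ) (pDD σ z) z := by
  have h := ((hasDerivAt_inv_pow (σ / 8) z 2 hz).add
    (hasDerivAt_inv_pow (9 / 64) z 3 hz)).sub (hasDerivAt_inv_pow (225 * σ / 1024) z 4 hz)
  refine (h.congr_deriv ?_).congr_of_eventuallyEq ?_
  · unfold pDD
    push_cast
    field_simp
    ring
  · refine Filter.Eventually.of_forall fun w => ?_
    simp only [pD, Pi.add_apply, Pi.sub_apply, div_div]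

/-- approximate solution -/
def vv (σ z : ℂ) : ℂ := Complex.exp (σ * z) * pp σ z

def vD (σ z : ℂ) : ℂ := Complex.exp (σ * z) * (σ * pp σ z + pD σ z)

lemma hasDerivAt_vv (σ : ℂ) {z : ℂ} (hz : z ≠ 0) : HasDerivAt (vv σ) (vD σ z) z := by
  have h := (((hasDerivAt_id z).const_mul σ).cexp).mul (hasDerivAt_pp σ hz)
  refine h.congr_deriv ?_
  unfold vD
  simp only [id]
  ring

lemma hasDerivAt_vD (σ : ℂ) {z : ℂ} (hz : z ≠ 0) : HasDerivAt (vD σ)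
    (Complex.exp (σ * z) * (σ ^ 2 * pp σ z + 2 * σ * pD σ z + pDD σ z)) z := by
  have h := (((hasDerivAt_id z).const_mul σ).cexp).mul
    (((hasDerivAt_pp σ hz).const_mul σ).add (hasDerivAt_pD σ hz))
  refine h.congr_deriv ?_
  simp only [id, Pi.add_apply]
  ring

/-- the Wronskian of the Bessel function with an approximate solution -/
def WW (σ z : ℂ) : ℂ := uu z * vD σ z - uD z * vv σ z

def WD (σ z : ℂ) : ℂ := uu z * Complex.exp (σ * z) * (3675 * σ / 4096) / z ^ 5

lemma hasDerivAt_WW (σ : ℂ) (hσ : σ ^ 2 = -1) {z : ℂ} (h : Dom z) :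
    HasDerivAt (WW σ) (WD σ z) z := by
  have h0 := h.ne
  have h1 := ((hasDerivAt_uu h).mul (hasDerivAt_vD σ h0)).sub
    ((hasDerivAt_uD h).mul (hasDerivAt_vv σ h0))
  refine h1.congr_deriv ?_
  unfold WD vD vv
  rw [hσ]
  have key : (-1) * pp σ z + 2 * σ * pD σ z + pDD σ z + (1 + 1 / (4 * z ^ 2)) * pp σ z
     = (3675 * σ / 4096) / z ^ 5 := by
    unfold pp pD pDD
    field_simp
    ring_nf
    rw [hσ]
    ring
  rw [mul_div_assoc, ← key]
  ring

lemma norm_WD_le (σ : ℂ) (hσ : σ ^ 2 = -1) (z : ℂ) (hz : 1 ≤ ‖z‖) (A : ℝ)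
    (hA : |z.im| + (σ * z).re ≤ A) : ‖WD σ z‖ ≤ Real.exp A / ‖z‖ ^ 4 := by
  have hs : ‖σ‖ = 1 := by
    have := congrArg norm hσ
    rw [norm_pow, norm_neg, norm_one] at this
    exact (pow_eq_one_iff_of_nonneg (norm_nonneg _) two_ne_zero).1 this
  unfold WD uu
  rw [norm_div, norm_mul, norm_mul, norm_mul, norm_pow, norm_div, norm_mul, hs, Complex.norm_exp]
  simp only [Complex.norm_ofNat]
  have h1 := norm_Sq_le z hz
  have h2 := norm_J0_le z
  have h3 : Real.exp |z.im| * Real.exp (σ * z).re ≤ Real.exp A := by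
    rw [← Real.exp_add]; exact Real.exp_le_exp.2 hA
  calc _ ≤ ‖z‖ * Real.exp |z.im| * Real.exp (σ * z).re * 1 / ‖z‖ ^ 5 := by gcongr; norm_num
    _ = (Real.exp |z.im| * Real.exp (σ * z).re) / ‖z‖ ^ 4 := by
      have : ‖z‖ ≠ 0 := by positivity
      field_simp
    _ ≤ _ := by gcongr

lemma WW_neg {x : ℝ} (hx : 0 < x) : WW I (-(x : ℂ)) = -I * WW (-I) x := by
  have hx0 : (x : ℂ) ≠ 0 := by exact_mod_cast hx.ne'
  have h1 : pp I (-(x : ℂ)) = pp (-I) x := by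
    unfold pp; field_simp
  have h2 : pD I (-(x : ℂ)) = - pD (-I) x := by
    unfold pD; field_simp; ring
  have h3 : Complex.exp (I * -(x : ℂ)) = Complex.exp (-I * x) := by congr 1; ring
  have h4 : J0 (-(x : ℂ)) / (2 * -(x : ℂ)) = - (J0 x / (2 * x)) := by
    rw [J0_neg]; ring
  unfold WW uu uD vv vD
  rw [h1, h2, h3, Sq_neg hx, h4, J0_neg, deriv_J0_neg]
  ring

lemma exists_limit_of_deriv (f f' : ℝ → ℂ) (C : ℝ) (hC : 0 ≤ C)
    (hf : ∀ x, 1 ≤ x → HasDerivAt f (f' x) x) (hb : ∀ x, 1 ≤ x → ‖f' x‖ ≤ C / x ^ 4) :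
    ∃ L : ℂ, ∀ x, 1 ≤ x → ‖f x - L‖ ≤ C / x ^ 3 := by
  have key : ∀ x y : ℝ, 1 ≤ x → x ≤ y → ‖f x - f y‖ ≤ C / x ^ 3 := by
    intro x y hx hxy
    have hx0 : 0 < x := by linarith
    have hy0 : 0 < y := by linarith
    have hyx : y⁻¹ ≤ x⁻¹ := inv_anti₀ hx0 hxy
    have h := norm_image_sub_le_of_norm_deriv_le_segment' (f := fun t => f t⁻¹)
      (a := y⁻¹) (b := x⁻¹) (f' := fun t => (-(t ^ 2)⁻¹) • f' t⁻¹) (C := C / x ^ 2)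
      (by
        intro t ht
        have ht0 : 0 < t := lt_of_lt_of_le (inv_pos.2 hy0) ht.1
        have h1 : 1 ≤ t⁻¹ := by
          have := inv_anti₀ ht0 ht.2
          rw [inv_inv] at this
          linarith
        exact (HasDerivAt.scomp t (hf _ h1) (hasDerivAt_inv ht0.ne')).hasDerivWithinAt)
      (by
        intro t ht
        have ht0 : 0 < t := lt_of_lt_of_le (inv_pos.2 hy0) ht.1
        have h2 : t ≤ x⁻¹ := ht.2.le
        have h1 : 1 ≤ t⁻¹ := by
          have := inv_anti₀ ht0 h2
          rw [inv_inv] at this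
          linarith
        rw [norm_smul, norm_neg, norm_inv, norm_pow, Real.norm_eq_abs, abs_of_pos ht0]
        calc (t ^ 2)⁻¹ * ‖f' t⁻¹‖ ≤ (t ^ 2)⁻¹ * (C / t⁻¹ ^ 4) := by
              gcongr; exact hb _ h1
          _ = C * t ^ 2 := by field_simp
          _ ≤ C * x⁻¹ ^ 2 := by gcongr
          _ = C / x ^ 2 := by field_simp)
      x⁻¹ ⟨hyx, le_rfl⟩
    simp only [inv_inv] at h
    refine h.trans ?_
    calc C / x ^ 2 * (x⁻¹ - y⁻¹) ≤ C / x ^ 2 * x⁻¹ := by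
          gcongr
          have := inv_pos.2 hy0
          linarith
      _ = C / x ^ 3 := by field_simp
  have ht : Tendsto (fun n : ℕ => C / ((n : ℝ) + 1) ^ 3) atTop (nhds 0) := by
    apply Filter.Tendsto.div_atTop tendsto_const_nhds
    exact (tendsto_pow_atTop (by norm_num)).comp
      (tendsto_atTop_add_const_right _ _ tendsto_natCast_atTop_atTop)
  have hcs : CauchySeq (fun n : ℕ => f ((n : ℝ) + 1)) := by
    apply cauchySeq_of_le_tendsto_0' (fun n : ℕ => C / ((n : ℝ) + 1) ^ 3) _ ht
    intro n m hnm
    rw [dist_eq_norm]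
    apply key
    · have : (0 : ℝ) ≤ n := n.cast_nonneg
      linarith
    · have : (n : ℝ) ≤ m := by exact_mod_cast hnm
      linarith
  obtain ⟨L, hL⟩ := cauchySeq_tendsto_of_complete hcs
  refine ⟨L, fun x hx => ?_⟩
  refine le_of_tendsto ((tendsto_const_nhds.sub hL).norm) ?_
  filter_upwards [eventually_ge_atTop ⌈x⌉₊] with n hn
  apply key x _ hx
  have := Nat.ceil_le.1 hn
  linarith

lemma strip_bound (σ : ℂ) (hσ : σ = I ∨ σ = -I) : ∃ L : ℂ, ∀ z : ℂ, 1 ≤ z.re → |z.im| ≤ 1 →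
    ‖WW σ z - L‖ ≤ 2 * Real.exp 2 / z.re ^ 3 := by
  have hσ2 : σ ^ 2 = -1 := by rcases hσ with rfl | rfl <;> simp
  have hre : ∀ z : ℂ, |z.im| ≤ 1 → |z.im| + (σ * z).re ≤ 2 := by
    intro z hz
    have h1 := abs_le.1 hz
    rcases hσ with rfl | rfl <;> simp <;> linarith
  have hWD : ∀ z : ℂ, 1 ≤ z.re → |z.im| ≤ 1 → ‖WD σ z‖ ≤ Real.exp 2 / z.re ^ 4 := by
    intro z hz hz'
    have h1 : z.re ≤ ‖z‖ := (le_abs_self _).trans (Complex.abs_re_le_norm z)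
    refine (norm_WD_le σ hσ2 z (by linarith) 2 (hre z hz')).trans ?_
    gcongr
  obtain ⟨L, hL⟩ := exists_limit_of_deriv (fun x => WW σ x) (fun x => WD σ x) (Real.exp 2)
    (Real.exp_pos _).le
    (fun x hx => (hasDerivAt_WW σ hσ2 (by right; simp; linarith)).comp_ofReal)
    (fun x hx => by simpa using hWD x (by simpa using hx) (by simp))
  refine ⟨L, fun z hz hz' => ?_⟩
  have h1 := hL z.re hz
  have hconv : Convex ℝ {w : ℂ | z.re ≤ w.re ∧ (w.im ≤ 1 ∧ -1 ≤ w.im)} :=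
    (convex_halfSpace_re_ge _).inter ((convex_halfSpace_im_le 1).inter (convex_halfSpace_im_ge (-1)))
  have h2 := Convex.norm_image_sub_le_of_norm_hasDerivWithin_le (f := WW σ) (f' := WD σ)
    (C := Real.exp 2 / z.re ^ 4) (x := (z.re : ℂ)) (y := z)
    (fun w hw => (hasDerivAt_WW σ hσ2 (by right; have := hw.1; linarith)).hasDerivWithinAt)
    (fun w hw => by
      refine (hWD w (by have := hw.1; linarith) (abs_le.2 ⟨hw.2.2, hw.2.1⟩)).trans ?_
      have := hw.1
      gcongr) hconv (by simp) (by
        have := abs_le.1 hz'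
        exact ⟨le_rfl, this.2, this.1⟩)
  have h3 : ‖z - (z.re : ℂ)‖ ≤ 1 := by
    have : z - (z.re : ℂ) = z.im * I := by
      apply Complex.ext <;> simp
    rw [this]; simpa using hz'
  have h4 : Real.exp 2 / z.re ^ 4 * ‖z - (z.re : ℂ)‖ ≤ Real.exp 2 / z.re ^ 3 := by
    calc _ ≤ Real.exp 2 / z.re ^ 4 * 1 := by gcongr
      _ ≤ Real.exp 2 / z.re ^ 3 := by
        rw [mul_one]
        have : z.re ^ 3 ≤ z.re ^ 4 := pow_le_pow_right₀ hz (by norm_num)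
        gcongr
  calc ‖WW σ z - L‖ = ‖(WW σ z - WW σ z.re) + (WW σ z.re - L)‖ := by ring_nf
    _ ≤ Real.exp 2 / z.re ^ 3 + Real.exp 2 / z.re ^ 3 :=
      (norm_add_le _ _).trans (add_le_add (h2.trans h4) h1)
    _ = _ := by ring

lemma arc_bound (X : ℝ) (hX : 1 ≤ X) : ‖WW I (-(X : ℂ)) - WW I X‖ ≤ π / X ^ 3 := by
  have hX0 : 0 < X := by linarith
  have hn : ∀ θ : ℝ, ‖(X : ℂ) * Complex.exp (θ * I)‖ = X := by
    intro θ
    rw [norm_mul, Complex.norm_exp_ofReal_mul_I, Complex.norm_real, Real.norm_eq_abs,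
      abs_of_pos hX0, mul_one]
  have him : ∀ θ : ℝ, ((X : ℂ) * Complex.exp (θ * I)).im = X * Real.sin θ := by
    intro θ
    rw [Complex.im_ofReal_mul, Complex.exp_ofReal_mul_I_im]
  have hre : ∀ θ : ℝ, ((X : ℂ) * Complex.exp (θ * I)).re = X * Real.cos θ := by
    intro θ
    rw [Complex.re_ofReal_mul, Complex.exp_ofReal_mul_I_re]
  have h := norm_image_sub_le_of_norm_deriv_le_segment'
    (f := fun θ : ℝ => WW I ((X : ℂ) * Complex.exp (θ * I))) (a := 0) (b := π)
    (f' := fun θ : ℝ => WD I ((X : ℂ) * Complex.exp (θ * I)) *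
      ((X : ℂ) * (Complex.exp (θ * I) * I)))
    (C := 1 / X ^ 3)
    (by
      intro θ hθ
      have hd : Dom ((X : ℂ) * Complex.exp (θ * I)) := by
        unfold Dom
        rw [him, hre]
        have hs := Real.sin_nonneg_of_mem_Icc hθ
        rcases hs.eq_or_lt with h | h
        · right
          have := Real.sin_sq_add_cos_sq θ
          rw [← h] at this
          intro h0
          rcases mul_eq_zero.1 h0 with h1 | h1
          · linarith
          · rw [h1] at this; norm_num at this
        · left; positivity
      have h1 : HasDerivAt (fun θ : ℝ => (X : ℂ) * Complex.exp (θ * I))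
          ((X : ℂ) * (Complex.exp (θ * I) * I)) θ := by
        have := (((Complex.ofRealCLM.hasDerivAt (x := θ)).mul_const I).cexp).const_mul (X : ℂ)
        simpa using this
      exact ((hasDerivAt_WW I (by simp) hd).comp θ h1).hasDerivWithinAt)
    (by
      intro θ hθ
      have hs := Real.sin_nonneg_of_mem_Icc ⟨hθ.1, hθ.2.le⟩
      have h1 := norm_WD_le I (by simp) ((X : ℂ) * Complex.exp (θ * I)) (by rw [hn]; exact hX) 0
        (by
          rw [Complex.I_mul_re, him, abs_of_nonneg (by positivity)]
          linarith)
      rw [hn, Real.exp_zero] at h1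
      rw [norm_mul, ← mul_assoc, norm_mul, hn, Complex.norm_I]
      calc _ ≤ 1 / X ^ 4 * (X * 1) := by gcongr
        _ = 1 / X ^ 3 := by field_simp)
    π ⟨Real.pi_pos.le, le_rfl⟩
  simp only [Complex.exp_pi_mul_I, Complex.ofReal_zero, zero_mul, Complex.exp_zero, mul_one,
    mul_neg] at h
  refine h.trans (le_of_eq ?_)
  ring

/-- the connection formula between the two limits -/
lemma connection (Lp Lm : ℂ) (hp : ∀ z : ℂ, 1 ≤ z.re → |z.im| ≤ 1 →
    ‖WW I z - Lp‖ ≤ 2 * Real.exp 2 / z.re ^ 3) (hm : ∀ z : ℂ, 1 ≤ z.re → |z.im| ≤ 1 →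
    ‖WW (-I) z - Lm‖ ≤ 2 * Real.exp 2 / z.re ^ 3) : Lp = -I * Lm := by
  have key : ∀ X : ℝ, 1 ≤ X → ‖Lp - -I * Lm‖ ≤ (4 * Real.exp 2 + π) / X ^ 3 := by
    intro X hX
    have h1 := hp X (by simpa using hX) (by simp)
    have h2 := hm X (by simpa using hX) (by simp)
    have h3 := arc_bound X hX
    rw [WW_neg (by linarith)] at h3
    rw [Complex.ofReal_re] at h1 h2
    calc ‖Lp - -I * Lm‖ = ‖-(WW I X - Lp) + (-I * (WW (-I) X - Lm)) +
          -(-I * WW (-I) X - WW I X)‖ := by congr 1; ring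
      _ ≤ ‖WW I X - Lp‖ + ‖WW (-I) X - Lm‖ + ‖-I * WW (-I) X - WW I X‖ := by
        refine norm_add₃_le.trans ?_
        rw [norm_neg, norm_neg, norm_mul, norm_neg, norm_I, one_mul]
      _ ≤ 2 * Real.exp 2 / X ^ 3 + 2 * Real.exp 2 / X ^ 3 + π / X ^ 3 := by gcongr
      _ = _ := by ring
  have ht : Tendsto (fun X : ℝ => (4 * Real.exp 2 + π) / X ^ 3) atTop (nhds 0) :=
    Filter.Tendsto.div_atTop tendsto_const_nhds (tendsto_pow_atTop (by norm_num))
  have := ge_of_tendsto ht (by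
    filter_upwards [eventually_ge_atTop 1] with X hX using key X hX)
  exact sub_eq_zero.1 (norm_le_zero_iff.1 this)

lemma norm_pp_sub_one (σ : ℂ) (hσ : σ = I ∨ σ = -I) (z : ℂ) (hz : 1 ≤ ‖z‖) :
    ‖pp σ z - 1‖ ≤ 1 / ‖z‖ := by
  have hs : ‖σ‖ = 1 := by rcases hσ with rfl | rfl <;> simp
  have h0 : 0 < ‖z‖ := by linarith
  have e : pp σ z - 1 = -(σ / (8 * z)) + -(9 / (128 * z ^ 2)) + 75 * σ / (1024 * z ^ 3) := by
    unfold pp; ring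
  rw [e]
  refine norm_add₃_le.trans ?_
  simp only [norm_neg, norm_div, norm_mul, norm_pow, hs, Complex.norm_ofNat]
  have h2 : ‖z‖ ≤ ‖z‖ ^ 2 := le_self_pow₀ hz (by norm_num)
  have h3 : ‖z‖ ≤ ‖z‖ ^ 3 := le_self_pow₀ hz (by norm_num)
  calc _ ≤ 1 / (8 * ‖z‖) + 9 / (128 * ‖z‖) + 75 * 1 / (1024 * ‖z‖) := by gcongr
    _ = (1 / 8 + 9 / 128 + 75 / 1024) * (1 / ‖z‖) := by field_simp
    _ ≤ 1 * (1 / ‖z‖) := by gcongr; norm_num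
    _ = _ := one_mul _

lemma norm_pD_le (σ : ℂ) (hσ : σ = I ∨ σ = -I) (z : ℂ) (hz : 1 ≤ ‖z‖) :
    ‖pD σ z‖ ≤ 1 / ‖z‖ ^ 2 := by
  have hs : ‖σ‖ = 1 := by rcases hσ with rfl | rfl <;> simp
  have h0 : 0 < ‖z‖ := by linarith
  have e : pD σ z = σ / (8 * z ^ 2) + 9 / (64 * z ^ 3) + -(225 * σ / (1024 * z ^ 4)) := by
    unfold pD; ring
  rw [e]
  refine norm_add₃_le.trans ?_
  simp only [norm_neg, norm_div, norm_mul, norm_pow, hs, Complex.norm_ofNat]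
  have h2 : ‖z‖ ^ 2 ≤ ‖z‖ ^ 3 := pow_le_pow_right₀ hz (by norm_num)
  have h3 : ‖z‖ ^ 2 ≤ ‖z‖ ^ 4 := pow_le_pow_right₀ hz (by norm_num)
  calc _ ≤ 1 / (8 * ‖z‖ ^ 2) + 9 / (64 * ‖z‖ ^ 2) + 225 * 1 / (1024 * ‖z‖ ^ 2) := by gcongr
    _ = (1 / 8 + 9 / 64 + 225 / 1024) * (1 / ‖z‖ ^ 2) := by field_simp
    _ ≤ 1 * (1 / ‖z‖ ^ 2) := by gcongr; norm_num
    _ = _ := one_mul _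

/-- Wronskian of the two approximate solutions -/
def Om (z : ℂ) : ℂ := vD I z * vv (-I) z - vD (-I) z * vv I z

lemma Om_uu (z : ℂ) : Om z * uu z = WW I z * vv (-I) z - WW (-I) z * vv I z := by
  unfold Om WW; ring

lemma Om_uD (z : ℂ) : Om z * uD z = WW I z * vD (-I) z - WW (-I) z * vD I z := by
  unfold Om WW; ring

lemma norm_Om_ge (z : ℂ) (hz : 10 ≤ ‖z‖) : 1 ≤ ‖Om z‖ := by
  have hz1 : 1 ≤ ‖z‖ := by linarith
  have hi : 1 / ‖z‖ ≤ 1 / 10 := by gcongr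
  have hi2 : 1 / ‖z‖ ^ 2 ≤ 1 / 10 ^ 2 := by gcongr
  set a := pp I z - 1 with ha
  set b := pp (-I) z - 1 with hb
  have h1 : ‖a‖ ≤ 1 / 10 := (norm_pp_sub_one I (Or.inl rfl) z hz1).trans hi
  have h2 : ‖b‖ ≤ 1 / 10 := (norm_pp_sub_one (-I) (Or.inr rfl) z hz1).trans hi
  have h3 := (norm_pD_le I (Or.inl rfl) z hz1).trans hi2
  have h4 := (norm_pD_le (-I) (Or.inr rfl) z hz1).trans hi2
  have he : Complex.exp (I * z) * Complex.exp (-I * z) = 1 := by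
    rw [← Complex.exp_add]; simp
  have e : Om z = 2 * I * (1 + (a + b + a * b)) + pD I z * (1 + b) - pD (-I) z * (1 + a) := by
    unfold Om vD vv
    rw [ha, hb]
    linear_combination ((I * pp I z + pD I z) * pp (-I) z
      - (-I * pp (-I) z + pD (-I) z) * pp I z) * he
  set c := pD I z
  set d := pD (-I) z
  have e2 : 2 * I = Om z + (-(2 * I * (a + b + a * b)) + (-(c * (1 + b)) + d * (1 + a))) := by
    rw [e]; ring
  have n1 : ‖a + b + a * b‖ ≤ 21 / 100 := by
    refine norm_add₃_le.trans ?_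
    rw [norm_mul]
    have : ‖a‖ * ‖b‖ ≤ 1 / 10 * (1 / 10) := by gcongr
    linarith
  have n2 : ‖c * (1 + b)‖ ≤ 2 / 100 := by
    rw [norm_mul]
    have : ‖1 + b‖ ≤ 2 := by
      refine (norm_add_le _ _).trans ?_
      rw [norm_one]; linarith
    calc ‖c‖ * ‖1 + b‖ ≤ 1 / 10 ^ 2 * 2 := by gcongr
      _ ≤ 2 / 100 := by norm_num
  have n3 : ‖d * (1 + a)‖ ≤ 2 / 100 := by
    rw [norm_mul]
    have : ‖1 + a‖ ≤ 2 := by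
      refine (norm_add_le _ _).trans ?_
      rw [norm_one]; linarith
    calc ‖d‖ * ‖1 + a‖ ≤ 1 / 10 ^ 2 * 2 := by gcongr
      _ ≤ 2 / 100 := by norm_num
  have n4 : ‖2 * I‖ = 2 := by simp
  have n5 : ‖2 * I‖ ≤ ‖Om z‖ + (‖2 * I * (a + b + a * b)‖ + (‖c * (1 + b)‖ + ‖d * (1 + a)‖)) := by
    conv_lhs => rw [e2]
    refine (norm_add_le _ _).trans (add_le_add le_rfl ?_)
    refine (norm_add_le _ _).trans (add_le_add (norm_neg _).le ?_)
    refine (norm_add_le _ _).trans (add_le_add (norm_neg _).le le_rfl)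
  rw [norm_mul (2 * I), n4] at n5
  linarith

lemma norm_vv_real (σ : ℂ) (hσ : σ = I ∨ σ = -I) (x : ℝ) (hx : 1 ≤ x) : ‖vv σ x‖ ≤ 2 := by
  have he : ‖Complex.exp (σ * x)‖ = 1 := by
    rw [Complex.norm_exp]; rcases hσ with rfl | rfl <;> simp
  have hn : ‖(x : ℂ)‖ = x := by rw [Complex.norm_real, Real.norm_eq_abs, abs_of_nonneg (by linarith)]
  have h1 := norm_pp_sub_one σ hσ x (by rw [hn]; exact hx)
  rw [hn] at h1
  have h2 : 1 / x ≤ 1 := by rw [div_le_one (by linarith)]; exact hx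
  unfold vv
  rw [norm_mul, he, one_mul]
  have := norm_add_le (pp σ x - 1) 1
  rw [sub_add_cancel, norm_one] at this
  linarith

lemma norm_vD_real (σ : ℂ) (hσ : σ = I ∨ σ = -I) (x : ℝ) (hx : 1 ≤ x) : ‖vD σ x‖ ≤ 3 := by
  have he : ‖Complex.exp (σ * x)‖ = 1 := by
    rw [Complex.norm_exp]; rcases hσ with rfl | rfl <;> simp
  have hs : ‖σ‖ = 1 := by rcases hσ with rfl | rfl <;> simp
  have hn : ‖(x : ℂ)‖ = x := by rw [Complex.norm_real, Real.norm_eq_abs, abs_of_nonneg (by linarith)]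
  have h0 := norm_vv_real σ hσ x hx
  unfold vv at h0
  rw [norm_mul, he, one_mul] at h0
  have h1 := norm_pD_le σ hσ x (by rw [hn]; exact hx)
  rw [hn] at h1
  have h2 : 1 / x ^ 2 ≤ 1 := by
    rw [div_le_one (by positivity)]; exact one_le_pow₀ hx
  unfold vD
  rw [norm_mul, he, one_mul]
  refine (norm_add_le _ _).trans ?_
  rw [norm_mul, hs]
  linarith

lemma bessel_lower : ∃ c : ℝ, 0 < c ∧ ∀ x : ℝ, 1 ≤ x →
    c ≤ x ^ 2 * (‖J0 x‖ ^ 2 + ‖deriv J0 x‖ ^ 2) := by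
  have hcont : Continuous fun x : ℝ => (J0 x).re :=
    Complex.continuous_re.comp (differentiable_J0.continuous.comp Complex.continuous_ofReal)
  have h0 : ∀ᶠ x : ℝ in nhds 0, 1 / 2 < (J0 x).re := by
    exact continuousAt_const.eventually_lt hcont.continuousAt (by simp [J0_zero]; norm_num)
  obtain ⟨δ, hδ, hball⟩ := Metric.eventually_nhds_iff.1 h0
  set x0 : ℝ := min (δ / 2) 1 with hx0
  have hx0p : 0 < x0 := lt_min (by linarith) one_pos
  have hx01 : x0 ≤ 1 := min_le_right _ _
  have hJ : 1 / 2 < (J0 x0).re := by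
    apply hball
    rw [Real.dist_eq, sub_zero, abs_of_pos hx0p]
    exact lt_of_le_of_lt (min_le_left _ _) (by linarith)
  set E : ℝ → ℝ := fun x => x ^ 2 * ((J0 x).re ^ 2 + (deriv J0 x).re ^ 2) with hE
  have hd : ∀ x : ℝ, 0 < x → HasDerivAt E (2 * x * (J0 x).re ^ 2) x := by
    intro x hx
    have hxc : (x : ℂ) ≠ 0 := by exact_mod_cast hx.ne'
    have h1 := (differentiable_J0 (x : ℂ)).hasDerivAt.real_of_complex
    have h2 := (J0_ode (x : ℂ) hxc).real_of_complex
    have h3 := (hasDerivAt_pow 2 x).mul ((h1.pow 2).add (h2.pow 2))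
    refine h3.congr_deriv ?_
    have e : (deriv J0 (x : ℂ) / (x : ℂ)).re = (deriv J0 (x : ℂ)).re / x := by
      rw [Complex.div_ofReal_re]
    simp only [Pi.add_apply, Pi.pow_apply, Complex.sub_re, Complex.neg_re, e]
    push_cast
    field_simp
    ring
  have hmono : MonotoneOn E (Set.Ici x0) := by
    apply monotoneOn_of_deriv_nonneg (convex_Ici x0)
    · intro x hx
      exact (hd x (lt_of_lt_of_le hx0p hx)).continuousAt.continuousWithinAt
    · intro x hx
      rw [interior_Ici] at hx
      exact (hd x (hx0p.trans hx)).differentiableAt.differentiableWithinAt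
    · intro x hx
      rw [interior_Ici] at hx
      have : 0 < x := hx0p.trans hx
      rw [(hd x this).deriv]
      positivity
  refine ⟨E x0, ?_, fun x hx => ?_⟩
  · have : 0 < (J0 x0).re := by linarith
    simp only [hE]
    positivity
  · refine (hmono (Set.mem_Ici.2 le_rfl) (Set.mem_Ici.2 (hx01.trans hx)) (hx01.trans hx)).trans ?_
    simp only [hE]
    have h1 : (J0 x).re ^ 2 ≤ ‖J0 x‖ ^ 2 := sq_le_sq.2 (by
      rw [abs_norm]; exact Complex.abs_re_le_norm _)
    have h2 : (deriv J0 x).re ^ 2 ≤ ‖deriv J0 x‖ ^ 2 := sq_le_sq.2 (by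
      rw [abs_norm]; exact Complex.abs_re_le_norm _)
    gcongr

lemma limit_ne_zero (Lp Lm : ℂ) (hp : ∀ z : ℂ, 1 ≤ z.re → |z.im| ≤ 1 →
    ‖WW I z - Lp‖ ≤ 2 * Real.exp 2 / z.re ^ 3) (hm : ∀ z : ℂ, 1 ≤ z.re → |z.im| ≤ 1 →
    ‖WW (-I) z - Lm‖ ≤ 2 * Real.exp 2 / z.re ^ 3) : Lm ≠ 0 := by
  intro h0
  have hL := connection Lp Lm hp hm
  rw [h0, mul_zero] at hL
  obtain ⟨c, hc, hlow⟩ := bessel_lower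
  set K : ℝ := 2 * Real.exp 2 with hK
  have hKp : 0 < K := by positivity
  have key : ∀ x : ℝ, 10 ≤ x → c ≤ 1000 * K ^ 2 / x := by
    intro x hx
    have hx1 : 1 ≤ x := by linarith
    have hxp : 0 < x := by linarith
    have hxc : (x : ℂ) ≠ 0 := by exact_mod_cast hxp.ne'
    have hn : ‖(x : ℂ)‖ = x := by rw [Complex.norm_real, Real.norm_eq_abs, abs_of_pos hxp]
    have h1 := hp x (by simpa using hx1) (by simp)
    have h2 := hm x (by simpa using hx1) (by simp)
    rw [hL, sub_zero, Complex.ofReal_re] at h1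
    rw [h0, sub_zero, Complex.ofReal_re] at h2
    have hO := norm_Om_ge x (by rw [hn]; exact hx)
    have hu : ‖uu x‖ ≤ 4 * (K / x ^ 3) := by
      calc ‖uu x‖ ≤ ‖Om x‖ * ‖uu x‖ := le_mul_of_one_le_left (norm_nonneg _) hO
        _ = ‖WW I x * vv (-I) x - WW (-I) x * vv I x‖ := by rw [← norm_mul, Om_uu]
        _ ≤ ‖WW I x‖ * ‖vv (-I) x‖ + ‖WW (-I) x‖ * ‖vv I x‖ := by
          rw [← norm_mul, ← norm_mul]; exact norm_sub_le _ _
        _ ≤ K / x ^ 3 * 2 + K / x ^ 3 * 2 := by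
          gcongr
          · exact norm_vv_real _ (Or.inr rfl) x hx1
          · exact norm_vv_real _ (Or.inl rfl) x hx1
        _ = _ := by ring
    have hu' : ‖uD x‖ ≤ 6 * (K / x ^ 3) := by
      calc ‖uD x‖ ≤ ‖Om x‖ * ‖uD x‖ := le_mul_of_one_le_left (norm_nonneg _) hO
        _ = ‖WW I x * vD (-I) x - WW (-I) x * vD I x‖ := by rw [← norm_mul, Om_uD]
        _ ≤ ‖WW I x‖ * ‖vD (-I) x‖ + ‖WW (-I) x‖ * ‖vD I x‖ := by
          rw [← norm_mul, ← norm_mul]; exact norm_sub_le _ _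
        _ ≤ K / x ^ 3 * 3 + K / x ^ 3 * 3 := by
          gcongr
          · exact norm_vD_real _ (Or.inr rfl) x hx1
          · exact norm_vD_real _ (Or.inl rfl) x hx1
        _ = _ := by ring
    have hS : 1 ≤ ‖Sq x‖ := by
      have h3 := norm_Sq_sq (x : ℂ) hxc
      rw [hn] at h3
      have := norm_nonneg (Sq x)
      nlinarith
    have hJ : ‖J0 x‖ ≤ 4 * (K / x ^ 3) := by
      refine le_trans ?_ hu
      unfold uu
      rw [norm_mul]
      exact le_mul_of_one_le_left (norm_nonneg _) hS
    have hJ' : ‖deriv J0 x‖ ≤ 10 * (K / x ^ 3) := by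
      have h4 : ‖deriv J0 x + J0 x / (2 * x)‖ ≤ 6 * (K / x ^ 3) := by
        refine le_trans ?_ hu'
        unfold uD
        rw [norm_mul]
        exact le_mul_of_one_le_left (norm_nonneg _) hS
      have h5 : ‖J0 x / (2 * x)‖ ≤ ‖J0 x‖ := by
        rw [norm_div, norm_mul, hn]
        apply div_le_self (norm_nonneg _)
        simp; linarith
      have h6 : ‖deriv J0 x‖ ≤ ‖deriv J0 x + J0 x / (2 * x)‖ + ‖J0 x / (2 * x)‖ := by
        have := norm_sub_le (deriv J0 x + J0 x / (2 * x)) (J0 x / (2 * x))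
        rwa [add_sub_cancel_right] at this
      linarith
    calc c ≤ x ^ 2 * (‖J0 x‖ ^ 2 + ‖deriv J0 x‖ ^ 2) := hlow x hx1
      _ ≤ x ^ 2 * ((4 * (K / x ^ 3)) ^ 2 + (10 * (K / x ^ 3)) ^ 2) := by gcongr
      _ = 116 * K ^ 2 / x ^ 4 := by field_simp; ring
      _ ≤ 1000 * K ^ 2 / x := by
        have : x ≤ x ^ 4 := le_self_pow₀ hx1 (by norm_num)
        gcongr
        norm_num
  have ht : Tendsto (fun X : ℝ => 1000 * K ^ 2 / X) atTop (nhds 0) :=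
    Filter.Tendsto.div_atTop tendsto_const_nhds tendsto_id
  have := ge_of_tendsto ht (by
    filter_upwards [eventually_ge_atTop 10] with X hX using key X hX)
  linarith

/-- quantitative existence of a root near an approximate root -/
lemma root_lemma (f : ℂ → ℂ) (hf : DifferentiableOn ℂ f (Metric.ball 0 1)) (δ : ℝ)
    (hδ : δ ≤ 1 / 8) (hb : ∀ h ∈ Metric.ball (0 : ℂ) 1, ‖f h - Complex.sin h‖ ≤ δ)
    (η : ℂ) (hη : ‖η‖ ≤ 1 / 8) (hfη : ‖f η‖ ≤ 1 / 32) :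
    ∃ h : ℂ, f h = 0 ∧ ‖h‖ < 1 ∧ ‖h - η‖ ≤ 4 * ‖f η‖ := by
  have hδ0 : 0 ≤ δ := (norm_nonneg _).trans (hb 0 (by simp))
  have hfd : ∀ h : ℂ, ‖h‖ < 1 → DifferentiableAt ℂ f h := fun h hh =>
    hf.differentiableAt (Metric.isOpen_ball.mem_nhds (by simpa using hh))
  have hder : ∀ x ∈ Metric.closedBall (0 : ℂ) (1 / 4), ‖deriv f x - 1‖ ≤ 3 / 4 := by
    intro x hx
    have hx' : ‖x‖ ≤ 1 / 4 := by simpa using hx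
    have h1 : ‖deriv (fun h => f h - Complex.sin h) x‖ ≤ δ / (1 / 2) := by
      have hsub : Metric.closedBall x (1 / 2) ⊆ Metric.ball (0 : ℂ) 1 := by
        intro y hy
        have hy' : ‖y - x‖ ≤ 1 / 2 := by simpa [dist_eq_norm] using hy
        have := norm_add_le (y - x) x
        rw [sub_add_cancel] at this
        simp only [Metric.mem_ball, dist_zero_right]
        linarith
      apply Complex.norm_deriv_le_of_forall_mem_sphere_norm_le (by norm_num)
      · apply DifferentiableOn.diffContOnCl
        refine DifferentiableOn.mono (hf.sub Complex.differentiable_sin.differentiableOn) ?_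
        exact Metric.closure_ball_subset_closedBall.trans hsub
      · intro z hz
        exact hb z (hsub (Metric.sphere_subset_closedBall hz))
    have h2 : deriv (fun h => f h - Complex.sin h) x = deriv f x - Complex.cos x :=
      ((hfd x (by linarith)).hasDerivAt.sub (Complex.hasDerivAt_sin x)).deriv
    rw [h2] at h1
    have h3 : ‖Complex.cos x - 1‖ ≤ 1 / 2 := by
      have e : Complex.cos x - 1 = ((Complex.exp (x * I) - 1) + (Complex.exp (-x * I) - 1)) / 2 := by
        unfold Complex.cos; ring
      rw [e, norm_div, Complex.norm_ofNat]
      have a1 := Complex.norm_exp_sub_one_le (x := x * I) (by simp; linarith)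
      have a2 := Complex.norm_exp_sub_one_le (x := -x * I) (by simp; linarith)
      have a3 := norm_add_le (Complex.exp (x * I) - 1) (Complex.exp (-x * I) - 1)
      simp only [norm_mul, norm_neg, Complex.norm_I, mul_one] at a1 a2
      linarith
    calc ‖deriv f x - 1‖ = ‖(deriv f x - Complex.cos x) + (Complex.cos x - 1)‖ := by ring_nf
      _ ≤ 3 / 4 := (norm_add_le _ _).trans (by linarith)
  have hlin : ApproximatesLinearOn f (ContinuousLinearMap.id ℂ ℂ)
      (Metric.closedBall (0 : ℂ) (1 / 4)) (3 / 4 : NNReal) := by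
    intro x hx y hy
    have h := Convex.norm_image_sub_le_of_norm_hasDerivWithin_le (f := fun z => f z - z)
      (f' := fun z => deriv f z - 1) (C := 3 / 4) (s := Metric.closedBall (0 : ℂ) (1 / 4))
      (x := y) (y := x)
      (fun z hz => by
        have hz' : ‖z‖ ≤ 1 / 4 := by simpa using hz
        exact ((hfd z (by linarith)).hasDerivAt.sub (hasDerivAt_id z)).hasDerivWithinAt)
      hder (convex_closedBall _ _) hy hx
    have e : f x - f y - (ContinuousLinearMap.id ℂ ℂ) (x - y) = f x - x - (f y - y) := by
      simp; ring
    rw [e]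
    simpa using h
  let inv : (ContinuousLinearMap.id ℂ ℂ).NonlinearRightInverse :=
    { toFun := id
      nnnorm := 1
      bound' := by simp
      right_inv' := by intro y; simp }
  have hs := hlin.surjOn_closedBall_of_nonlinearRightInverse inv (ε := 4 * ‖f η‖) (b := η)
    (by positivity) (by
      intro y hy
      have hy' : ‖y - η‖ ≤ 4 * ‖f η‖ := by simpa [dist_eq_norm] using hy
      have := norm_add_le (y - η) η
      rw [sub_add_cancel] at this
      simp only [Metric.mem_closedBall, dist_zero_right]
      linarith)
  have h0 : (0 : ℂ) ∈ Metric.closedBall (f η) ((((inv.nnnorm : NNReal) : ℝ)⁻¹ -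
      ((3 / 4 : NNReal) : ℝ)) * (4 * ‖f η‖)) := by
    have : inv.nnnorm = 1 := rfl
    rw [this]
    simp only [Metric.mem_closedBall, dist_zero_left]
    push_cast
    linarith
  obtain ⟨h, hh, hfh⟩ := hs h0
  have hh' : ‖h - η‖ ≤ 4 * ‖f η‖ := by simpa [dist_eq_norm] using hh
  refine ⟨h, hfh, ?_, hh'⟩
  have := norm_add_le (h - η) η
  rw [sub_add_cancel] at this
  linarith

/-- equality up to third order at the origin -/
def E3 (f g : ℂ → ℂ) : Prop := (fun t => f t - g t) =O[nhds 0] fun t : ℂ => t ^ 3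

lemma E3.of_factor {f g : ℂ → ℂ} (r : ℂ → ℂ) (hr : ContinuousAt r 0)
    (h : ∀ᶠ t in nhds (0 : ℂ), f t - g t = t ^ 3 * r t) : E3 f g := by
  unfold E3
  have h1 : (fun t => t ^ 3 * r t) =O[nhds (0 : ℂ)] fun t : ℂ => t ^ 3 * (1 : ℂ) :=
    (isBigO_refl _ _).mul (hr.tendsto.isBigO_one ℂ)
  simp only [mul_one] at h1
  exact h1.congr' (h.mono fun t ht => ht.symm) (Filter.EventuallyEq.refl _ _)

lemma E3.mul {f g f' g' : ℂ → ℂ} (h : E3 f g) (h' : E3 f' g') (hg : ContinuousAt g 0)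
    (hf' : ContinuousAt f' 0) : E3 (fun t => f t * f' t) (fun t => g t * g' t) := by
  unfold E3 at *
  have h1 : (fun t => (f t - g t) * f' t) =O[nhds (0 : ℂ)] fun t : ℂ => t ^ 3 * (1 : ℂ) :=
    h.mul (hf'.tendsto.isBigO_one ℂ)
  have h2 : (fun t => g t * (f' t - g' t)) =O[nhds (0 : ℂ)] fun t : ℂ => (1 : ℂ) * t ^ 3 :=
    (hg.tendsto.isBigO_one ℂ).mul h'
  simp only [mul_one] at h1
  simp only [one_mul] at h2
  refine (h1.add h2).congr_left fun t => ?_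
  ring

lemma E3.sub {f g f' g' : ℂ → ℂ} (h : E3 f g) (h' : E3 f' g') :
    E3 (fun t => f t - f' t) (fun t => g t - g' t) := by
  unfold E3 at *
  refine (IsBigO.sub h h').congr_left fun t => ?_
  ring

lemma E3.trans {f g k : ℂ → ℂ} (h : E3 f g) (h' : E3 g k) : E3 f k := by
  unfold E3 at *
  refine (IsBigO.add h h').congr_left fun t => ?_
  ring

/-- the approximate shift, in the variable `t = 1/β` -/
def et (t : ℂ) : ℂ := t / 8 + t / (1 - I * t)

/-- the inverse `1/(β + η)` in the variable `t = 1/β` -/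
def st (t : ℂ) : ℂ := t / (1 + t * et t)

def qq (σ s : ℂ) : ℂ := (1 + s ^ 2 / 2 - I * s - σ * s) *
  (1 - σ * s / 8 - 9 * s ^ 2 / 128 + 75 * σ * s ^ 3 / 1024)
  - s * (σ * s ^ 2 / 8 + 9 * s ^ 3 / 64 - 225 * σ * s ^ 4 / 1024)

lemma cont_et : ContinuousAt et 0 := by
  unfold et
  refine ContinuousAt.add (by fun_prop) (ContinuousAt.div (by fun_prop) (by fun_prop) (by simp))

lemma et_zero : et 0 = 0 := by simp [et]

lemma cont_st : ContinuousAt st 0 := by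
  unfold st
  refine ContinuousAt.div (by fun_prop) ?_ (by simp)
  exact continuousAt_const.add (continuousAt_id.mul cont_et)

lemma ev1 : ∀ᶠ t in nhds (0 : ℂ), 1 - I * t ≠ 0 := by
  have h : ContinuousAt (fun t : ℂ => 1 - I * t) 0 := by fun_prop
  exact h.eventually_ne (by simp)

lemma ev2 : ∀ᶠ t in nhds (0 : ℂ), 1 + t * et t ≠ 0 := by
  have h : ContinuousAt (fun t : ℂ => 1 + t * et t) 0 :=
    continuousAt_const.add (continuousAt_id.mul cont_et)
  exact h.eventually_ne (by simp)

def e0 (t : ℂ) : ℂ := 9 * t / 8 + I * t ^ 2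

lemma E3_et : E3 et e0 := by
  refine E3.of_factor (fun t => -1 / (1 - I * t))
    (ContinuousAt.div (by fun_prop) (by fun_prop) (by simp)) ?_
  filter_upwards [ev1] with t ht
  have e : t / (1 - I * t) - (t + I * t ^ 2) = t ^ 3 * (-1 / (1 - I * t)) := by
    rw [mul_div_assoc', div_sub' ht]
    congr 1
    linear_combination t ^ 3 * Complex.I_sq
  unfold et e0
  linear_combination e

lemma E3_exp (σ : ℂ) : E3 (fun t => Complex.exp (σ * et t))
    (fun t => 1 + σ * e0 t + σ ^ 2 * e0 t ^ 2 / 2) := by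
  have hO : et =O[nhds (0 : ℂ)] fun t : ℂ => t := by
    have h1 : ContinuousAt (fun t : ℂ => 1 / 8 + 1 / (1 - I * t)) 0 :=
      continuousAt_const.add (ContinuousAt.div (by fun_prop) (by fun_prop) (by simp))
    have h2 : (fun t : ℂ => t * (1 / 8 + 1 / (1 - I * t))) =O[nhds (0 : ℂ)] fun t : ℂ => t * (1 : ℂ) :=
      (isBigO_refl _ _).mul (h1.tendsto.isBigO_one ℂ)
    simp only [mul_one] at h2
    refine h2.congr_left fun t => ?_
    unfold et; ring
  have h1 : E3 (fun t => Complex.exp (σ * et t))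
      (fun t => 1 + σ * et t + σ ^ 2 * et t ^ 2 / 2) := by
    unfold E3
    have h2 : (fun t => Complex.exp (σ * et t) - (1 + σ * et t + σ ^ 2 * et t ^ 2 / 2))
        =O[nhds (0 : ℂ)] fun t => (σ * et t) ^ 3 := by
      refine IsBigO.of_bound (4 * (6 * 3 : ℝ)⁻¹) ?_
      have hc : ContinuousAt (fun t => ‖σ * et t‖) 0 :=
        (continuousAt_const.mul cont_et).norm
      have : ∀ᶠ t in nhds (0 : ℂ), ‖σ * et t‖ < 1 :=
        hc.eventually_lt continuousAt_const (by simp [et_zero])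
      filter_upwards [this] with t ht
      have h3 := Complex.exp_bound ht.le (n := 3) (by norm_num)
      simp only [Finset.sum_range_succ, Finset.sum_range_zero, Nat.factorial] at h3
      norm_num at h3
      rw [norm_pow]
      norm_num
      convert h3 using 1
      · congr 1; ring
      · ring
    refine h2.trans ?_
    exact (hO.const_mul_left σ).pow 3
  refine h1.trans ?_
  have h4 := E3_et.mul E3_et (by unfold e0; fun_prop) cont_et
  unfold E3 at *
  refine ((E3_et.const_mul_left σ).add (h4.const_mul_left (σ ^ 2 / 2))).congr_left fun t => ?_
  ring

lemma E3_qq (σ : ℂ) : E3 (fun t => qq σ (st t))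
    (fun t => 1 + (-(I + σ) - σ / 8) * t + (1 / 2 - 9 / 128 + (I + σ) * σ / 8) * t ^ 2) := by
  have hm : ContinuousAt (fun t : ℂ => -(1 / 8 + 1 / (1 - I * t)) / (1 + t * et t)) 0 := by
    refine ContinuousAt.div (ContinuousAt.neg ?_) ?_ (by simp)
    · exact continuousAt_const.add (ContinuousAt.div (by fun_prop) (by fun_prop) (by simp))
    · exact continuousAt_const.add (continuousAt_id.mul cont_et)
  have hk : ContinuousAt (fun t : ℂ => 1 / (1 + t * et t)) 0 := by
    refine ContinuousAt.div continuousAt_const ?_ (by simp)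
    exact continuousAt_const.add (continuousAt_id.mul cont_et)
  have hs := cont_st
  refine E3.of_factor (fun t =>
    (-(I + σ) - σ / 8) * (-(1 / 8 + 1 / (1 - I * t)) / (1 + t * et t))
    + (1 / 2 - 9 / 128 + (I + σ) * σ / 8) *
      (-(1 / 8 + 1 / (1 - I * t)) / (1 + t * et t)) * (st t + t)
    + (1 / (1 + t * et t)) ^ 3 * ((75 * σ / 1024 + (I + σ) * 9 / 128 - σ / 16 - σ / 8)
      + (-(I + σ) * 75 * σ / 1024 - 9 / 256 - 9 / 64) * st t
      + (75 * σ / 2048 + 225 * σ / 1024) * st t ^ 2)) (by fun_prop) ?_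
  filter_upwards [ev1, ev2] with t h1 h2
  set m := -(1 / 8 + 1 / (1 - I * t)) / (1 + t * et t) with hmdef
  have e1 : st t - t = t ^ 3 * m := by
    have : et t = t * (1 / 8 + 1 / (1 - I * t)) := by unfold et; ring
    have h3 : t ^ 3 * m = -(t ^ 2 * et t) / (1 + t * et t) := by
      rw [hmdef, mul_div_assoc']
      congr 1
      rw [this]; ring
    rw [h3]
    unfold st
    field_simp
    ring
  have e2 : st t ^ 3 = t ^ 3 * (1 / (1 + t * et t)) ^ 3 := by
    unfold st; rw [← mul_pow]; congr 1; ring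
  unfold qq
  linear_combination ((-(I + σ) - σ / 8) + (1 / 2 - 9 / 128 + (I + σ) * σ / 8) * (st t + t)) * e1
    + ((75 * σ / 1024 + (I + σ) * 9 / 128 - σ / 16 - σ / 8)
      + (-(I + σ) * 75 * σ / 1024 - 9 / 256 - 9 / 64) * st t
      + (75 * σ / 2048 + 225 * σ / 1024) * st t ^ 2) * e2

lemma cont_qq (σ : ℂ) : ContinuousAt (fun t => qq σ (st t)) 0 := by
  have := cont_st
  unfold qq
  fun_prop

/-- third order vanishing of the main term at the approximate root -/
lemma main_expansion : (fun t => Complex.exp (I * et t) * qq I (st t)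
    - Complex.exp (-I * et t) * qq (-I) (st t)) =O[nhds 0] fun t : ℂ => t ^ 3 := by
  have h1 := (E3_exp I).mul (E3_qq I) (by unfold e0; fun_prop) (cont_qq I)
  have h2 := (E3_exp (-I)).mul (E3_qq (-I)) (by unfold e0; fun_prop) (cont_qq (-I))
  have h3 := (h1.sub h2).trans (k := fun _ => 0) (E3.of_factor (fun t =>
    263 / 64 * I - 1527 / 512 * t - 27 / 32 * I * t ^ 2 - t ^ 3 / 8) (by fun_prop)
    (Filter.Eventually.of_forall fun t => by
      have h3 : I ^ 3 = -I := by rw [pow_succ, I_sq]; ring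
      have h4 : I ^ 4 = 1 := Complex.I_pow_four
      have h5 : I ^ 5 = I := by rw [pow_succ, h4]; ring
      have h6 : I ^ 6 = -1 := by rw [pow_succ, h5]; simp
      unfold e0
      ring_nf
      simp only [I_sq, h3, h4, h5, h6]
      ring))
  unfold E3 at h3
  simpa using h3

lemma qq_eq (σ z : ℂ) (hz : z ≠ 0) : qq σ (1 / z) =
    (1 + 1 / (2 * z ^ 2) - I / z - σ / z) * pp σ z - pD σ z / z := by
  unfold qq pp pD
  field_simp

lemma V_eq (σ z : ℂ) (hz : z ≠ 0) :
    (I - z - 1 / (2 * z)) * vv σ z + vD σ z = -z * (Complex.exp (σ * z) * qq σ (1 / z)) := by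
  rw [qq_eq σ z hz]
  unfold vv vD
  field_simp
  ring

lemma norm_qq_sub_one (σ : ℂ) (hσ : σ = I ∨ σ = -I) (z : ℂ) (hz : 1 ≤ ‖z‖) :
    ‖qq σ (1 / z) - 1‖ ≤ 7 / ‖z‖ := by
  have hs : ‖σ‖ = 1 := by rcases hσ with rfl | rfl <;> simp
  have h0 : 0 < ‖z‖ := by linarith
  have hz0 : z ≠ 0 := norm_pos_iff.1 h0
  have h1 := norm_pp_sub_one σ hσ z hz
  have h2 := norm_pD_le σ hσ z hz
  have hi : 1 / ‖z‖ ≤ 1 := by rw [div_le_one h0]; exact hz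
  have hp : ‖pp σ z‖ ≤ 2 := by
    have := norm_add_le (pp σ z - 1) 1
    rw [sub_add_cancel, norm_one] at this
    linarith
  have n1 : ‖1 / (2 * z ^ 2) + -(I / z) + -(σ / z)‖ ≤ 5 / 2 * (1 / ‖z‖) := by
    refine norm_add₃_le.trans ?_
    simp only [norm_neg, norm_div, norm_mul, norm_pow, hs, Complex.norm_ofNat, norm_one, norm_I]
    have : ‖z‖ ≤ ‖z‖ ^ 2 := le_self_pow₀ hz (by norm_num)
    have : 1 / (2 * ‖z‖ ^ 2) ≤ 1 / (2 * ‖z‖) := by gcongr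
    have e : 1 / (2 * ‖z‖) = 1 / 2 * (1 / ‖z‖) := by field_simp
    linarith
  have n2 : ‖pD σ z / z‖ ≤ 1 / ‖z‖ := by
    rw [norm_div]
    have h3 : 1 / ‖z‖ ^ 2 ≤ 1 := by
      rw [div_le_one (by positivity)]; exact one_le_pow₀ hz
    gcongr
    linarith
  have e : qq σ (1 / z) - 1 = (pp σ z - 1) + (1 / (2 * z ^ 2) + -(I / z) + -(σ / z)) * pp σ z
      + -(pD σ z / z) := by
    rw [qq_eq σ z hz0]; ring
  rw [e]
  refine norm_add₃_le.trans ?_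
  rw [norm_neg, norm_mul]
  have n3 : ‖1 / (2 * z ^ 2) + -(I / z) + -(σ / z)‖ * ‖pp σ z‖ ≤ 5 / 2 * (1 / ‖z‖) * 2 := by
    gcongr
  have : 7 / ‖z‖ = 7 * (1 / ‖z‖) := by field_simp
  linarith

/-- reduced characteristic function -/
def FF (z : ℂ) : ℂ := WW (-I) z * (Complex.exp (I * z) * qq I (1 / z))
  - WW I z * (Complex.exp (-I * z) * qq (-I) (1 / z))

lemma FF_eq (z : ℂ) (hz : z ≠ 0) :
    Om z * (Sq z * ((I - z) * J0 z + deriv J0 z)) = z * FF z := by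
  have h1 : Sq z * ((I - z) * J0 z + deriv J0 z) = (I - z - 1 / (2 * z)) * uu z + uD z := by
    unfold uu uD; field_simp; ring
  have h2 : Om z * ((I - z - 1 / (2 * z)) * uu z + uD z) =
      WW I z * ((I - z - 1 / (2 * z)) * vv (-I) z + vD (-I) z)
      - WW (-I) z * ((I - z - 1 / (2 * z)) * vv I z + vD I z) := by
    linear_combination (I - z - 1 / (2 * z)) * Om_uu z + Om_uD z
  rw [h1, h2, V_eq _ _ hz, V_eq _ _ hz]
  unfold FF
  ring

lemma root_of_FF (z : ℂ) (hz : 10 ≤ ‖z‖) (h : FF z = 0) :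
    (I * z - z ^ 2) * J0 z + z * deriv J0 z = 0 := by
  have hz0 : z ≠ 0 := by
    rintro rfl; simp at hz; linarith
  have h1 := FF_eq z hz0
  rw [h, mul_zero] at h1
  have hO : Om z ≠ 0 := by
    have := norm_Om_ge z hz
    intro h0
    rw [h0, norm_zero] at this
    linarith
  have h2 := (mul_eq_zero.1 ((mul_eq_zero.1 h1).resolve_left hO)).resolve_left (Sq_ne hz0)
  linear_combination z * h2

lemma differentiableAt_FF {z : ℂ} (hz : Dom z) : DifferentiableAt ℂ FF z := by
  have h0 := hz.ne
  have h1 := (hasDerivAt_WW I (by simp) hz).differentiableAt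
  have h2 := (hasDerivAt_WW (-I) (by simp) hz).differentiableAt
  have hi : DifferentiableAt ℂ (fun z : ℂ => 1 / z) z :=
    (differentiableAt_const _).div differentiableAt_id h0
  have hq : ∀ σ : ℂ, DifferentiableAt ℂ (fun z : ℂ => qq σ (1 / z)) z := by
    intro σ
    have : Differentiable ℂ (qq σ) := by unfold qq; fun_prop
    exact (this _).comp z hi
  have h3 := hq I
  have h4 := hq (-I)
  unfold FF
  fun_prop

/-- the normalising constant -/
def kap (Lm : ℂ) (k : ℕ) : ℂ := (-1) ^ k * Complex.exp (π / 4 * I) / (2 * I * Lm)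

def MM (h z : ℂ) : ℂ := (Complex.exp (I * h) * qq I (1 / z)
    - Complex.exp (-I * h) * qq (-I) (1 / z)) / (2 * I)

def bet (k : ℕ) : ℝ := k * π - π / 4

lemma exp_bet (k : ℕ) : Complex.exp (I * (bet k : ℝ)) = (-1) ^ k * Complex.exp (-(π / 4 * I)) := by
  have : I * ((bet k : ℝ) : ℂ) = k * (π * I) + -(π / 4 * I) := by
    unfold bet; push_cast; ring
  rw [this, Complex.exp_add, Complex.exp_nat_mul, Complex.exp_pi_mul_I]

lemma FF_split (Lp Lm : ℂ) (hL : Lp = -I * Lm) (hL0 : Lm ≠ 0) (k : ℕ) (h : ℂ) :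
    kap Lm k * FF (bet k + h) = MM h (bet k + h) + kap Lm k *
      ((WW (-I) (bet k + h) - Lm) * (Complex.exp (I * (bet k + h)) * qq I (1 / (bet k + h)))
      - (WW I (bet k + h) - Lp) * (Complex.exp (-I * (bet k + h)) * qq (-I) (1 / (bet k + h)))) := by
  set z : ℂ := bet k + h with hz
  have hE : Complex.exp (π / 4 * I) * Complex.exp (-(π / 4 * I)) = 1 := by
    rw [← Complex.exp_add]; simp
  have hE2 : Complex.exp (π / 4 * I) * Complex.exp (π / 4 * I) = I := by
    rw [← Complex.exp_add]
    have e : (π : ℂ) / 4 * I + π / 4 * I = π / 2 * I := by ring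
    rw [e]
    exact Complex.exp_pi_div_two_mul_I
  have hk : ((-1 : ℂ) ^ k) * (-1) ^ k = 1 := by
    rw [← mul_pow]; simp
  have h1 : Complex.exp (I * z) = (-1) ^ k * Complex.exp (-(π / 4 * I)) * Complex.exp (I * h) := by
    rw [hz, mul_add, Complex.exp_add, exp_bet]
  have h2 : Complex.exp (-I * z) = (-1) ^ k * Complex.exp (π / 4 * I) * Complex.exp (-I * h) := by
    have h3 : Complex.exp (-I * (bet k : ℝ)) = (-1) ^ k * Complex.exp (π / 4 * I) := by
      have e1 : Complex.exp (-I * (bet k : ℝ)) * Complex.exp (I * (bet k : ℝ)) = 1 := by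
        rw [← Complex.exp_add]; simp
      rw [exp_bet] at e1
      calc Complex.exp (-I * (bet k : ℝ)) = Complex.exp (-I * (bet k : ℝ)) *
            (((-1) ^ k * (-1) ^ k) * (Complex.exp (π / 4 * I) * Complex.exp (-(π / 4 * I)))) := by
            rw [hk, hE]; ring
        _ = (Complex.exp (-I * (bet k : ℝ)) * ((-1) ^ k * Complex.exp (-(π / 4 * I)))) *
          ((-1) ^ k * Complex.exp (π / 4 * I)) := by ring
        _ = _ := by rw [e1, one_mul]
    rw [hz, mul_add, Complex.exp_add, h3]
  have key : kap Lm k * (Lm * (Complex.exp (I * z) * qq I (1 / z))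
      - Lp * (Complex.exp (-I * z) * qq (-I) (1 / z))) = MM h z := by
    rw [h1, h2, hL]
    unfold kap MM
    set A := qq I (1 / z)
    set B := qq (-I) (1 / z)
    set e1 := Complex.exp (π / 4 * I)
    set e2 := Complex.exp (-(π / 4 * I))
    set s : ℂ := (-1) ^ k
    rw [div_mul_eq_mul_div, div_eq_div_iff (by simp [hL0]) (by simp)]
    linear_combination (2 * I * Lm) * (Complex.exp (I * h) * A * s * s * hE
      + I * Complex.exp (-I * h) * B * s * s * hE2
      + Complex.exp (I * h) * A * hk + I ^ 2 * Complex.exp (-I * h) * B * hk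
      + Complex.exp (-I * h) * B * Complex.I_sq)
  rw [← key]
  unfold FF
  ring

lemma norm_exp_le_three (h : ℂ) (w : ℂ) (hw : w.re ≤ |h.im|) (hh : ‖h‖ ≤ 1) :
    ‖Complex.exp w‖ ≤ 3 := by
  rw [Complex.norm_exp]
  have h1 : |h.im| ≤ 1 := (Complex.abs_im_le_norm h).trans hh
  have h2 := Real.exp_le_exp.2 (hw.trans h1)
  have := Real.exp_one_lt_d9
  linarith

lemma norm_kap (Lm : ℂ) (k : ℕ) : ‖kap Lm k‖ = 1 / (2 * ‖Lm‖) := by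
  unfold kap
  have : ‖Complex.exp (π / 4 * I)‖ = 1 := by
    rw [Complex.norm_exp]; simp
  rw [norm_div, norm_mul, this, norm_pow, norm_mul, norm_mul]
  simp

lemma norm_qq_le (σ : ℂ) (hσ : σ = I ∨ σ = -I) (z : ℂ) (hz : 1 ≤ ‖z‖) :
    ‖qq σ (1 / z)‖ ≤ 8 := by
  have h := norm_qq_sub_one σ hσ z hz
  have := norm_add_le (qq σ (1 / z) - 1) 1
  rw [sub_add_cancel, norm_one] at this
  have : 7 / ‖z‖ ≤ 7 := div_le_self (by norm_num) hz
  linarith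

lemma err_bound (Lp Lm : ℂ) (hp : ∀ z : ℂ, 1 ≤ z.re → |z.im| ≤ 1 →
    ‖WW I z - Lp‖ ≤ 2 * Real.exp 2 / z.re ^ 3) (hm : ∀ z : ℂ, 1 ≤ z.re → |z.im| ≤ 1 →
    ‖WW (-I) z - Lm‖ ≤ 2 * Real.exp 2 / z.re ^ 3) (hL0 : Lm ≠ 0) :
    ∃ C : ℝ, 0 ≤ C ∧ ∀ k : ℕ, 20 ≤ bet k → ∀ h : ℂ, ‖h‖ ≤ 1 →
      ‖kap Lm k * FF (bet k + h) - MM h (bet k + h)‖ ≤ C / bet k ^ 3 := by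
  refine ⟨1 / (2 * ‖Lm‖) * (2 * (2 * Real.exp 2 * 8 * (3 * 8))), by positivity, ?_⟩
  intro k hk h hh
  rw [FF_split Lp Lm (connection Lp Lm hp hm) hL0, add_sub_cancel_left, norm_mul, norm_kap]
  set z : ℂ := bet k + h with hz
  have him : z.im = h.im := by simp [hz]
  have hre : bet k / 2 ≤ z.re := by
    have := abs_le.1 ((Complex.abs_re_le_norm h).trans hh)
    have e : z.re = bet k + h.re := by simp [hz]
    linarith [this.1]
  have hre1 : 1 ≤ z.re := by linarith
  have him1 : |z.im| ≤ 1 := by rw [him]; exact (Complex.abs_im_le_norm h).trans hh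
  have hzn : 1 ≤ ‖z‖ := hre1.trans ((le_abs_self _).trans (Complex.abs_re_le_norm z))
  have hB : 2 * Real.exp 2 / z.re ^ 3 ≤ 2 * Real.exp 2 * 8 / bet k ^ 3 := by
    have hb0 : 0 < bet k := by linarith
    calc 2 * Real.exp 2 / z.re ^ 3 ≤ 2 * Real.exp 2 / (bet k / 2) ^ 3 := by gcongr
      _ = _ := by field_simp; norm_num
  have h1 := (hp z hre1 him1).trans hB
  have h2 := (hm z hre1 him1).trans hB
  have h3 := norm_exp_le_three h (I * z) (by rw [Complex.I_mul_re, him]; exact neg_le_abs _) hh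
  have h4 := norm_exp_le_three h (-I * z) (by
    rw [neg_mul, Complex.neg_re, Complex.I_mul_re, him, neg_neg]; exact le_abs_self _) hh
  have h5 := norm_qq_le I (Or.inl rfl) z hzn
  have h6 := norm_qq_le (-I) (Or.inr rfl) z hzn
  have hb0 : 0 < bet k := by linarith
  rw [mul_div_assoc]
  gcongr
  refine (norm_sub_le _ _).trans ?_
  rw [norm_mul, norm_mul, norm_mul, norm_mul]
  calc _ ≤ 2 * Real.exp 2 * 8 / bet k ^ 3 * (3 * 8) + 2 * Real.exp 2 * 8 / bet k ^ 3 * (3 * 8) := by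
        gcongr
    _ = _ := by ring

lemma MM_sin (k : ℕ) (hk : 20 ≤ bet k) (h : ℂ) (hh : ‖h‖ ≤ 1) :
    ‖MM h (bet k + h) - Complex.sin h‖ ≤ 42 / bet k := by
  set z : ℂ := bet k + h with hz
  have hb0 : 0 < bet k := by linarith
  have hzn : bet k / 2 ≤ ‖z‖ := by
    have h1 : ‖((bet k : ℝ) : ℂ)‖ = bet k := by
      rw [Complex.norm_real, Real.norm_eq_abs, abs_of_pos hb0]
    have := norm_sub_le z h
    rw [hz, add_sub_cancel_right, h1, ← hz] at this
    linarith
  have hz1 : 1 ≤ ‖z‖ := by linarith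
  have h3 := norm_exp_le_three h (I * h) (by rw [Complex.I_mul_re]; exact neg_le_abs _) hh
  have h4 := norm_exp_le_three h (-I * h) (by
    rw [neg_mul, Complex.neg_re, Complex.I_mul_re, neg_neg]; exact le_abs_self _) hh
  have hB : 7 / ‖z‖ ≤ 14 / bet k := by
    calc 7 / ‖z‖ ≤ 7 / (bet k / 2) := by gcongr
      _ = _ := by field_simp; norm_num
  have h5 := (norm_qq_sub_one I (Or.inl rfl) z hz1).trans hB
  have h6 := (norm_qq_sub_one (-I) (Or.inr rfl) z hz1).trans hB
  have e : MM h z - Complex.sin h = (Complex.exp (I * h) * (qq I (1 / z) - 1)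
      - Complex.exp (-I * h) * (qq (-I) (1 / z) - 1)) / (2 * I) := by
    have e1 : I * h = h * I := mul_comm _ _
    have e2 : -I * h = -h * I := by ring
    unfold MM Complex.sin
    rw [e1, e2]
    field_simp
    ring_nf
    simp only [I_sq]
    ring
  rw [e, norm_div]
  have : ‖2 * I‖ = 2 := by simp
  rw [this, div_le_iff₀ (by norm_num)]
  refine (norm_sub_le _ _).trans ?_
  rw [norm_mul, norm_mul]
  calc _ ≤ 3 * (14 / bet k) + 3 * (14 / bet k) := by gcongr
    _ = _ := by ring

lemma bet_tendsto : Tendsto bet atTop atTop := by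
  unfold bet
  simp only [sub_eq_add_neg]
  apply tendsto_atTop_add_const_right
  exact tendsto_natCast_atTop_atTop.atTop_mul_const Real.pi_pos

lemma tinv_tendsto : Tendsto (fun k => ((bet k : ℝ) : ℂ)⁻¹) atTop (nhds 0) := by
  have h := (tendsto_inv_atTop_zero.comp bet_tendsto)
  have h2 := (Complex.continuous_ofReal.tendsto 0).comp h
  simpa [Function.comp_def] using h2

lemma et_bet (b : ℂ) (hb : b ≠ 0) (hb1 : 1 + b ^ 2 ≠ 0) :
    et b⁻¹ = 1 / (8 * b) + b / (1 + b ^ 2) + I / (1 + b ^ 2) := by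
  have e : (1 + b ^ 2) = (b - I) * (b + I) := by linear_combination Complex.I_sq
  have h1 : b - I ≠ 0 := fun h => hb1 (by rw [e, h, zero_mul])
  have h2 : b + I ≠ 0 := fun h => hb1 (by rw [e, h, mul_zero])
  have e2 : 1 - I * b⁻¹ = (b - I) / b := by field_simp
  unfold et
  rw [e2, e]
  field_simp
  ring

lemma st_bet (b : ℂ) (hb : b ≠ 0) : st b⁻¹ = 1 / (b + et b⁻¹) := by
  have : 1 + b⁻¹ * et b⁻¹ = (b + et b⁻¹) / b := by field_simp
  unfold st
  rw [this, div_div_eq_mul_div, inv_mul_cancel₀ hb]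

lemma main_exists (Lp Lm : ℂ) (hp : ∀ z : ℂ, 1 ≤ z.re → |z.im| ≤ 1 →
    ‖WW I z - Lp‖ ≤ 2 * Real.exp 2 / z.re ^ 3) (hm : ∀ z : ℂ, 1 ≤ z.re → |z.im| ≤ 1 →
    ‖WW (-I) z - Lm‖ ≤ 2 * Real.exp 2 / z.re ^ 3) :
    ∃ C : ℝ, 0 ≤ C ∧ ∀ᶠ k : ℕ in atTop, ∃ h : ℂ, 20 ≤ bet k ∧ ‖h‖ < 1 ∧ FF (bet k + h) = 0 ∧
      ‖h - et ((bet k : ℝ) : ℂ)⁻¹‖ ≤ C / bet k ^ 3 := by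
  have hL0 := limit_ne_zero Lp Lm hp hm
  obtain ⟨C1, hC1, herr⟩ := err_bound Lp Lm hp hm hL0
  obtain ⟨C2, hC2⟩ := (main_expansion.comp_tendsto tinv_tendsto).bound
  set C : ℝ := |C2| / 2 + C1 with hC
  have hC0 : 0 ≤ C := by positivity
  refine ⟨4 * C, by positivity, ?_⟩
  have het : ∀ᶠ k : ℕ in atTop, ‖et ((bet k : ℝ) : ℂ)⁻¹‖ < 1 / 8 := by
    have h1 : Tendsto (fun k => ‖et ((bet k : ℝ) : ℂ)⁻¹‖) atTop (nhds ‖et 0‖) :=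
      (cont_et.tendsto.comp tinv_tendsto).norm
    rw [et_zero, norm_zero] at h1
    exact h1.eventually_lt_const (by norm_num)
  have hlarge : ∀ᶠ k : ℕ in atTop, max 20 (max (8 * (42 + C1)) (32 * C)) ≤ bet k :=
    bet_tendsto.eventually_ge_atTop _
  filter_upwards [hC2, het, hlarge] with k hk1 hk2 hk3
  have hb20 : 20 ≤ bet k := (le_max_left _ _).trans hk3
  have hbA : 8 * (42 + C1) ≤ bet k := ((le_max_left _ _).trans (le_max_right _ _)).trans hk3
  have hbB : 32 * C ≤ bet k := ((le_max_right _ _).trans (le_max_right _ _)).trans hk3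
  have hb0 : 0 < bet k := by linarith
  have hbc : ((bet k : ℝ) : ℂ) ≠ 0 := by exact_mod_cast hb0.ne'
  have hb3 : bet k ≤ bet k ^ 3 := le_self_pow₀ (by linarith) (by norm_num)
  set η := et ((bet k : ℝ) : ℂ)⁻¹ with hη
  have hfη : ‖kap Lm k * FF (bet k + η)‖ ≤ C / bet k ^ 3 := by
    have h1 := herr k hb20 η (by linarith)
    have h2 : ‖MM η (bet k + η)‖ ≤ |C2| / 2 / bet k ^ 3 := by
      unfold MM
      simp only [Function.comp] at hk1
      rw [st_bet _ hbc, ← hη, norm_pow, norm_inv, Complex.norm_real, Real.norm_eq_abs,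
        abs_of_pos hb0] at hk1
      have : ‖2 * I‖ = 2 := by simp
      rw [norm_div, this, div_le_iff₀ (by norm_num)]
      refine hk1.trans ?_
      calc C2 * (bet k)⁻¹ ^ 3 ≤ |C2| * (bet k)⁻¹ ^ 3 := by gcongr; exact le_abs_self _
        _ = _ := by field_simp
    have h3 := norm_add_le (kap Lm k * FF (bet k + η) - MM η (bet k + η)) (MM η (bet k + η))
    rw [sub_add_cancel] at h3
    rw [hC, add_div]
    linarith
  obtain ⟨h, hf0, hh1, hh2⟩ := root_lemma (fun h => kap Lm k * FF (bet k + h))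
    (by
      intro h hh
      have hh' : ‖h‖ < 1 := by simpa using hh
      have h1 : Dom ((bet k : ℂ) + h) := by
        right
        have := abs_le.1 ((Complex.abs_re_le_norm h).trans hh'.le)
        simp only [Complex.add_re, Complex.ofReal_re]
        intro h0
        linarith [this.1]
      have h2 := (differentiableAt_FF h1).comp h
        ((differentiableAt_const (bet k : ℂ)).add differentiableAt_id)
      exact (h2.const_mul _).differentiableWithinAt)
    ((42 + C1) / bet k)
    (by rw [div_le_iff₀ hb0]; linarith)
    (by
      intro h hh
      have hh' : ‖h‖ < 1 := by simpa using hh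
      have h1 := herr k hb20 h hh'.le
      have h2 := MM_sin k hb20 h hh'.le
      have h3 : C1 / bet k ^ 3 ≤ C1 / bet k := by gcongr
      have h4 := norm_add_le (kap Lm k * FF (bet k + h) - MM h (bet k + h))
        (MM h (bet k + h) - Complex.sin h)
      rw [sub_add_sub_cancel] at h4
      rw [add_div]
      linarith)
    η hk2.le
    (hfη.trans (by
      rw [div_le_iff₀ (by positivity)]
      linarith))
  refine ⟨h, hb20, hh1, ?_, ?_⟩
  · have hk0 : kap Lm k ≠ 0 := by
      rw [← norm_pos_iff, norm_kap]
      have := norm_pos_iff.2 hL0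
      positivity
    exact (mul_eq_zero.1 hf0).resolve_left hk0
  · refine hh2.trans ?_
    rw [mul_div_assoc]
    gcongr

/-- **Root asymptotics.** There is a sequence `λ_k` of complex roots of
`(iλ − λ²)J₀(λ) + λJ₀′(λ) = 0` with
`λ_k = kπ − π/4 + 1/(8(kπ − π/4)) + (kπ − π/4)/(1 + (kπ − π/4)²) + i/(1 + (kπ − π/4)²)
       + O(k⁻³)` as `k → +∞`. -/
theorem stmt6 :
    ∃ lam : ℕ → ℂ,
      (∀ᶠ k in atTop,
        (I * lam k - (lam k) ^ 2) * J0 (lam k) + lam k * deriv J0 (lam k) = 0)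
      ∧ (fun k : ℕ =>
          lam k -
            (((k : ℂ) * (π : ℂ) - (π : ℂ) / 4)
              + 1 / (8 * ((k : ℂ) * (π : ℂ) - (π : ℂ) / 4))
              + ((k : ℂ) * (π : ℂ) - (π : ℂ) / 4)
                  / (1 + ((k : ℂ) * (π : ℂ) - (π : ℂ) / 4) ^ 2)
              + I / (1 + ((k : ℂ) * (π : ℂ) - (π : ℂ) / 4) ^ 2)))
          =O[atTop] fun k : ℕ => 1 / (k : ℝ) ^ 3 := by
  obtain ⟨Lp, hp⟩ := strip_bound I (Or.inl rfl)
  obtain ⟨Lm, hm⟩ := strip_bound (-I) (Or.inr rfl)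
  obtain ⟨C, hC, hex⟩ := main_exists Lp Lm hp hm
  classical
  refine ⟨fun k => if hk : ∃ h : ℂ, 20 ≤ bet k ∧ ‖h‖ < 1 ∧ FF (bet k + h) = 0 ∧
      ‖h - et ((bet k : ℝ) : ℂ)⁻¹‖ ≤ C / bet k ^ 3 then bet k + hk.choose else 0, ?_, ?_⟩
  · filter_upwards [hex] with k hk
    rw [dif_pos hk]
    obtain ⟨h1, h2, h3, h4⟩ := hk.choose_spec
    apply root_of_FF _ _ h3
    have hn : ‖((bet k : ℝ) : ℂ)‖ = bet k := by
      rw [Complex.norm_real, Real.norm_eq_abs, abs_of_nonneg (by linarith)]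
    have := norm_sub_le ((bet k : ℂ) + hk.choose) hk.choose
    rw [add_sub_cancel_right, hn] at this
    linarith
  · refine IsBigO.of_bound C ?_
    filter_upwards [hex, eventually_ge_atTop 1] with k hk hk1
    rw [dif_pos hk]
    obtain ⟨h1, h2, h3, h4⟩ := hk.choose_spec
    have hb : (k : ℂ) * (π : ℂ) - (π : ℂ) / 4 = ((bet k : ℝ) : ℂ) := by
      unfold bet; push_cast; ring
    have hb0 : 0 < bet k := by linarith
    have hbc : ((bet k : ℝ) : ℂ) ≠ 0 := by exact_mod_cast hb0.ne'
    have hb1 : 1 + ((bet k : ℝ) : ℂ) ^ 2 ≠ 0 := by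
      have : 1 + bet k ^ 2 ≠ 0 := by positivity
      exact_mod_cast this
    have hk1' : (1 : ℝ) ≤ k := by exact_mod_cast hk1
    have hkb : (k : ℝ) ≤ bet k := by
      unfold bet
      nlinarith [Real.pi_gt_three]
    rw [hb]
    have e : (bet k : ℂ) + hk.choose - ((bet k : ℂ) + 1 / (8 * (bet k : ℂ))
        + (bet k : ℂ) / (1 + (bet k : ℂ) ^ 2) + I / (1 + (bet k : ℂ) ^ 2))
        = hk.choose - et ((bet k : ℝ) : ℂ)⁻¹ := by
      linear_combination et_bet _ hbc hb1
    rw [e]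
    refine h4.trans ?_
    rw [Real.norm_eq_abs, abs_of_nonneg (by positivity), mul_one_div]
    gcongr

end
end

section
/- Let Ω ⊂ ℝ^d be a smooth bounded domain whose boundary contains two disjoint compact parts Γ₀ and Γ₁ with Γ̄₀ ∩ Γ̄₁ = ∅, and suppose λ ∈ ℝ, λ ≠ 0. If u ∈ H²(Ω) satisfies (−Δ − λ²)u = 0 in Ω, u = 0 on Γ₀ and ∂_ν u = 0 on Γ₀, then u = 0 in Ω. -/
open Complex

noncomputable section

variable {d : ℕ}

def pd (i : Fin d) (u : EuclideanSpace ℝ (Fin d) → ℂ) (x : EuclideanSpace ℝ (Fin d)) : ℂ :=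
  fderiv ℝ u x (EuclideanSpace.single i 1)

def lap (u : EuclideanSpace ℝ (Fin d) → ℂ) (x : EuclideanSpace ℝ (Fin d)) : ℂ :=
  ∑ i : Fin d, fderiv ℝ (fun y => pd i u y) x (EuclideanSpace.single i 1)

namespace UCaux

open MeasureTheory Set Filter Topology
open scoped ContDiff

/-- Laplacian of a real function on Euclidean space, by iterated partial derivatives. -/
def rlap {ι : Type} [Fintype ι] [DecidableEq ι] (g : EuclideanSpace ℝ ι → ℝ)
    (x : EuclideanSpace ℝ ι) : ℝ :=
  ∑ i : ι, fderiv ℝ (fun y => fderiv ℝ g y (EuclideanSpace.single i 1)) x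
    (EuclideanSpace.single i 1)

lemma exists_kernel {ι : Type} [Fintype ι] :
    ∃ K η : EuclideanSpace ℝ ι → ℝ, ContDiff ℝ ∞ K ∧ ContDiff ℝ ∞ η ∧
      HasCompactSupport K ∧ HasCompactSupport η ∧ (∀ y, 1 ≤ ‖y‖ → K y = 0) ∧
      (∀ y, 1 ≤ ‖y‖ → η y = 0) ∧ 0 < ∫ y, η y ∧
      ∀ y w, fderiv ℝ K y w = -(η y * inner ℝ y w) := by
  set h : ℝ → ℝ := fun x => (Polynomial.X ^ 2 : Polynomial ℝ).eval x⁻¹ * expNegInvGlue x with hh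
  have hder : ∀ x, HasDerivAt expNegInvGlue (h x) x := by
    intro x
    have := expNegInvGlue.hasDerivAt_polynomial_eval_inv_mul 1 x
    simpa [hh] using this
  have hsm : ContDiff ℝ ∞ h := expNegInvGlue.contDiff_polynomial_eval_inv_mul _
  have hq : ContDiff ℝ ∞ (fun y : EuclideanSpace ℝ ι => 1 - ‖y‖ ^ 2) :=
    contDiff_const.sub (contDiff_norm_sq ℝ)
  have hK0 : ∀ y : EuclideanSpace ℝ ι, 1 ≤ ‖y‖ → expNegInvGlue (1 - ‖y‖ ^ 2) = 0 := by
    intro y hy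
    exact expNegInvGlue.zero_of_nonpos (by nlinarith)
  have hη0 : ∀ y : EuclideanSpace ℝ ι, 1 ≤ ‖y‖ → 2 * h (1 - ‖y‖ ^ 2) = 0 := by
    intro y hy
    simp [hh, hK0 y hy]
  have cs : ∀ f : EuclideanSpace ℝ ι → ℝ, (∀ y, 1 ≤ ‖y‖ → f y = 0) → HasCompactSupport f := by
    intro f hf
    refine HasCompactSupport.intro (isCompact_closedBall (0 : EuclideanSpace ℝ ι) 1) ?_
    intro y hy
    apply hf
    simp at hy
    exact hy.le
  have hsη : ContDiff ℝ ∞ (fun y : EuclideanSpace ℝ ι => 2 * h (1 - ‖y‖ ^ 2)) :=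
    contDiff_const.mul (hsm.comp hq)
  refine ⟨fun y => expNegInvGlue (1 - ‖y‖ ^ 2), fun y => 2 * h (1 - ‖y‖ ^ 2),
    expNegInvGlue.contDiff.comp hq, hsη, cs _ hK0, cs _ hη0, hK0, hη0, ?_, ?_⟩
  · refine hsη.continuous.integral_pos_of_hasCompactSupport_nonneg_nonzero (x := 0) (cs _ hη0) ?_ ?_
    · intro y
      have := expNegInvGlue.nonneg (1 - ‖y‖ ^ 2)
      simp only [hh, Polynomial.eval_pow, Polynomial.eval_X, Pi.zero_apply]
      positivity
    · have := expNegInvGlue.pos_of_pos (x := 1) one_pos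
      simp [hh, this.ne']
  · intro y w
    have h1 : HasFDerivAt (fun y : EuclideanSpace ℝ ι => 1 - ‖y‖ ^ 2) (-(2 • innerSL ℝ y)) y := by
      have := (hasStrictFDerivAt_norm_sq y).hasFDerivAt.const_sub (1 : ℝ)
      simpa using this
    have h2 := (hder (1 - ‖y‖ ^ 2)).comp_hasFDerivAt y h1
    have h3 := h2.fderiv
    change fderiv ℝ (expNegInvGlue ∘ fun y : EuclideanSpace ℝ ι => 1 - ‖y‖ ^ 2) y w = _
    rw [h3]
    simp
    ring

/-- Differentiation under the integral sign against a compactly supported kernel. -/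
lemma param_deriv {E : Type*} [NormedAddCommGroup E] [InnerProductSpace ℝ E]
    [FiniteDimensional ℝ E] [MeasurableSpace E] [BorelSpace E]
    {η : E → ℝ} (hη : Continuous η) (hc : HasCompactSupport η)
    (G G' : ℝ → E → ℝ) (hG : Continuous (fun p : ℝ × E => G p.1 p.2))
    (hG' : Continuous (fun p : ℝ × E => G' p.1 p.2))
    (hd : ∀ s y, HasDerivAt (fun s => G s y) (G' s y) s) (s : ℝ) :
    HasDerivAt (fun s => ∫ y, G s y * η y) (∫ y, G' s y * η y) s := by
  have hGs : ∀ s, Continuous (G s) := fun s => hG.comp (by fun_prop : Continuous fun y => (s, y))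
  have hGs' : ∀ s, Continuous (G' s) := fun s => hG'.comp (by fun_prop : Continuous fun y => (s, y))
  obtain ⟨C, hC⟩ := ((isCompact_closedBall s (1 : ℝ)).prod hc).exists_bound_of_continuousOn
    hG'.continuousOn
  refine (hasDerivAt_integral_of_dominated_loc_of_deriv_le (μ := volume)
    (F := fun s y => G s y * η y) (F' := fun s y => G' s y * η y) (s := Metric.closedBall s 1)
    (bound := fun y => C * ‖η y‖) (Metric.closedBall_mem_nhds s one_pos) ?_ ?_ ?_ ?_ ?_ ?_).2
  · exact Eventually.of_forall fun s => ((hGs s).mul hη).aestronglyMeasurable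
  · exact ((hGs s).mul hη).integrable_of_hasCompactSupport hc.mul_left
  · exact ((hGs' s).mul hη).aestronglyMeasurable
  · refine Eventually.of_forall fun y t ht => ?_
    by_cases hy : y ∈ tsupport η
    · rw [norm_mul]
      gcongr
      exact hC (t, y) ⟨ht, hy⟩
    · simp [image_eq_zero_of_notMem_tsupport hy]
  · exact (hη.norm.const_smul C |>.integrable_of_hasCompactSupport (hc.norm.mul_left))
  · exact Eventually.of_forall fun y t _ => (hd t y).mul_const _

lemma ibp {E : Type*} [NormedAddCommGroup E] [InnerProductSpace ℝ E]
    [FiniteDimensional ℝ E] [MeasurableSpace E] [BorelSpace E]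
    {f k : E → ℝ} (hf : ContDiff ℝ 1 f) (hk : ContDiff ℝ 1 k) (hc : HasCompactSupport k) (v : E) :
    ∫ x, f x * fderiv ℝ k x v = - ∫ x, fderiv ℝ f x v * k x := by
  have h1 : Continuous fun x => fderiv ℝ f x v :=
    (hf.continuous_fderiv (by norm_num)).clm_apply continuous_const
  have h2 : Continuous fun x => fderiv ℝ k x v :=
    (hk.continuous_fderiv (by norm_num)).clm_apply continuous_const
  apply integral_mul_fderiv_eq_neg_fderiv_mul_of_integrable
  · exact (h1.mul hk.continuous).integrable_of_hasCompactSupport hc.mul_left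
  · exact (hf.continuous.mul h2).integrable_of_hasCompactSupport
      (hc.fderiv_apply (𝕜 := ℝ) v).mul_left
  · exact (hf.continuous.mul hk.continuous).integrable_of_hasCompactSupport hc.mul_left
  · exact fun x _ => hf.differentiable (by norm_num) x
  · exact fun x _ => hk.differentiable (by norm_num) x

/-- Weighted mean value property. -/
def MVP {E : Type*} [NormedAddCommGroup E] [NormedSpace ℝ E] [MeasureSpace E]
    (η g : E → ℝ) (x : E) (r : ℝ) : Prop :=
  ∫ y, g (x + r • y) * η y = (∫ y, η y) * g x

lemma fderiv_comp_affine {E : Type*} [NormedAddCommGroup E] [NormedSpace ℝ E]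
    {f : E → ℝ} (hf : Differentiable ℝ f) (x y w : E) (r : ℝ) :
    fderiv ℝ (fun y => f (x + r • y)) y w = r * fderiv ℝ f (x + r • y) w := by
  have h1 : HasFDerivAt (fun y : E => x + r • y) (r • ContinuousLinearMap.id ℝ E) y :=
    ((hasFDerivAt_id y).const_smul r).const_add x
  have h2 := (hf (x + r • y)).hasFDerivAt.comp y h1
  have h3 := h2.fderiv
  change fderiv ℝ (f ∘ fun y => x + r • y) y w = _
  rw [h3]
  simp

lemma mvp_of_harmonic {ι : Type} [Fintype ι] [DecidableEq ι] {K η : EuclideanSpace ℝ ι → ℝ}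
    (hK : ContDiff ℝ ∞ K) (hη : ContDiff ℝ ∞ η) (hKc : HasCompactSupport K)
    (hηc : HasCompactSupport η) (hK0 : ∀ y, 1 ≤ ‖y‖ → K y = 0)
    (hKη : ∀ y w, fderiv ℝ K y w = -(η y * inner ℝ y w))
    {g : EuclideanSpace ℝ ι → ℝ} (hg : ContDiff ℝ 2 g) {x : EuclideanSpace ℝ ι} {r : ℝ}
    (hr : 0 ≤ r) (hh : ∀ z ∈ Metric.ball x r, rlap g z = 0) : MVP η g x r := by
  have hgd : Differentiable ℝ g := hg.differentiable (by norm_num)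
  have hg1 : ContDiff ℝ 1 (fderiv ℝ g) := hg.fderiv_right (by norm_num)
  have hpart : ∀ w, ContDiff ℝ 1 fun z => fderiv ℝ g z w := fun w => hg1.clm_apply contDiff_const
  set M : ℝ → ℝ := fun s => ∫ y, g (x + s • y) * η y with hM
  have hMd : ∀ s, HasDerivAt M (∫ y, fderiv ℝ g (x + s • y) y * η y) s := by
    intro s
    refine param_deriv hη.continuous hηc (fun s y => g (x + s • y))
      (fun s y => fderiv ℝ g (x + s • y) y) ?_ ?_ ?_ s
    · exact hg.continuous.comp (by fun_prop)
    · exact (hg1.continuous.comp (by fun_prop)).clm_apply continuous_snd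
    · intro s y
      have h1 : HasDerivAt (fun s : ℝ => x + s • y) y s := by
        simpa using ((hasDerivAt_id s).smul_const y).const_add x
      exact (hgd (x + s • y)).hasFDerivAt.comp_hasDerivAt s h1
  have hzero : ∀ s, 0 ≤ s → s ≤ r → ∫ y, fderiv ℝ g (x + s • y) y * η y = 0 := by
    intro s hs hsr
    have e1 : ∀ y : EuclideanSpace ℝ ι, fderiv ℝ g (x + s • y) y * η y =
        ∑ i, -(fderiv ℝ g (x + s • y) (EuclideanSpace.single i 1) *
          fderiv ℝ K y (EuclideanSpace.single i 1)) := by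
      intro y
      have hy : y = ∑ i, y i • (EuclideanSpace.single i (1 : ℝ)) := by
        ext j
        simp [Finset.sum_apply, Pi.single_apply]
      conv_lhs => rw [show fderiv ℝ g (x + s • y) y = fderiv ℝ g (x + s • y)
        (∑ i, y i • (EuclideanSpace.single i (1 : ℝ))) from by rw [← hy]]
      rw [map_sum, Finset.sum_mul]
      refine Finset.sum_congr rfl fun i _ => ?_
      rw [hKη]
      simp [EuclideanSpace.inner_single_right]
      ring
    have hin : ∀ i : ι, ContDiff ℝ 1 fun y : EuclideanSpace ℝ ι =>
        fderiv ℝ g (x + s • y) (EuclideanSpace.single i 1) := fun i =>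
      (hpart (EuclideanSpace.single i 1)).comp (by fun_prop)
    have hKd : ∀ i : ι, Continuous fun y => fderiv ℝ K y (EuclideanSpace.single i 1) := fun i =>
      (hK.continuous_fderiv (by simp)).clm_apply continuous_const
    simp_rw [e1]
    rw [integral_finsetSum]
    swap
    · intro i _
      refine Integrable.neg ?_
      exact ((hin i).continuous.mul (hKd i)).integrable_of_hasCompactSupport
        (hKc.fderiv_apply (𝕜 := ℝ) _).mul_left
    have e2 : ∀ i : ι, ∫ y, -(fderiv ℝ g (x + s • y) (EuclideanSpace.single i 1) *
          fderiv ℝ K y (EuclideanSpace.single i 1)) =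
        ∫ y, s * fderiv ℝ (fun z => fderiv ℝ g z (EuclideanSpace.single i 1)) (x + s • y)
          (EuclideanSpace.single i 1) * K y := by
      intro i
      rw [integral_neg, ibp (hin i) (hK.of_le (by simp)) hKc, neg_neg]
      congr 1
      ext y
      rw [fderiv_comp_affine ((hpart _).differentiable (by norm_num))]
    simp_rw [e2]
    rw [← integral_finsetSum]
    swap
    · intro i _
      refine Continuous.integrable_of_hasCompactSupport (Continuous.mul (continuous_const.mul ?_)
        hK.continuous) hKc.mul_left
      have : Continuous (fderiv ℝ (fun z => fderiv ℝ g z (EuclideanSpace.single i 1))) :=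
        (hpart _).continuous_fderiv (by norm_num)
      exact (this.comp (by fun_prop)).clm_apply continuous_const
    rw [integral_eq_zero_of_ae]
    refine Eventually.of_forall fun y => ?_
    simp only [Pi.zero_apply]
    rw [← Finset.sum_mul, ← Finset.mul_sum]
    by_cases hy : 1 ≤ ‖y‖
    · simp [hK0 y hy]
    · rcases hs.eq_or_lt with h0 | h0
      · simp [← h0]
      have := hh (x + s • y) (by
        simp only [Metric.mem_ball, dist_self_add_left, norm_smul, Real.norm_eq_abs, abs_of_pos h0]
        push Not at hy
        nlinarith)
      rw [rlap] at this
      simp [this]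
  have hconst := constant_of_has_deriv_right_zero (f := M) (a := 0) (b := r)
    (fun s _ => (hMd s).continuousAt.continuousWithinAt)
    (fun s hs => by
      have := (hMd s).hasDerivWithinAt (s := Ici s)
      rwa [hzero s hs.1 hs.2.le] at this) r ⟨hr, le_rfl⟩
  rw [MVP]
  change M r = _
  rw [hconst, hM]
  simp [integral_const_mul]
  rw [mul_comm]

lemma contDiff_dir {E : Type*} [NormedAddCommGroup E] [NormedSpace ℝ E] {g : E → ℝ}
    (hg : ContDiff ℝ ∞ g) (w : E) : ContDiff ℝ ∞ fun z => fderiv ℝ g z w :=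
  (hg.fderiv_right (m := ∞) (by simp)).clm_apply contDiff_const

lemma mvp_deriv {ι : Type} [Fintype ι] {η : EuclideanSpace ℝ ι → ℝ}
    (hη : ContDiff ℝ ∞ η) (hηc : HasCompactSupport η)
    {g : EuclideanSpace ℝ ι → ℝ} (hg : ContDiff ℝ ∞ g) {x : EuclideanSpace ℝ ι} {r : ℝ}
    (w : EuclideanSpace ℝ ι) (h : ∀ᶠ z in 𝓝 x, MVP η g z r) :
    MVP η (fun z => fderiv ℝ g z w) x r := by
  have hgd : Differentiable ℝ g := hg.differentiable (by simp)
  have h1 : HasDerivAt (fun s : ℝ => ∫ y, g (x + s • w + r • y) * η y)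
      (∫ y, fderiv ℝ g (x + (0 : ℝ) • w + r • y) w * η y) 0 := by
    refine param_deriv hη.continuous hηc (fun s y => g (x + s • w + r • y))
      (fun s y => fderiv ℝ g (x + s • w + r • y) w) ?_ ?_ ?_ 0
    · exact hg.continuous.comp (by fun_prop)
    · exact ((contDiff_dir hg w).continuous.comp (by fun_prop))
    · intro s y
      have h1 : HasDerivAt (fun s : ℝ => x + s • w + r • y) w s := by
        simpa using (((hasDerivAt_id s).smul_const w).const_add x).add_const (r • y)
      exact (hgd (x + s • w + r • y)).hasFDerivAt.comp_hasDerivAt s h1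
  have h2 : HasDerivAt (fun s : ℝ => (∫ y, η y) * g (x + s • w))
      ((∫ y, η y) * fderiv ℝ g (x + (0 : ℝ) • w) w) 0 := by
    have h1 : HasDerivAt (fun s : ℝ => x + s • w) w 0 := by
      simpa using ((hasDerivAt_id (0 : ℝ)).smul_const w).const_add x
    exact ((hgd (x + (0 : ℝ) • w)).hasFDerivAt.comp_hasDerivAt 0 h1).const_mul _
  have h3 : (fun s : ℝ => ∫ y, g (x + s • w + r • y) * η y) =ᶠ[𝓝 0]
      (fun s : ℝ => (∫ y, η y) * g (x + s • w)) := by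
    have hc : Tendsto (fun s : ℝ => x + s • w) (𝓝 0) (𝓝 x) := by
      have : Continuous (fun s : ℝ => x + s • w) := by fun_prop
      simpa using this.tendsto 0
    filter_upwards [hc.eventually h] with s hs
    exact hs
  have := h1.unique (h2.congr_of_eventuallyEq h3)
  simpa [MVP] using this

lemma grad_bound {ι : Type} [Fintype ι] {η : EuclideanSpace ℝ ι → ℝ}
    (hη : ContDiff ℝ ∞ η) (hηc : HasCompactSupport η) (hη0 : ∀ y, 1 ≤ ‖y‖ → η y = 0)
    (hpos : 0 < ∫ y, η y)
    {g : EuclideanSpace ℝ ι → ℝ} (hg : ContDiff ℝ ∞ g) {x : EuclideanSpace ℝ ι} {r B : ℝ}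
    (hr : 0 < r)
    (w : EuclideanSpace ℝ ι) (hw : ‖w‖ ≤ 1) (h : ∀ᶠ z in 𝓝 x, MVP η g z r)
    (hB : ∀ z ∈ Metric.closedBall x r, |g z| ≤ B) :
    |fderiv ℝ g x w| ≤ ((∫ y, ‖fderiv ℝ η y‖) / ∫ y, η y) / r * B := by
  have hgd : Differentiable ℝ g := hg.differentiable (by simp)
  have h1 := mvp_deriv hη hηc hg w h
  rw [MVP] at h1
  have haff : ContDiff ℝ 1 (fun y : EuclideanSpace ℝ ι => g (x + r • y)) :=
    (hg.of_le (by simp)).comp (by fun_prop)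
  have h2 := ibp haff (hη.of_le (by simp) : ContDiff ℝ 1 η) hηc w
  simp_rw [fderiv_comp_affine hgd, mul_assoc, integral_const_mul] at h2
  rw [h1] at h2
  have hts : tsupport η ⊆ Metric.closedBall 0 1 := by
    refine closure_minimal ?_ Metric.isClosed_closedBall
    intro y hy
    by_contra hcon
    simp at hcon
    exact hy (hη0 y hcon.le)
  have hcf : HasCompactSupport (fun y => ‖fderiv ℝ η y‖) := (hηc.fderiv (𝕜 := ℝ)).norm
  have hcont : Continuous (fun y => ‖fderiv ℝ η y‖) := (hη.continuous_fderiv (by simp)).norm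
  have hintg := hcont.integrable_of_hasCompactSupport (μ := volume) hcf
  have h3 : |∫ y, g (x + r • y) * fderiv ℝ η y w| ≤ B * ∫ y, ‖fderiv ℝ η y‖ := by
    rw [← integral_const_mul, ← Real.norm_eq_abs]
    refine norm_integral_le_of_norm_le (hintg.const_mul B) (Eventually.of_forall fun y => ?_)
    by_cases hy : ‖y‖ ≤ 1
    · rw [norm_mul]
      have hb := hB (x + r • y) (by
        simp only [Metric.mem_closedBall, dist_self_add_left, norm_smul, Real.norm_eq_abs,
          abs_of_pos hr]
        nlinarith)
      have hB0 : 0 ≤ B := (abs_nonneg _).trans hb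
      have : ‖fderiv ℝ η y w‖ ≤ ‖fderiv ℝ η y‖ := by
        refine (ContinuousLinearMap.le_opNorm _ _).trans ?_
        exact mul_le_of_le_one_right (norm_nonneg _) hw
      exact mul_le_mul hb this (norm_nonneg _) hB0
    · have hy' : y ∉ tsupport η := fun hc => hy (by simpa using hts hc)
      have : fderiv ℝ η y = 0 := fderiv_of_notMem_tsupport (𝕜 := ℝ) hy'
      simp [this]
  rw [h2, abs_neg, abs_mul, abs_mul, abs_of_pos hr, abs_of_pos hpos] at h3
  rw [div_div, div_mul_eq_mul_div, le_div_iff₀ (by positivity)]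
  linarith

/-- Iterated directional derivatives. -/
def iterD {E : Type*} [NormedAddCommGroup E] [NormedSpace ℝ E] (w : E) (g : E → ℝ) : ℕ → E → ℝ
  | 0 => g
  | (k + 1) => fun z => fderiv ℝ (iterD w g k) z w

lemma iterD_contDiff {E : Type*} [NormedAddCommGroup E] [NormedSpace ℝ E] (w : E) {g : E → ℝ}
    (hg : ContDiff ℝ ∞ g) (k : ℕ) : ContDiff ℝ ∞ (iterD w g k) := by
  induction k with
  | zero => exact hg
  | succ k ih => exact contDiff_dir ih w

lemma iterD_mvp {ι : Type} [Fintype ι] {η : EuclideanSpace ℝ ι → ℝ}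
    (hη : ContDiff ℝ ∞ η) (hηc : HasCompactSupport η)
    {g : EuclideanSpace ℝ ι → ℝ} (hg : ContDiff ℝ ∞ g) {x₀ : EuclideanSpace ℝ ι} {R : ℝ}
    (w : EuclideanSpace ℝ ι) (h : ∀ x r, 0 < r → dist x x₀ + r < R → MVP η g x r) (k : ℕ) :
    ∀ x r, 0 < r → dist x x₀ + r < R → MVP η (iterD w g k) x r := by
  induction k with
  | zero => exact h
  | succ k ih =>
    intro x r hr hx
    refine mvp_deriv hη hηc (iterD_contDiff w hg k) w ?_
    have : Continuous fun z => dist z x₀ + r := by fun_prop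
    filter_upwards [this.tendsto x |>.eventually (gt_mem_nhds hx)] with z hz
    exact ih z r hr hz

lemma iterD_bound {ι : Type} [Fintype ι] {η : EuclideanSpace ℝ ι → ℝ}
    (hη : ContDiff ℝ ∞ η) (hηc : HasCompactSupport η) (hη0 : ∀ y, 1 ≤ ‖y‖ → η y = 0)
    (hpos : 0 < ∫ y, η y)
    {g : EuclideanSpace ℝ ι → ℝ} (hg : ContDiff ℝ ∞ g) {x₀ : EuclideanSpace ℝ ι} {R M ρ : ℝ}
    (hρ : 0 < ρ)
    (w : EuclideanSpace ℝ ι) (hw : ‖w‖ ≤ 1)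
    (h : ∀ x r, 0 < r → dist x x₀ + r < R → MVP η g x r)
    (hM : ∀ z ∈ Metric.ball x₀ R, |g z| ≤ M) (k : ℕ) :
    ∀ x, dist x x₀ < R - k * ρ →
      |iterD w g k x| ≤ (((∫ y, ‖fderiv ℝ η y‖) / ∫ y, η y) / ρ) ^ k * M := by
  induction k with
  | zero =>
    intro x hx
    simpa [iterD] using hM x (by simpa using hx)
  | succ k ih =>
    intro x hx
    push_cast at hx
    have hkρ : 0 ≤ k * ρ := by positivity
    have := grad_bound hη hηc hη0 hpos (iterD_contDiff w hg k) hρ (x := x) w hw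
      (B := (((∫ y, ‖fderiv ℝ η y‖) / ∫ y, η y) / ρ) ^ k * M) ?_ ?_
    · rw [pow_succ', mul_assoc]
      exact this
    · have hc : Continuous fun z => dist z x₀ + ρ := by fun_prop
      filter_upwards [hc.tendsto x |>.eventually (gt_mem_nhds (show dist x x₀ + ρ < R by linarith))] with z hz
      exact iterD_mvp hη hηc hg w h k z ρ hρ hz
    · intro z hz
      refine ih z ?_
      have := dist_triangle z x x₀
      rw [Metric.mem_closedBall] at hz
      linarith

lemma iteratedDeriv_line {E : Type*} [NormedAddCommGroup E] [NormedSpace ℝ E] (x w : E) {g : E → ℝ}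
    (hg : ContDiff ℝ ∞ g) (k : ℕ) :
    iteratedDeriv k (fun t : ℝ => g (x + t • w)) = fun t => iterD w g k (x + t • w) := by
  induction k with
  | zero => simp [iterD]
  | succ k ih =>
    rw [iteratedDeriv_succ, ih]
    ext t
    have h1 : HasDerivAt (fun s : ℝ => x + s • w) w t := by
      simpa using ((hasDerivAt_id t).smul_const w).const_add x
    exact (((iterD_contDiff w hg k).differentiable (by simp) (x + t • w)).hasFDerivAt.comp_hasDerivAt
      t h1).deriv

lemma uc_smooth {ι : Type} [Fintype ι] {η : EuclideanSpace ℝ ι → ℝ}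
    (hη : ContDiff ℝ ∞ η) (hηc : HasCompactSupport η) (hη0 : ∀ y, 1 ≤ ‖y‖ → η y = 0)
    (hpos : 0 < ∫ y, η y) :
    ∃ κ > 0, κ ≤ 1 / 2 ∧ ∀ (g : EuclideanSpace ℝ ι → ℝ), ContDiff ℝ ∞ g →
      ∀ (x₀ : EuclideanSpace ℝ ι) (R : ℝ), 0 < R →
      (∀ x r, 0 < r → dist x x₀ + r < R → MVP η g x r) →
      (∀ᶠ z in 𝓝 x₀, g z = 0) → ∀ z, dist z x₀ < κ * R → g z = 0 := by
  set A : ℝ := (∫ y, ‖fderiv ℝ η y‖) / ∫ y, η y with hA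
  have hA0 : 0 ≤ A := div_nonneg (integral_nonneg fun _ => norm_nonneg _) hpos.le
  have he : 1 < Real.exp 1 := by
    have := Real.add_one_lt_exp (x := 1) one_ne_zero
    linarith
  have hden : 2 ≤ 2 * (A + 1) * Real.exp 1 := by nlinarith
  refine ⟨1 / (2 * (A + 1) * Real.exp 1), by positivity, ?_, ?_⟩
  · exact one_div_le_one_div_of_le (by norm_num) hden
  intro g hg x₀ R hR hmvp hloc z hz
  rcases eq_or_ne z x₀ with rfl | hne
  · exact hloc.self_of_nhds
  set t := dist z x₀ with ht
  have htpos : 0 < t := dist_pos.2 hne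
  have htR : t < R / 2 := by
    have : 1 / (2 * (A + 1) * Real.exp 1) ≤ 1 / 2 := one_div_le_one_div_of_le (by norm_num) hden
    nlinarith
  set w := t⁻¹ • (z - x₀) with hwdef
  have hw : ‖w‖ = 1 := by
    rw [hwdef, norm_smul, ← dist_eq_norm, ← ht, norm_inv, Real.norm_eq_abs, abs_of_pos htpos]
    exact inv_mul_cancel₀ htpos.ne'
  have hzw : x₀ + t • w = z := by
    rw [hwdef, smul_smul, mul_inv_cancel₀ htpos.ne', one_smul]
    abel
  obtain ⟨M, hM⟩ := (isCompact_closedBall x₀ R).exists_bound_of_continuousOn hg.continuous.continuousOn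
  have hM' : ∀ y ∈ Metric.ball x₀ R, |g y| ≤ M := fun y hy => hM y (Metric.ball_subset_closedBall hy)
  have hM0 : 0 ≤ M := (abs_nonneg _).trans (hM' x₀ (Metric.mem_ball_self hR))
  set φ : ℝ → ℝ := fun s => g (x₀ + s • w) with hφ
  have hφs : ContDiff ℝ ∞ φ := hg.comp (by fun_prop)
  have hφ0 : φ =ᶠ[𝓝 0] fun _ => 0 := by
    have hc : Continuous (fun s : ℝ => x₀ + s • w) := by fun_prop
    have hc' : Tendsto (fun s : ℝ => x₀ + s • w) (𝓝 0) (𝓝 x₀) := by simpa using hc.tendsto 0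
    exact hc'.eventually hloc
  set q := 2 * A * t * Real.exp 1 / R with hq
  have hq0 : 0 ≤ q := by positivity
  have hq1 : q < 1 := by
    rw [hq, div_lt_one hR]
    have h1 : t * (2 * (A + 1) * Real.exp 1) < R := by
      rw [div_mul_eq_mul_div, one_mul, lt_div_iff₀ (by positivity)] at hz
      exact hz
    nlinarith
  have key : ∀ n : ℕ, |g z| ≤ M * (((n + 1 : ℕ) : ℝ) * q ^ (n + 1)) := by
    intro n
    have hud : UniqueDiffOn ℝ (Icc 0 t) := uniqueDiffOn_Icc htpos
    have hn : (0 : ℝ) < ((n + 1 : ℕ) : ℝ) := by positivity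
    have hfac : (0 : ℝ) < (n.factorial : ℝ) := by exact_mod_cast n.factorial_pos
    set ρ := R / (2 * ((n + 1 : ℕ) : ℝ)) with hρ
    have hρpos : 0 < ρ := by positivity
    have hbd := iterD_bound hη hηc hη0 hpos hg hρpos w hw.le hmvp hM' (n + 1)
    rw [← hA] at hbd
    have htay := taylor_mean_remainder_bound (f := φ) (a := 0) (b := t) (x := t) (n := n)
      (C := (A / ρ) ^ (n + 1) * M) htpos.le ((hφs.of_le (by exact_mod_cast le_top)).contDiffOn)
      ⟨htpos.le, le_rfl⟩ ?_
    · have hz0 : taylorWithinEval φ n (Icc 0 t) 0 t = 0 := by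
        rw [taylor_within_apply]
        refine Finset.sum_eq_zero fun k _ => ?_
        rw [iteratedDerivWithin_eq_iteratedDeriv hud
          (hφs.of_le (by exact_mod_cast le_top)).contDiffAt ⟨le_rfl, htpos.le⟩]
        rw [hφ0.iteratedDeriv_eq]
        simp
      rw [hz0, sub_zero, sub_zero, Real.norm_eq_abs] at htay
      simp only [hφ, hzw] at htay
      refine htay.trans ?_
      have hexp := Real.pow_div_factorial_le_exp (x := ((n + 1 : ℕ) : ℝ)) hn.le (n + 1)
      have hexp' : Real.exp ((n + 1 : ℕ) : ℝ) = Real.exp 1 ^ (n + 1) := by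
        rw [← Real.exp_nat_mul, mul_one]
      rw [hexp', Nat.factorial_succ, Nat.cast_mul, div_le_iff₀ (by positivity)] at hexp
      have e1 : A / ρ = 2 * A / R * ((n + 1 : ℕ) : ℝ) := by
        rw [hρ]
        field_simp
      have e2 : q = 2 * A / R * t * Real.exp 1 := by
        rw [hq]
        ring
      rw [e1, e2, div_le_iff₀ hfac]
      calc (2 * A / R * ((n + 1 : ℕ) : ℝ)) ^ (n + 1) * M * t ^ (n + 1)
          = (M * (2 * A / R * t) ^ (n + 1)) * ((n + 1 : ℕ) : ℝ) ^ (n + 1) := by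
            rw [mul_pow, mul_pow]
            ring
        _ ≤ (M * (2 * A / R * t) ^ (n + 1)) *
            (Real.exp 1 ^ (n + 1) * (((n + 1 : ℕ) : ℝ) * n.factorial)) := by
            gcongr
        _ = _ := by
            rw [mul_pow (2 * A / R * t)]
            ring
    · intro s hs
      rw [iteratedDerivWithin_eq_iteratedDeriv hud
        (hφs.of_le (by exact_mod_cast le_top)).contDiffAt hs, iteratedDeriv_line x₀ w hg]
      refine hbd _ ?_
      rw [dist_self_add_left, norm_smul, hw, mul_one, Real.norm_eq_abs, abs_of_nonneg hs.1]
      have : ((n + 1 : ℕ) : ℝ) * ρ = R / 2 := by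
        rw [hρ]
        field_simp
      rw [this]
      linarith [hs.2]
  have hlim : Tendsto (fun n : ℕ => M * (((n + 1 : ℕ) : ℝ) * q ^ (n + 1))) atTop (𝓝 (M * 0)) :=
    ((tendsto_self_mul_const_pow_of_lt_one hq0 hq1).comp (tendsto_add_atTop_nat 1)).const_mul M
  rw [mul_zero] at hlim
  have := ge_of_tendsto' hlim key
  exact abs_nonpos_iff.1 this

open scoped Convolution in
lemma smooth_mean {ι : Type} [Fintype ι] {η : EuclideanSpace ℝ ι → ℝ}
    (hη : ContDiff ℝ ∞ η) (hηc : HasCompactSupport η)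
    {g : EuclideanSpace ℝ ι → ℝ} (hg : Continuous g) {r : ℝ} (hr : 0 < r) :
    ContDiff ℝ ∞ (fun x => ∫ y, g (x + r • y) * η y) := by
  have hψs : ContDiff ℝ ∞ (fun y : EuclideanSpace ℝ ι => η ((-r⁻¹) • y)) := hη.comp (by fun_prop)
  have hψc : HasCompactSupport (fun y : EuclideanSpace ℝ ι => η ((-r⁻¹) • y)) :=
    hηc.comp_smul (by simpa using hr.ne')
  have h1 := hψc.contDiff_convolution_right (ContinuousLinearMap.mul ℝ ℝ)
    (hg.locallyIntegrable (μ := volume)) hψs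
  have h2 : (fun x => ∫ y, g (x + r • y) * η y) = fun x =>
      |(r ^ Module.finrank ℝ (EuclideanSpace ℝ ι))⁻¹| •
      (g ⋆[ContinuousLinearMap.mul ℝ ℝ, volume] (fun y => η ((-r⁻¹) • y))) x := by
    ext x
    have e1 := Measure.integral_comp_smul (volume : Measure (EuclideanSpace ℝ ι))
      (fun z => g (x + z) * η (r⁻¹ • z)) r
    simp only [smul_smul, inv_mul_cancel₀ hr.ne', one_smul] at e1
    rw [e1]
    congr 1
    rw [convolution_def]
    rw [← integral_add_left_eq_self (fun t => ((ContinuousLinearMap.mul ℝ ℝ) (g t))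
      (η ((-r⁻¹) • (x - t)))) x]
    simp
  rw [h2]
  exact h1.const_smul _

lemma uc_harmonic (ι : Type) [Fintype ι] [DecidableEq ι] :
    ∃ κ > 0, ∀ (g : EuclideanSpace ℝ ι → ℝ), ContDiff ℝ 2 g →
      ∀ (x₀ : EuclideanSpace ℝ ι) (R : ℝ), 0 < R →
      (∀ x ∈ Metric.ball x₀ R, rlap g x = 0) →
      (∀ᶠ z in 𝓝 x₀, g z = 0) → ∀ z, dist z x₀ < κ * R → g z = 0 := by
  obtain ⟨K, η, hK, hη, hKc, hηc, hK0, hη0, hpos, hKη⟩ := exists_kernel (ι := ι)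
  obtain ⟨κ, hκ, hκ2, H⟩ := uc_smooth hη hηc hη0 hpos
  refine ⟨κ / 2, by positivity, ?_⟩
  intro g hg x₀ R hR hh hloc z hz
  have hm : ∀ x r, 0 < r → dist x x₀ + r ≤ R → MVP η g x r := by
    intro x r hr hx
    refine mvp_of_harmonic hK hη hKc hηc hK0 hKη hg hr.le fun y hy => hh y ?_
    have := dist_triangle y x x₀
    rw [Metric.mem_ball] at hy ⊢
    linarith
  set h : EuclideanSpace ℝ ι → ℝ := fun x => (∫ y, η y)⁻¹ * ∫ y, g (x + (R / 2) • y) * η y with hdef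
  have hhs : ContDiff ℝ ∞ h := contDiff_const.mul (smooth_mean hη hηc hg.continuous (by positivity))
  have heq : ∀ x, dist x x₀ ≤ R / 2 → h x = g x := by
    intro x hx
    have := hm x (R / 2) (by positivity) (by linarith)
    rw [MVP] at this
    rw [hdef]
    simp only
    rw [this, ← mul_assoc, inv_mul_cancel₀ hpos.ne', one_mul]
  have hz2 : dist z x₀ ≤ R / 2 := by nlinarith
  rw [← heq z hz2]
  refine H h hhs x₀ (R / 2) (by positivity) ?_ ?_ z (by linarith)
  · intro x r hr hx
    have h1 := hm x r hr (by linarith)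
    rw [MVP] at h1 ⊢
    rw [heq x (by linarith), ← h1]
    congr 1
    ext y
    by_cases hy : 1 ≤ ‖y‖
    · simp [hη0 y hy]
    · rw [heq]
      push Not at hy
      have h2 := dist_triangle (x + r • y) x x₀
      rw [dist_self_add_left, norm_smul, Real.norm_eq_abs, abs_of_pos hr] at h2
      nlinarith
  · filter_upwards [hloc, Metric.closedBall_mem_nhds x₀ (half_pos hR)] with y hy hy2
    rw [heq y hy2, hy]

lemma rlap_congr {ι : Type} [Fintype ι] [DecidableEq ι] {g h : EuclideanSpace ℝ ι → ℝ}
    {x : EuclideanSpace ℝ ι} (e : g =ᶠ[𝓝 x] h) : rlap g x = rlap h x := by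
  unfold rlap
  refine Finset.sum_congr rfl fun i _ => ?_
  have : (fun y => fderiv ℝ g y (EuclideanSpace.single i 1)) =ᶠ[𝓝 x]
      fun y => fderiv ℝ h y (EuclideanSpace.single i 1) := by
    filter_upwards [e.fderiv (𝕜 := ℝ)] with y hy
    rw [hy]
  rw [this.fderiv_eq]

/-- Projection forgetting the additional variable. -/
def projP (d : ℕ) : EuclideanSpace ℝ (Option (Fin d)) →L[ℝ] EuclideanSpace ℝ (Fin d) :=
  LinearMap.toContinuousLinearMap
    { toFun := fun z => WithLp.toLp 2 (fun i => z (some i))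
      map_add' := fun _ _ => rfl
      map_smul' := fun _ _ => rfl }

/-- The additional variable. -/
def projL (d : ℕ) : EuclideanSpace ℝ (Option (Fin d)) →L[ℝ] ℝ :=
  LinearMap.toContinuousLinearMap
    { toFun := fun z => z none
      map_add' := fun _ _ => rfl
      map_smul' := fun _ _ => rfl }

lemma projP_apply (z : EuclideanSpace ℝ (Option (Fin d))) (i : Fin d) :
    projP d z i = z (some i) := rfl

lemma projL_apply (z : EuclideanSpace ℝ (Option (Fin d))) : projL d z = z none := rfl

lemma projP_some (i : Fin d) : projP d (EuclideanSpace.single (some i) 1) =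
    EuclideanSpace.single i 1 := by
  ext j
  rw [projP_apply]
  simp [Pi.single_apply]

lemma projP_none : projP d (EuclideanSpace.single none 1) = 0 := by
  ext j
  rw [projP_apply]
  simp

lemma projL_some (i : Fin d) : projL d (EuclideanSpace.single (some i) 1) = 0 := by
  rw [projL_apply]
  simp

lemma projL_none : projL d (EuclideanSpace.single none 1) = 1 := by
  rw [projL_apply]
  simp

/-- Lift of a Helmholtz solution to a harmonic function. -/
def lift (lam : ℝ) (v : EuclideanSpace ℝ (Fin d) → ℝ) (z : EuclideanSpace ℝ (Option (Fin d))) : ℝ :=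
  v (projP d z) * Real.exp (lam * projL d z)

lemma fderiv_lift (lam : ℝ) {v : EuclideanSpace ℝ (Fin d) → ℝ} (hv : Differentiable ℝ v)
    (z e : EuclideanSpace ℝ (Option (Fin d))) :
    fderiv ℝ (lift lam v) z e =
      lift lam (fun y => fderiv ℝ v y (projP d e)) z + lam * projL d e * lift lam v z := by
  have h1 : HasFDerivAt (fun z => v (projP d z)) ((fderiv ℝ v (projP d z)).comp (projP d)) z :=
    (hv (projP d z)).hasFDerivAt.comp z (projP d).hasFDerivAt
  have h2 : HasFDerivAt (fun z => Real.exp (lam * projL d z))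
      (Real.exp (lam * projL d z) • (lam • projL d)) z :=
    ((projL d).hasFDerivAt.const_mul lam).exp
  have h3 := (h1.mul h2).fderiv
  change fderiv ℝ ((fun z => v (projP d z)) * (fun z => Real.exp (lam * projL d z))) z e = _
  rw [h3]
  simp [lift]
  ring

lemma rlap_lift (lam : ℝ) {v : EuclideanSpace ℝ (Fin d) → ℝ} (hv : ContDiff ℝ 2 v)
    (z : EuclideanSpace ℝ (Option (Fin d))) :
    rlap (lift lam v) z =
      (rlap v (projP d z) + lam ^ 2 * v (projP d z)) * Real.exp (lam * projL d z) := by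
  have hvd : Differentiable ℝ v := hv.differentiable (by norm_num)
  have hv1 : ContDiff ℝ 1 (fderiv ℝ v) := hv.fderiv_right (by norm_num)
  have hpart : ∀ w, Differentiable ℝ fun z => fderiv ℝ v z w :=
    fun w => (hv1.clm_apply contDiff_const).differentiable (by norm_num)
  rw [rlap, Fintype.sum_option]
  have e0 : ∀ y, fderiv ℝ (lift lam v) y (EuclideanSpace.single none 1) = lam * lift lam v y := by
    intro y
    rw [fderiv_lift lam hvd, projP_none, projL_none]
    simp [lift]
  have e1 : ∀ i, ∀ y, fderiv ℝ (lift lam v) y (EuclideanSpace.single (some i) 1) =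
      lift lam (fun y => fderiv ℝ v y (EuclideanSpace.single i 1)) y := by
    intro i y
    rw [fderiv_lift lam hvd, projP_some, projL_some]
    simp
  have hl : Differentiable ℝ (lift lam v) := by
    unfold lift
    have := (projL d).differentiable
    exact (hvd.comp (projP d).differentiable).mul ((this.const_mul lam).exp)
  simp_rw [e0, e1]
  have e2 : fderiv ℝ (fun y => lam * lift lam v y) z (EuclideanSpace.single none 1) =
      lam ^ 2 * lift lam v z := by
    rw [fderiv_const_mul (hl z)]
    simp [e0]
    ring
  rw [e2]
  have e3 : ∀ i, fderiv ℝ (lift lam (fun y => fderiv ℝ v y (EuclideanSpace.single i 1))) z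
      (EuclideanSpace.single (some i) 1) =
      fderiv ℝ (fun y => fderiv ℝ v y (EuclideanSpace.single i 1)) (projP d z)
        (EuclideanSpace.single i 1) * Real.exp (lam * projL d z) := by
    intro i
    rw [fderiv_lift lam (hpart _), projP_some, projL_some]
    simp [lift]
  have e3' : ∀ i, fderiv ℝ (fun y => lift lam (fun y => fderiv ℝ v y (EuclideanSpace.single i 1)) y) z
      (EuclideanSpace.single (some i) 1) =
      fderiv ℝ (fun y => fderiv ℝ v y (EuclideanSpace.single i 1)) (projP d z)
        (EuclideanSpace.single i 1) * Real.exp (lam * projL d z) := e3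
  simp_rw [e3']
  rw [← Finset.sum_mul, rlap, lift]
  ring

lemma uc_helmholtz (d : ℕ) :
    ∃ κ > 0, ∀ (lam : ℝ) (v : EuclideanSpace ℝ (Fin d) → ℝ), ContDiff ℝ 2 v →
      ∀ (x₀ : EuclideanSpace ℝ (Fin d)) (R : ℝ), 0 < R →
      (∀ x ∈ Metric.ball x₀ R, rlap v x + lam ^ 2 * v x = 0) →
      (∀ᶠ z in 𝓝 x₀, v z = 0) → ∀ z, dist z x₀ < κ * R → v z = 0 := by
  obtain ⟨κ, hκ, H⟩ := uc_harmonic (Option (Fin d))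
  refine ⟨κ, hκ, ?_⟩
  intro lam v hv x₀ R hR hh hloc z hz
  let J : EuclideanSpace ℝ (Fin d) → EuclideanSpace ℝ (Option (Fin d)) := fun x =>
    WithLp.toLp 2 (fun o => o.elim 0 (fun i => x i))
  have hPJ : ∀ x, projP d (J x) = x := by
    intro x
    ext i
    rfl
  have hLJ : ∀ x, projL d (J x) = 0 := fun x => rfl
  have hdJ : ∀ x y, dist (J x) (J y) = dist x y := by
    intro x y
    rw [EuclideanSpace.dist_eq, EuclideanSpace.dist_eq, Fintype.sum_option]
    simp [J]
  have hPd : ∀ a b, dist (projP d a) (projP d b) ≤ dist a b := by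
    intro a b
    rw [EuclideanSpace.dist_eq, EuclideanSpace.dist_eq, Fintype.sum_option]
    apply Real.sqrt_le_sqrt
    simp only [projP_apply]
    have : 0 ≤ dist (a none) (b none) ^ 2 := by positivity
    linarith
  have hls : ContDiff ℝ 2 (lift lam v) := by
    unfold lift
    have := (projL d).contDiff (n := 2)
    exact (hv.comp (projP d).contDiff).mul ((contDiff_const.mul this).exp)
  have := H (lift lam v) hls (J x₀) R hR ?_ ?_ (J z) (by rw [hdJ]; exact hz)
  · simpa [lift, hPJ, hLJ] using this
  · intro y hy
    rw [rlap_lift lam hv, hh (projP d y) ?_, zero_mul]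
    rw [Metric.mem_ball] at hy ⊢
    calc dist (projP d y) x₀ = dist (projP d y) (projP d (J x₀)) := by rw [hPJ]
      _ ≤ _ := hPd _ _
      _ < R := hy
  · have hc : Tendsto (projP d) (𝓝 (J x₀)) (𝓝 x₀) := by
      have := (projP d).continuous.tendsto (J x₀)
      rwa [hPJ] at this
    filter_upwards [hc.eventually hloc] with y hy
    simp [lift, hy]

lemma indicator_hasFDerivAt {E F : Type*} [NormedAddCommGroup E] [NormedSpace ℝ E]
    [NormedAddCommGroup F] [NormedSpace ℝ F] {g : E → F} (hg : Differentiable ℝ g)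
    {Ω : Set E} (hΩ : IsOpen Ω) {x : E}
    (hx : x ∈ frontier Ω → g x = 0 ∧ fderiv ℝ g x = 0) :
    HasFDerivAt (Ω.indicator g) (Ω.indicator (fderiv ℝ g) x) x := by
  by_cases h1 : x ∈ Ω
  · rw [indicator_of_mem h1]
    refine (hg x).hasFDerivAt.congr_of_eventuallyEq ?_
    filter_upwards [hΩ.mem_nhds h1] with y hy
    rw [indicator_of_mem hy]
  rw [indicator_of_notMem h1]
  by_cases h2 : x ∈ closure Ω
  · obtain ⟨h3, h4⟩ := hx ⟨h2, by rwa [hΩ.interior_eq]⟩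
    have h5 := (hg x).hasFDerivAt
    rw [h4, hasFDerivAt_iff_isLittleO] at h5
    rw [hasFDerivAt_iff_isLittleO]
    refine Asymptotics.IsBigO.trans_isLittleO ?_ h5
    refine Asymptotics.IsBigO.of_bound 1 (Eventually.of_forall fun y => ?_)
    rw [indicator_of_notMem h1, h3]
    simpa using norm_indicator_le_norm_self g y
  · refine (hasFDerivAt_const (0 : F) x).congr_of_eventuallyEq ?_
    filter_upwards [isClosed_closure.isOpen_compl.mem_nhds h2] with y hy
    rw [indicator_of_notMem (fun h => hy (subset_closure h))]

lemma indicator_continuousAt {E F : Type*} [TopologicalSpace E]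
    [NormedAddCommGroup F] {g : E → F} (hg : Continuous g)
    {Ω : Set E} (hΩ : IsOpen Ω) {x : E} (hx : x ∈ frontier Ω → g x = 0) :
    ContinuousAt (Ω.indicator g) x := by
  by_cases h1 : x ∈ Ω
  · refine hg.continuousAt.congr ?_
    filter_upwards [hΩ.mem_nhds h1] with y hy
    rw [indicator_of_mem hy]
  by_cases h2 : x ∈ closure Ω
  · have h3 := hx ⟨h2, by rwa [hΩ.interior_eq]⟩
    rw [ContinuousAt, indicator_of_notMem h1]
    have h5 := hg.tendsto x
    rw [h3] at h5
    exact squeeze_zero_norm (fun y => norm_indicator_le_norm_self g y) (by simpa using h5.norm)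
  · refine (continuousAt_const (y := (0 : F))).congr ?_
    filter_upwards [isClosed_closure.isOpen_compl.mem_nhds h2] with y hy
    rw [indicator_of_notMem (fun h => hy (subset_closure h))]

lemma indicator_contDiffAt {E : Type*} [NormedAddCommGroup E] [NormedSpace ℝ E]
    {v : E → ℝ} (hv : ContDiff ℝ 2 v) {Ω W : Set E} (hΩ : IsOpen Ω) (hW : IsOpen W)
    (h : ∀ x ∈ W ∩ frontier Ω, v x = 0 ∧ fderiv ℝ v x = 0 ∧ fderiv ℝ (fderiv ℝ v) x = 0)
    {x : E} (hx : x ∈ W) : ContDiffAt ℝ 2 (Ω.indicator v) x := by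
  have hv1 : ContDiff ℝ 1 (fderiv ℝ v) := hv.fderiv_right (by norm_num)
  rw [show (2 : WithTop ℕ∞) = ((1 : ℕ) : WithTop ℕ∞) + 1 by norm_num]
  rw [contDiffAt_succ_iff_hasFDerivAt]
  refine ⟨Ω.indicator (fderiv ℝ v), ⟨W, hW.mem_nhds hx, fun y hy => ?_⟩, ?_⟩
  · exact indicator_hasFDerivAt (hv.differentiable (by norm_num)) hΩ
      fun hf => ⟨(h y ⟨hy, hf⟩).1, (h y ⟨hy, hf⟩).2.1⟩
  rw [show ((1 : ℕ) : WithTop ℕ∞) = ((0 : ℕ) : WithTop ℕ∞) + 1 by simp]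
  rw [contDiffAt_succ_iff_hasFDerivAt]
  refine ⟨Ω.indicator (fderiv ℝ (fderiv ℝ v)), ⟨W, hW.mem_nhds hx, fun y hy => ?_⟩, ?_⟩
  · exact indicator_hasFDerivAt (hv1.differentiable (by norm_num)) hΩ
      fun hf => (h y ⟨hy, hf⟩).2
  refine contDiffAt_zero.2 ⟨W, hW.mem_nhds hx, fun y hy => ?_⟩
  exact (indicator_continuousAt (hv1.continuous_fderiv (by norm_num)) hΩ
    fun hf => (h y ⟨hy, hf⟩).2.2).continuousWithinAt

lemma rlap_eq {ι : Type} [Fintype ι] [DecidableEq ι] {g : EuclideanSpace ℝ ι → ℝ}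
    {x : EuclideanSpace ℝ ι} (hg : DifferentiableAt ℝ (fderiv ℝ g) x) :
    rlap g x = ∑ i : ι, fderiv ℝ (fderiv ℝ g) x (EuclideanSpace.single i 1)
      (EuclideanSpace.single i 1) := by
  unfold rlap
  refine Finset.sum_congr rfl fun i _ => ?_
  rw [fderiv_clm_apply hg (by fun_prop)]
  simp

lemma rlap_indicator {v : EuclideanSpace ℝ (Fin d) → ℝ} (hv : ContDiff ℝ 2 v)
    {Ω W : Set (EuclideanSpace ℝ (Fin d))} (hΩ : IsOpen Ω) (hW : IsOpen W)
    (h : ∀ x ∈ W ∩ frontier Ω, v x = 0 ∧ fderiv ℝ v x = 0 ∧ fderiv ℝ (fderiv ℝ v) x = 0)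
    {x : EuclideanSpace ℝ (Fin d)} (hx : x ∈ W) (hxΩ : x ∉ Ω) : rlap (Ω.indicator v) x = 0 := by
  have hv1 : ContDiff ℝ 1 (fderiv ℝ v) := hv.fderiv_right (by norm_num)
  have e : fderiv ℝ (Ω.indicator v) =ᶠ[𝓝 x] Ω.indicator (fderiv ℝ v) := by
    filter_upwards [hW.mem_nhds hx] with y hy
    exact (indicator_hasFDerivAt (hv.differentiable (by norm_num)) hΩ
      fun hf => ⟨(h y ⟨hy, hf⟩).1, (h y ⟨hy, hf⟩).2.1⟩).fderiv
  have h2 := (indicator_hasFDerivAt (hv1.differentiable (by norm_num)) hΩ (x := x)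
      fun hf => (h x ⟨hx, hf⟩).2).congr_of_eventuallyEq e
  rw [rlap_eq h2.differentiableAt, h2.fderiv, indicator_of_notMem hxΩ]
  simp

lemma hess_zero {v f : EuclideanSpace ℝ (Fin d) → ℝ} (hv : ContDiff ℝ 2 v)
    {x : EuclideanSpace ℝ (Fin d)} (hf : ContDiff ℝ ∞ f) (hfx : f x = 0)
    (hdf : fderiv ℝ f x ≠ 0) (h : ∀ᶠ y in 𝓝 x, f y = 0 → fderiv ℝ v y = 0)
    (hlap : rlap v x = 0) : fderiv ℝ (fderiv ℝ v) x = 0 := by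
  have hv1 : ContDiff ℝ 1 (fderiv ℝ v) := hv.fderiv_right (by norm_num)
  have hvd := hv1.differentiable (by norm_num) x
  set e : Fin d → EuclideanSpace ℝ (Fin d) := fun i => EuclideanSpace.single i 1 with he
  set H := fderiv ℝ (fderiv ℝ v) x with hH
  have hc : ∀ i, ∃ c : ℝ, ∀ w, H w (e i) = c * fderiv ℝ f x w := by
    intro i
    have hφ : ContDiff ℝ 1 (fun y => fderiv ℝ v y (e i)) := hv1.clm_apply contDiff_const
    have hφd : ∀ w, fderiv ℝ (fun y => fderiv ℝ v y (e i)) x w = H w (e i) := by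
      intro w
      rw [fderiv_clm_apply hvd (by fun_prop)]
      simp [hH]
    have hext : IsLocalExtrOn (fun y => fderiv ℝ v y (e i)) {y | f y = f x} x := by
      left
      have h0 : fderiv ℝ v x = 0 := h.self_of_nhds hfx
      filter_upwards [nhdsWithin_le_nhds h, self_mem_nhdsWithin] with y hy hy2
      replace hy2 : f y = 0 := Eq.trans hy2 hfx
      simp [hy hy2, h0]
    obtain ⟨a, b, hab, heq⟩ := hext.exists_multipliers_of_hasStrictFDerivAt_1d
      (hf.contDiffAt.hasStrictFDerivAt (by simp)) (hφ.contDiffAt.hasStrictFDerivAt (by norm_num))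
    have hb : b ≠ 0 := by
      rintro rfl
      rw [zero_smul, add_zero, smul_eq_zero] at heq
      rcases heq with h | h
      · exact hab (by simp [h])
      · exact hdf h
    refine ⟨-(a / b), fun w => ?_⟩
    have := congrArg (fun T => T w) heq
    simp only [add_apply, smul_apply, smul_eq_mul,
      zero_apply, hφd] at this
    field_simp
    linarith
  choose c hc using hc
  have hsymm : ∀ a b, H a b = H b a := by
    have := hv.contDiffAt.isSymmSndFDerivAt (x := x) (by simp)
    exact fun a b => this a b
  have hbasis : ∀ w : EuclideanSpace ℝ (Fin d), w = ∑ i, w i • e i := by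
    intro w
    ext j
    simp [he, Finset.sum_apply, Pi.single_apply]
  obtain ⟨j, hj⟩ : ∃ j, fderiv ℝ f x (e j) ≠ 0 := by
    by_contra hcon
    push Not at hcon
    apply hdf
    ext w
    rw [hbasis w]
    simp [hcon]
  have hsum : ∑ i, c i * fderiv ℝ f x (e i) = 0 := by
    rw [rlap_eq hvd] at hlap
    rw [← hlap]
    exact Finset.sum_congr rfl fun i _ => (hc i (e i)).symm
  have hrel : ∀ i, c i * fderiv ℝ f x (e j) = c j * fderiv ℝ f x (e i) := by
    intro i
    rw [← hc, ← hc, hsymm]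
  have hcj : c j = 0 := by
    have h1 : c j * ∑ i, fderiv ℝ f x (e i) ^ 2 = 0 := by
      calc c j * ∑ i, fderiv ℝ f x (e i) ^ 2
          = ∑ i, (c j * fderiv ℝ f x (e i)) * fderiv ℝ f x (e i) := by
            rw [Finset.mul_sum]
            exact Finset.sum_congr rfl fun i _ => by ring
        _ = ∑ i, fderiv ℝ f x (e j) * (c i * fderiv ℝ f x (e i)) := by
            refine Finset.sum_congr rfl fun i _ => ?_
            rw [← hrel]
            ring
        _ = 0 := by rw [← Finset.mul_sum, hsum, mul_zero]
    have h2 : 0 < ∑ i, fderiv ℝ f x (e i) ^ 2 :=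
      Finset.sum_pos' (fun i _ => sq_nonneg _) ⟨j, Finset.mem_univ _, by positivity⟩
    exact (mul_eq_zero.1 h1).resolve_right h2.ne'
  have hci : ∀ i, c i = 0 := by
    intro i
    have := hrel i
    rw [hcj, zero_mul] at this
    exact (mul_eq_zero.1 this).resolve_right hj
  ext a b
  rw [hbasis b]
  simp [hc, hci]

lemma local_zero {v f : EuclideanSpace ℝ (Fin d) → ℝ} (hv : ContDiff ℝ 2 v)
    {Ω W : Set (EuclideanSpace ℝ (Fin d))} (hΩ : IsOpen Ω) (hW : IsOpen W)
    (h : ∀ x ∈ W ∩ frontier Ω, v x = 0 ∧ fderiv ℝ v x = 0 ∧ fderiv ℝ (fderiv ℝ v) x = 0)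
    {x₀ : EuclideanSpace ℝ (Fin d)} (hx₀ : x₀ ∈ W) (hfx : f x₀ = 0)
    (hdf : fderiv ℝ f x₀ ≠ 0)
    (hloc : ∀ᶠ y in 𝓝 x₀, (y ∈ Ω ↔ f y < 0) ∧ (y ∈ frontier Ω ↔ f y = 0))
    (lam : ℝ) (hpde : ∀ x ∈ Ω, rlap v x + lam ^ 2 * v x = 0) :
    ∀ᶠ y in 𝓝 x₀, y ∈ Ω → v y = 0 := by
  obtain ⟨κ, hκ, H⟩ := uc_helmholtz d
  obtain ⟨R₀, hR₀, hball⟩ := Metric.isOpen_iff.1 hW x₀ hx₀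
  set R := R₀ / 3 with hRdef
  have hR : 0 < R := by positivity
  let χ : ContDiffBump x₀ := ⟨R, 2 * R, hR, by linarith⟩
  set g : EuclideanSpace ℝ (Fin d) → ℝ := fun y => χ y * Ω.indicator v y with hg
  have hgs : ContDiff ℝ 2 g := by
    rw [contDiff_iff_contDiffAt]
    intro x
    by_cases hx : x ∈ W
    · exact χ.contDiff.contDiffAt.mul (indicator_contDiffAt hv hΩ hW h hx)
    · have hx' : x ∉ tsupport χ := by
        rw [χ.tsupport_eq]
        intro hc
        apply hx
        apply hball
        have h1 : dist x x₀ ≤ 2 * R := hc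
        rw [Metric.mem_ball]
        linarith
      refine (contDiffAt_const (c := (0 : ℝ))).congr_of_eventuallyEq ?_
      filter_upwards [(isClosed_tsupport χ).isOpen_compl.mem_nhds hx'] with y hy
      simp [hg, image_eq_zero_of_notMem_tsupport hy]
  have hgeq : ∀ x ∈ Metric.ball x₀ R, g x = Ω.indicator v x := by
    intro x hx
    have : χ x = 1 := χ.one_of_mem_closedBall (Metric.ball_subset_closedBall hx)
    simp [hg, this]
  have hgpde : ∀ x ∈ Metric.ball x₀ R, rlap g x + lam ^ 2 * g x = 0 := by
    intro x hx
    have e1 : g =ᶠ[𝓝 x] Ω.indicator v := by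
      filter_upwards [Metric.isOpen_ball.mem_nhds hx] with y hy using hgeq y hy
    rw [rlap_congr e1, hgeq x hx]
    by_cases hxΩ : x ∈ Ω
    · have e2 : Ω.indicator v =ᶠ[𝓝 x] v := by
        filter_upwards [hΩ.mem_nhds hxΩ] with y hy using indicator_of_mem hy v
      rw [rlap_congr e2, indicator_of_mem hxΩ, hpde x hxΩ]
    · rw [rlap_indicator hv hΩ hW h ?_ hxΩ, indicator_of_notMem hxΩ]
      · simp
      · apply hball
        rw [Metric.mem_ball] at hx ⊢
        linarith
  have hfreq : ∃ᶠ y in 𝓝 x₀, 0 < f y := by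
    intro hcon
    apply hdf
    apply IsLocalMax.fderiv_eq_zero
    filter_upwards [hcon] with y hy
    rw [hfx]
    exact not_lt.1 hy
  set δ := min (κ * (R / 2)) (R / 2) with hδ
  have hδpos : 0 < δ := by positivity
  obtain ⟨y, hy0, ⟨hy1, hy2⟩, hy3⟩ :=
    (hfreq.and_eventually (hloc.and (Metric.ball_mem_nhds x₀ hδpos))).exists
  replace hy3 : dist y x₀ < δ := hy3
  have hycl : y ∉ closure Ω := by
    rw [closure_eq_self_union_frontier]
    rintro (h1 | h1)
    · exact absurd (hy1.1 h1) (by linarith)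
    · exact absurd (hy2.1 h1) (by linarith)
  have hgy : ∀ᶠ z in 𝓝 y, g z = 0 := by
    filter_upwards [isClosed_closure.isOpen_compl.mem_nhds hycl] with z hz
    simp [hg, indicator_of_notMem (fun h => hz (subset_closure h))]
  have hfin := H lam g hgs y (R / 2) (by positivity) (fun x hx => hgpde x (by
    have h1 := dist_triangle x y x₀
    have h2 : δ ≤ R / 2 := min_le_right _ _
    rw [Metric.mem_ball] at hx ⊢
    linarith)) hgy
  have hop : IsOpen {z | dist z y < κ * (R / 2)} := Metric.isOpen_ball
  have hmem : x₀ ∈ {z | dist z y < κ * (R / 2)} := by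
    change dist x₀ y < κ * (R / 2)
    rw [dist_comm]
    exact hy3.trans_le (min_le_left _ _)
  filter_upwards [hop.mem_nhds hmem, Metric.ball_mem_nhds x₀ hR] with z hz hz2 hzΩ
  have := hfin z hz
  rwa [hgeq z hz2, indicator_of_mem hzΩ] at this

lemma rlap_continuous {v : EuclideanSpace ℝ (Fin d) → ℝ} (hv : ContDiff ℝ 2 v) :
    Continuous (rlap v) := by
  have hv1 : ContDiff ℝ 1 (fderiv ℝ v) := hv.fderiv_right (by norm_num)
  unfold rlap
  refine continuous_finsetSum _ fun i _ => ?_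
  have : ContDiff ℝ 1 (fun y => fderiv ℝ v y (EuclideanSpace.single i 1)) :=
    hv1.clm_apply contDiff_const
  exact (this.continuous_fderiv (by norm_num)).clm_apply continuous_const

lemma real_case
    (Ω : Set (EuclideanSpace ℝ (Fin d))) (hΩ : IsOpen Ω) (hconn : IsConnected Ω)
    (Γ₀ : Set (EuclideanSpace ℝ (Fin d))) (hΓ₀ : Γ₀ ⊆ frontier Ω) (hne : Γ₀.Nonempty)
    (hopen : ∃ W : Set (EuclideanSpace ℝ (Fin d)), IsOpen W ∧ Γ₀ = W ∩ frontier Ω)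
    (hsmooth : ∀ x ∈ Γ₀, ∃ f : EuclideanSpace ℝ (Fin d) → ℝ,
      ContDiff ℝ ∞ f ∧ fderiv ℝ f x ≠ 0 ∧
        ∀ᶠ y in nhds x, (y ∈ Ω ↔ f y < 0) ∧ (y ∈ frontier Ω ↔ f y = 0))
    (lam : ℝ) (v : EuclideanSpace ℝ (Fin d) → ℝ) (hv : ContDiff ℝ 2 v)
    (hPDE : ∀ x ∈ Ω, rlap v x + lam ^ 2 * v x = 0)
    (hDir : ∀ x ∈ Γ₀, v x = 0)
    (hNeu : ∀ x ∈ Γ₀, fderiv ℝ v x = 0) :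
    ∀ x ∈ Ω, v x = 0 := by
  obtain ⟨W, hW, rfl⟩ := hopen
  obtain ⟨x₀, hx₀⟩ := hne
  have hlap : ∀ x ∈ W ∩ frontier Ω, rlap v x = 0 := by
    intro x hx
    have hcl : IsClosed {x | rlap v x + lam ^ 2 * v x = 0} :=
      isClosed_eq ((rlap_continuous hv).add (continuous_const.mul hv.continuous)) continuous_const
    have h1 : x ∈ {x | rlap v x + lam ^ 2 * v x = 0} :=
      closure_minimal hPDE hcl (frontier_subset_closure hx.2)
    simpa [hDir x hx] using h1
  have h : ∀ x ∈ W ∩ frontier Ω, v x = 0 ∧ fderiv ℝ v x = 0 ∧ fderiv ℝ (fderiv ℝ v) x = 0 := by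
    intro x hx
    refine ⟨hDir x hx, hNeu x hx, ?_⟩
    obtain ⟨f, hf, hdf, hloc⟩ := hsmooth x hx
    refine hess_zero hv hf (hloc.self_of_nhds.2.1 hx.2) hdf ?_ (hlap x hx)
    filter_upwards [hloc, hW.mem_nhds hx.1] with y hy hyW hfy
    exact hNeu y ⟨hyW, hy.2.2 hfy⟩
  obtain ⟨f, hf, hdf, hloc⟩ := hsmooth x₀ hx₀
  have hz := local_zero hv hΩ hW h hx₀.1 (hloc.self_of_nhds.2.1 hx₀.2) hdf hloc lam hPDE
  set U : Set (EuclideanSpace ℝ (Fin d)) := {x | ∀ᶠ y in 𝓝 x, v y = 0} with hU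
  have hUo : IsOpen U := isOpen_setOfPred_eventually_nhds
  have hsub : Ω ⊆ U := by
    refine hconn.isPreconnected.subset_of_closure_inter_subset hUo ?_ ?_
    · have hfr : ∃ᶠ y in 𝓝 x₀, y ∈ Ω := mem_closure_iff_frequently.1 (frontier_subset_closure hx₀.2)
      obtain ⟨y, hy1, hy2⟩ := (hfr.and_eventually hz.eventually_nhds).exists
      refine ⟨y, hy1, ?_⟩
      change ∀ᶠ z in 𝓝 y, v z = 0
      filter_upwards [hy2, hΩ.mem_nhds hy1] with z hz hz2 using hz hz2
    · rintro x ⟨hxU, hxΩ⟩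
      obtain ⟨κ, hκ, H⟩ := uc_helmholtz d
      obtain ⟨R, hR, hball⟩ := Metric.isOpen_iff.1 hΩ x hxΩ
      have hδpos : 0 < min (κ * (R / 2)) (R / 2) := by positivity
      obtain ⟨y, hyU, hy⟩ := Metric.mem_closure_iff.1 hxU _ hδpos
      have hfin := H lam v hv y (R / 2) (by positivity) (fun z hz => hPDE z (hball (by
        have h1 := dist_triangle z y x
        have h2 : min (κ * (R / 2)) (R / 2) ≤ R / 2 := min_le_right _ _
        rw [dist_comm] at hy
        rw [Metric.mem_ball] at hz ⊢
        linarith))) hyU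
      have hop : IsOpen {z | dist z y < κ * (R / 2)} := Metric.isOpen_ball
      have hmem : x ∈ {z | dist z y < κ * (R / 2)} := hy.trans_le (min_le_left _ _)
      change ∀ᶠ z in 𝓝 x, v z = 0
      filter_upwards [hop.mem_nhds hmem] with z hz using hfin z hz
  intro x hx
  exact (hsub hx : ∀ᶠ y in 𝓝 x, v y = 0).self_of_nhds

lemma fderiv_clm_comp {u : EuclideanSpace ℝ (Fin d) → ℂ} (hu : Differentiable ℝ u) (T : ℂ →L[ℝ] ℝ)
    (x : EuclideanSpace ℝ (Fin d)) :
    fderiv ℝ (fun y => T (u y)) x = T.comp (fderiv ℝ u x) :=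
  (T.hasFDerivAt.comp x (hu x).hasFDerivAt).fderiv

lemma rlap_clm {u : EuclideanSpace ℝ (Fin d) → ℂ} (hu : ContDiff ℝ 2 u) (T : ℂ →L[ℝ] ℝ)
    (x : EuclideanSpace ℝ (Fin d)) : rlap (fun y => T (u y)) x = T (lap u x) := by
  have hu1 : ContDiff ℝ 1 (fderiv ℝ u) := hu.fderiv_right (by norm_num)
  unfold rlap lap
  rw [map_sum]
  refine Finset.sum_congr rfl fun i _ => ?_
  have hp : ContDiff ℝ 1 (fun y => pd i u y) := by
    unfold pd
    exact hu1.clm_apply contDiff_const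
  have : (fun y => fderiv ℝ (fun y => T (u y)) y (EuclideanSpace.single i 1)) =
      fun y => T (pd i u y) := by
    ext y
    rw [fderiv_clm_comp (hu.differentiable (by norm_num))]
    rfl
  rw [this, fderiv_clm_comp (hp.differentiable (by norm_num))]
  rfl

end UCaux

/-- **Unique continuation from Cauchy data** (John–Holmgren). Let `Ω` be a bounded smooth
domain, `Γ₀` a nonempty relatively open smooth part of its boundary, and `λ ≠ 0` real.
If `u` (regular up to the boundary) solves `(−Δ − λ²)u = 0` in `Ω` with `u = 0` and
`∂_ν u = 0` on `Γ₀` (vanishing full gradient, since `u` vanishes on the relatively open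
set `Γ₀`), then `u = 0` in `Ω`. -/
theorem stmt14
    (Ω : Set (EuclideanSpace ℝ (Fin d))) (hΩ : IsOpen Ω) (hconn : IsConnected Ω)
    (hbd : IsCompact (closure Ω))
    (Γ₀ : Set (EuclideanSpace ℝ (Fin d))) (hΓ₀ : Γ₀ ⊆ frontier Ω) (hne : Γ₀.Nonempty)
    (hopen : ∃ W : Set (EuclideanSpace ℝ (Fin d)), IsOpen W ∧ Γ₀ = W ∩ frontier Ω)
    (hsmooth : ∀ x ∈ Γ₀, ∃ f : EuclideanSpace ℝ (Fin d) → ℝ,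
      ContDiff ℝ (⊤ : ℕ∞) f ∧ fderiv ℝ f x ≠ 0 ∧
        ∀ᶠ y in nhds x, (y ∈ Ω ↔ f y < 0) ∧ (y ∈ frontier Ω ↔ f y = 0))
    (lam : ℝ) (hlam : lam ≠ 0)
    (u : EuclideanSpace ℝ (Fin d) → ℂ) (hu : ContDiff ℝ 2 u)
    (hPDE : ∀ x ∈ Ω, lap u x + ((lam : ℂ)) ^ 2 * u x = 0)
    (hDir : ∀ x ∈ Γ₀, u x = 0)
    (hNeu : ∀ x ∈ Γ₀, fderiv ℝ u x = 0) :
    ∀ x ∈ Ω, u x = 0 := by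
  have key : ∀ T : ℂ →L[ℝ] ℝ, ∀ x ∈ Ω, T (u x) = 0 := by
    intro T
    refine UCaux.real_case Ω hΩ hconn Γ₀ hΓ₀ hne hopen hsmooth lam (fun y => T (u y))
      (T.contDiff.comp hu) ?_ ?_ ?_
    · intro x hx
      have h1 := congrArg T (hPDE x hx)
      have h2 : ((lam : ℂ)) ^ 2 * u x = (lam ^ 2 : ℝ) • u x := by
        rw [Complex.real_smul]
        push_cast
        rfl
      rw [map_add, h2, map_smul, map_zero] at h1
      rw [UCaux.rlap_clm hu]
      exact h1
    · intro x hx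
      simp [hDir x hx]
    · intro x hx
      rw [UCaux.fderiv_clm_comp (hu.differentiable (by norm_num)), hNeu x hx]
      simp
  intro x hx
  exact Complex.ext (by simpa using key Complex.reCLM x hx) (by simpa using key Complex.imCLM x hx)

end
end

section
/- Let {α_k} be the increasing sequence of positive zeros of the Bessel function J₀. Then there exist K ∈ ℕ and c' > 0 such that for all k ≥ K and all ε ∈ ℂ with |ε| = 3/4, one has |J₀(α_k + ε)| ≥ c'/√k. -/
open Complex

noncomputable section

/-- Coefficients of the series in `s = z^2/4`. -/
def bc (m : ℕ) : ℂ := (-1 : ℂ) ^ m / ((Nat.factorial m : ℂ)) ^ 2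

def bc1 (m : ℕ) : ℂ := ((m : ℂ) + 1) * bc (m + 1)

def bc2 (m : ℕ) : ℂ := ((m : ℂ) + 1) * bc1 (m + 1)

def ps (c : ℕ → ℂ) (s : ℂ) : ℂ := ∑' m : ℕ, c m * s ^ m

lemma fact_inv_le_one (m : ℕ) : ((Nat.factorial m : ℝ))⁻¹ ≤ 1 := by
  apply inv_le_one_of_one_le₀
  exact_mod_cast Nat.one_le_iff_ne_zero.mpr (Nat.factorial_ne_zero m)

lemma bc_le (m : ℕ) : ‖bc m‖ ≤ ((Nat.factorial m : ℝ))⁻¹ := by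
  have h := fact_inv_le_one m
  have h0 : 0 ≤ ((Nat.factorial m : ℝ))⁻¹ := by positivity
  have : ‖bc m‖ = ((Nat.factorial m : ℝ))⁻¹ * ((Nat.factorial m : ℝ))⁻¹ := by
    simp [bc, pow_two]
  rw [this]
  nlinarith

lemma bc1_eq (m : ℕ) : bc1 m = (-1) ^ (m + 1) / ((Nat.factorial m : ℂ) * (Nat.factorial (m + 1) : ℂ)) := by
  have h1 : (Nat.factorial m : ℂ) ≠ 0 := by exact_mod_cast Nat.factorial_ne_zero m
  have h2 : (m : ℂ) + 1 ≠ 0 := by exact_mod_cast Nat.succ_ne_zero m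
  simp only [bc1, bc, Nat.factorial_succ]
  push_cast
  field_simp

lemma bc2_eq (m : ℕ) : bc2 m = (-1) ^ (m + 2) / ((Nat.factorial m : ℂ) * (Nat.factorial (m + 2) : ℂ)) := by
  have h1 : (Nat.factorial m : ℂ) ≠ 0 := by exact_mod_cast Nat.factorial_ne_zero m
  have h2 : (m : ℂ) + 1 ≠ 0 := by exact_mod_cast Nat.succ_ne_zero m
  have h3 : (m : ℂ) + 1 + 1 ≠ 0 := by exact_mod_cast Nat.succ_ne_zero (m + 1)
  simp only [bc2, bc1_eq, Nat.factorial_succ]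
  push_cast
  field_simp

lemma bc1_le (m : ℕ) : ‖bc1 m‖ ≤ ((Nat.factorial m : ℝ))⁻¹ := by
  have h := fact_inv_le_one (m + 1)
  have h0 : 0 ≤ ((Nat.factorial m : ℝ))⁻¹ := by positivity
  have : ‖bc1 m‖ = ((Nat.factorial (m + 1) : ℝ))⁻¹ * ((Nat.factorial m : ℝ))⁻¹ := by
    rw [bc1_eq]; simp only [norm_div, norm_mul, norm_pow, norm_neg, norm_one, one_pow,
      Complex.norm_natCast, one_div, mul_inv]; ring
  rw [this]
  nlinarith

lemma bc2_le (m : ℕ) : ‖bc2 m‖ ≤ ((Nat.factorial m : ℝ))⁻¹ := by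
  have h := fact_inv_le_one (m + 2)
  have h0 : 0 ≤ ((Nat.factorial m : ℝ))⁻¹ := by positivity
  have : ‖bc2 m‖ = ((Nat.factorial (m + 2) : ℝ))⁻¹ * ((Nat.factorial m : ℝ))⁻¹ := by
    rw [bc2_eq]; simp only [norm_div, norm_mul, norm_pow, norm_neg, norm_one, one_pow,
      Complex.norm_natCast, one_div, mul_inv]; ring
  rw [this]
  nlinarith

lemma ps_term_le (c : ℕ → ℂ) (hc : ∀ m, ‖c m‖ ≤ ((Nat.factorial m : ℝ))⁻¹) (R : ℝ) (s : ℂ)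
    (hs : ‖s‖ ≤ R) (m : ℕ) : ‖c m * s ^ m‖ ≤ R ^ m / (Nat.factorial m : ℝ) := by
  rw [norm_mul, norm_pow, div_eq_mul_inv, mul_comm]
  have hR : 0 ≤ R := (norm_nonneg s).trans hs
  gcongr
  exact hc m

lemma ps_summable (c : ℕ → ℂ) (hc : ∀ m, ‖c m‖ ≤ ((Nat.factorial m : ℝ))⁻¹) (s : ℂ) :
    Summable (fun m : ℕ => c m * s ^ m) :=
  Summable.of_norm_bounded (Real.summable_pow_div_factorial ‖s‖)
    (fun m => ps_term_le c hc _ s le_rfl m)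

lemma ps_hasDerivAt (c : ℕ → ℂ) (hc : ∀ m, ‖c m‖ ≤ ((Nat.factorial m : ℝ))⁻¹)
    (hd : ∀ m : ℕ, ‖((m : ℂ) + 1) * c (m + 1)‖ ≤ ((Nat.factorial m : ℝ))⁻¹) (s : ℂ) :
    HasDerivAt (ps c) (ps (fun m => ((m : ℂ) + 1) * c (m + 1)) s) s := by
  have hU : IsOpen (Metric.ball (0 : ℂ) (‖s‖ + 1)) := Metric.isOpen_ball
  have hsU : s ∈ Metric.ball (0 : ℂ) (‖s‖ + 1) := by simp
  have hF : ∀ m : ℕ, DifferentiableOn ℂ (fun w : ℂ => c m * w ^ m) (Metric.ball (0 : ℂ) (‖s‖ + 1)) :=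
    fun m => by fun_prop
  have hle : ∀ (m : ℕ) (w : ℂ), w ∈ Metric.ball (0 : ℂ) (‖s‖ + 1) →
      ‖c m * w ^ m‖ ≤ (‖s‖ + 1) ^ m / (Nat.factorial m : ℝ) := fun m w hw =>
    ps_term_le c hc _ w (by simpa using (mem_ball_zero_iff.mp hw).le) m
  have hsum := Real.summable_pow_div_factorial (‖s‖ + 1)
  have h1 : DifferentiableAt ℂ (ps c) s :=
    (Complex.differentiableOn_tsum_of_summable_norm hsum hF hU hle).differentiableAt
      (hU.mem_nhds hsU)
  have h2 := Complex.hasSum_deriv_of_summable_norm hsum hF hU hle hsU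
  have h3 : deriv (ps c) s = ps (fun m => ((m : ℂ) + 1) * c (m + 1)) s := by
    have h4 : HasSum (fun m : ℕ => c m * ((m : ℂ) * s ^ (m - 1))) (deriv (ps c) s) := by
      have e : (fun m : ℕ => c m * ((m : ℂ) * s ^ (m - 1)))
          = (fun m : ℕ => deriv (fun w : ℂ => c m * w ^ m) s) := by
        funext m
        simp
      rw [e]
      exact h2
    have h5 := (hasSum_nat_add_iff' 1).mpr h4
    simp only [Finset.range_one, Finset.sum_singleton, Nat.cast_zero, zero_mul, mul_zero,
      sub_zero] at h5
    rw [← h5.tsum_eq]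
    unfold ps
    congr 1
    funext m
    simp only [Nat.add_sub_cancel]
    push_cast
    ring
  rw [← h3]
  exact h1.hasDerivAt

lemma ps_ode (s : ℂ) : s * ps bc2 s + ps bc1 s + ps bc s = 0 := by
  have e0 : ps bc s = bc 0 * s ^ 0 + ∑' m : ℕ, bc (m + 1) * s ^ (m + 1) :=
    (ps_summable bc bc_le s).tsum_eq_zero_add
  have e1 : ps bc1 s = bc1 0 * s ^ 0 + ∑' m : ℕ, bc1 (m + 1) * s ^ (m + 1) :=
    (ps_summable bc1 bc1_le s).tsum_eq_zero_add
  have e2 : s * ps bc2 s = ∑' m : ℕ, s * (bc2 m * s ^ m) := tsum_mul_left.symm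
  have s0 := (summable_nat_add_iff 1).mpr (ps_summable bc bc_le s)
  have s1 := (summable_nat_add_iff 1).mpr (ps_summable bc1 bc1_le s)
  have s2 := (ps_summable bc2 bc2_le s).mul_left s
  have key : (∑' m : ℕ, s * (bc2 m * s ^ m)) + (∑' m : ℕ, bc1 (m + 1) * s ^ (m + 1))
      + (∑' m : ℕ, bc (m + 1) * s ^ (m + 1)) = 0 := by
    rw [← s2.tsum_add s1, ← (s2.add s1).tsum_add s0]
    convert tsum_zero using 2
    funext m
    have : bc2 m + bc1 (m + 1) + bc (m + 1) = 0 := by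
      have h1 : (Nat.factorial m : ℂ) ≠ 0 := by exact_mod_cast Nat.factorial_ne_zero m
      have h2 : (m : ℂ) + 1 ≠ 0 := by exact_mod_cast Nat.succ_ne_zero m
      have h3 : (m : ℂ) + 1 + 1 ≠ 0 := by exact_mod_cast Nat.succ_ne_zero (m + 1)
      simp only [bc2, bc1, bc, Nat.factorial_succ]
      push_cast
      field_simp
      ring
    linear_combination s ^ (m + 1) * this
  have hz : bc1 0 + bc 0 = 0 := by simp [bc1, bc]
  rw [e0, e1, e2]
  linear_combination key + hz

/-- The derivative of `J0`. -/
def J1 (z : ℂ) : ℂ := z / 2 * ps bc1 (z ^ 2 / 4)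

lemma J0_eq_s18 (z : ℂ) : J0 z = ps bc (z ^ 2 / 4) := by
  unfold J0 ps bc
  congr 1
  funext m
  rw [pow_mul, div_pow]
  norm_num

lemma sq_hasDerivAt (z : ℂ) : HasDerivAt (fun w : ℂ => w ^ 2 / 4) (z / 2) z := by
  have := ((hasDerivAt_id z).pow 2).div_const 4
  refine this.congr_deriv ?_
  simp; ring

lemma J0_hasDerivAt (z : ℂ) : HasDerivAt J0 (J1 z) z := by
  have h := (ps_hasDerivAt bc bc_le bc1_le (z ^ 2 / 4)).comp z (sq_hasDerivAt z)
  have e : J0 = ps bc ∘ (fun w : ℂ => w ^ 2 / 4) := funext J0_eq_s18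
  rw [e]
  refine h.congr_deriv ?_
  rw [J1, mul_comm]; rfl

lemma J1_hasDerivAt (z : ℂ) (hz : z ≠ 0) : HasDerivAt J1 (-J0 z - J1 z / z) z := by
  have h := (ps_hasDerivAt bc1 bc1_le bc2_le (z ^ 2 / 4)).comp z (sq_hasDerivAt z)
  have h' := ((hasDerivAt_id z).div_const 2).mul h
  refine h'.congr_deriv ?_
  have ode := ps_ode (z ^ 2 / 4)
  have e : ps (fun m => ((m : ℂ) + 1) * bc1 (m + 1)) = ps bc2 := rfl
  rw [J1, J0_eq_s18, e]
  simp only [Function.comp, id]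
  field_simp
  linear_combination 4 * ode

lemma J0_im (x : ℝ) : (J0 x).im = 0 := by
  have : J0 x = ((∑' m : ℕ, ((-1 : ℝ)) ^ m / ((Nat.factorial m : ℝ)) ^ 2 * (x / 2) ^ (2 * m) : ℝ) : ℂ) := by
    rw [Complex.ofReal_tsum]
    unfold J0
    congr 1
    funext m
    push_cast
    ring
  rw [this, Complex.ofReal_im]

def j (x : ℝ) : ℝ := (J0 x).re
def j1 (x : ℝ) : ℝ := (J1 x).re

lemma J0_zero_iff (x : ℝ) : J0 x = 0 ↔ j x = 0 := by
  constructor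
  · intro h; simp [j, h]
  · intro h; exact Complex.ext h (by simpa using J0_im x)

lemma j_hasDerivAt (x : ℝ) : HasDerivAt j (j1 x) x := (J0_hasDerivAt x).real_of_complex

lemma j1_hasDerivAt (x : ℝ) (hx : 0 < x) : HasDerivAt j1 (-j x - j1 x / x) x := by
  have h := (J1_hasDerivAt x (by exact_mod_cast hx.ne')).real_of_complex
  refine h.congr_deriv ?_
  simp [j, j1, Complex.div_ofReal_re]

def G (x : ℝ) : ℝ := x * j x ^ 2 + (j x + 2 * x * j1 x) ^ 2 * (x / (4 * x ^ 2 + 1))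

lemma G_hasDerivAt (x : ℝ) (hx : 0 < x) :
    HasDerivAt G (2 * (j x + 2 * x * j1 x) ^ 2 / (4 * x ^ 2 + 1) ^ 2) x := by
  have hj := j_hasDerivAt x
  have hj1 := j1_hasDerivAt x hx
  have hi := hasDerivAt_id x
  have hne : 4 * x ^ 2 + 1 ≠ 0 := by positivity
  have hq := hi.div (((hi.pow 2).const_mul 4).add_const 1) (by simpa using hne)
  have h := (hi.mul (hj.pow 2)).add (((hj.add ((hi.const_mul 2).mul hj1)).pow 2).mul hq)
  refine h.congr_deriv ?_
  simp
  field_simp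
  ring

lemma G_mono : MonotoneOn G (Set.Ioi 0) := by
  apply monotoneOn_of_deriv_nonneg (convex_Ioi 0)
  · exact fun x hx => (G_hasDerivAt x hx).continuousAt.continuousWithinAt
  · rw [interior_Ioi]
    exact fun x hx => (G_hasDerivAt x hx).differentiableAt.differentiableWithinAt
  · rw [interior_Ioi]
    intro x hx
    rw [(G_hasDerivAt x hx).deriv]
    positivity

lemma G_at_zero (x : ℝ) (hx : 0 < x) (h : j x = 0) : G x ≤ x * j1 x ^ 2 := by
  have : G x = x * j1 x ^ 2 * (4 * x ^ 2 / (4 * x ^ 2 + 1)) := by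
    rw [G, h]; field_simp; ring
  rw [this]
  apply mul_le_of_le_one_right (by positivity)
  rw [div_le_one (by positivity)]
  linarith

/-- Sturm comparison quantity. -/
def W (a x : ℝ) : ℝ :=
  √x * (j1 x * Real.sin (x - a) + j x * Real.sin (x - a) / (2 * x) - j x * Real.cos (x - a))

lemma W_hasDerivAt (a x : ℝ) (hx : 0 < x) :
    HasDerivAt (W a) (-(√x * j x * Real.sin (x - a)) / (4 * x ^ 2)) x := by
  have hj := j_hasDerivAt x
  have hj1 := j1_hasDerivAt x hx
  have hi := hasDerivAt_id x
  have hs : HasDerivAt (fun x => Real.sin (x - a)) (Real.cos (x - a)) x := by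
    simpa using (hi.sub_const a).sin
  have hc : HasDerivAt (fun x => Real.cos (x - a)) (-Real.sin (x - a)) x := by
    simpa using (hi.sub_const a).cos
  have hr := hi.sqrt hx.ne'
  have h := hr.mul (((hj1.mul hs).add ((hj.mul hs).div (hi.const_mul 2) (by simpa using hx.ne'))).sub
    (hj.mul hc))
  refine h.congr_deriv ?_
  have hsq : √x ≠ 0 := (Real.sqrt_pos.mpr hx).ne'
  have h2 : √x ^ 2 = x := Real.sq_sqrt hx.le
  simp
  generalize √x = r at *
  subst h2
  field_simp
  ring

lemma exists_zero (a : ℝ) (ha : 0 < a) : ∃ x, a < x ∧ x < a + Real.pi ∧ j x = 0 := by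
  by_contra! hcon
  have hpi := Real.pi_pos
  have hcont : Continuous j := continuous_iff_continuousAt.mpr fun x => (j_hasDerivAt x).continuousAt
  have hWc : ContinuousOn (W a) (Set.Icc a (a + Real.pi)) := fun x hx =>
    (W_hasDerivAt a x (ha.trans_le hx.1)).continuousAt.continuousWithinAt
  obtain ⟨ξ, hξ, hξe⟩ := exists_hasDerivAt_eq_slope (W a) _ (by linarith : a < a + Real.pi) hWc
    (fun x hx => W_hasDerivAt a x (ha.trans hx.1))
  have hWa : W a a = -(√a * j a) := by simp [W]
  have hWb : W a (a + Real.pi) = √(a + Real.pi) * j (a + Real.pi) := by simp [W]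
  have hξ0 : 0 < ξ := ha.trans hξ.1
  have hsin : 0 < Real.sin (ξ - a) :=
    Real.sin_pos_of_pos_of_lt_pi (by linarith [hξ.1]) (by linarith [hξ.2])
  have hne : ∀ x ∈ Set.Ioo a (a + Real.pi), j x ≠ 0 := fun x hx => hcon x hx.1 hx.2
  have hcl : closure (Set.Ioo a (a + Real.pi)) = Set.Icc a (a + Real.pi) :=
    closure_Ioo (by linarith)
  rw [hWa, hWb, div_eq_div_iff (by positivity) (by linarith)] at hξe
  have hsame : ∀ x ∈ Set.Ioo a (a + Real.pi), 0 < j x * j ξ := by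
    intro x hx
    by_contra! hneg
    have hconn : IsPreconnected (Set.Ioo a (a + Real.pi)) := isPreconnected_Ioo
    have : ∃ y ∈ Set.Ioo a (a + Real.pi), j y = 0 := by
      rcases lt_or_gt_of_ne (hne ξ hξ) with h | h
      · have hx0 : 0 ≤ j x := by nlinarith
        exact hconn.intermediate_value hξ hx hcont.continuousOn ⟨h.le, hx0⟩
      · have hx0 : j x ≤ 0 := by nlinarith
        exact hconn.intermediate_value hx hξ hcont.continuousOn ⟨hx0, h.le⟩
    obtain ⟨y, hy, hy0⟩ := this
    exact hne y hy hy0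
  have hclosed : ∀ x ∈ Set.Icc a (a + Real.pi), 0 ≤ j x * j ξ := by
    intro x hx
    rw [← hcl] at hx
    have hc : IsClosed {x | 0 ≤ j x * j ξ} :=
      isClosed_le continuous_const (hcont.mul continuous_const)
    exact closure_minimal (fun y hy => (hsame y hy).le) hc hx
  have h1 := hclosed a ⟨le_rfl, by linarith⟩
  have h2 := hclosed (a + Real.pi) ⟨by linarith, le_rfl⟩
  have h3 : 0 ≤ √a := Real.sqrt_nonneg _
  have h4 : 0 ≤ √(a + Real.pi) := Real.sqrt_nonneg _
  have h5 : 0 < √ξ := Real.sqrt_pos.mpr hξ0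
  have h6 := hsame ξ hξ
  have h7 : 0 < √ξ * Real.sin (ξ - a) * (j ξ * j ξ) * Real.pi := by positivity
  have h8 : 0 ≤ (√(a + Real.pi) * (j (a + Real.pi) * j ξ) + √a * (j a * j ξ)) * (4 * ξ ^ 2) := by
    positivity
  have h9 := congrArg (· * j ξ) hξe
  nlinarith

/-- Gronwall bound for `J0, J0'` near `a`. -/
lemma J1_bound (a : ℝ) (ha : 2 ≤ a) (h0 : J0 a = 0) (ε : ℂ) (hε : ‖ε‖ = 3 / 4) (t : ℝ)
    (ht : t ∈ Set.Icc (0 : ℝ) 1) : ‖J1 (a + t * ε)‖ ≤ ‖J1 a‖ * Real.exp 2 := by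
  have hz : ∀ t ∈ Set.Icc (0 : ℝ) 1, 1 ≤ ‖(a : ℂ) + t * ε‖ := by
    intro t ht
    have h1 : ‖(t : ℂ) * ε‖ ≤ 1 := by
      rw [norm_mul, hε, Complex.norm_real, Real.norm_eq_abs, abs_of_nonneg ht.1]
      linarith [ht.2]
    have h2 : ‖(a : ℂ)‖ = a := by
      rw [Complex.norm_real, Real.norm_eq_abs, abs_of_nonneg (by linarith)]
    have h3 := norm_sub_le ((a : ℂ) + t * ε) (t * ε)
    rw [add_sub_cancel_right, h2] at h3
    linarith
  have hd : ∀ t ∈ Set.Icc (0 : ℝ) 1, HasDerivAt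
      (fun t : ℝ => (J0 (a + t * ε), J1 (a + t * ε)))
      (J1 (a + t * ε) * ε, (-J0 (a + t * ε) - J1 (a + t * ε) / (a + t * ε)) * ε) t := by
    intro t ht
    have hne : (a : ℂ) + t * ε ≠ 0 := by
      intro h
      have := hz t ht
      rw [h] at this
      norm_num at this
    have hl : HasDerivAt (fun t : ℂ => (a : ℂ) + t * ε) ε (t : ℂ) := by
      simpa using ((hasDerivAt_id (t : ℂ)).mul_const ε).const_add (a : ℂ)
    have h1 := ((J0_hasDerivAt (a + t * ε)).comp (t : ℂ) hl).comp_ofReal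
    have h2 := ((J1_hasDerivAt (a + t * ε) hne).comp (t : ℂ) hl).comp_ofReal
    exact h1.prodMk h2
  have key := norm_le_gronwallBound_of_norm_deriv_right_le (a := 0) (b := 1) (δ := ‖J1 a‖)
    (K := 2) (ε := 0)
    (f := fun t : ℝ => (J0 (a + t * ε), J1 (a + t * ε)))
    (fun t ht => (hd t ht).continuousAt.continuousWithinAt)
    (fun t ht => (hd t ⟨ht.1, ht.2.le⟩).hasDerivWithinAt)
    (by simp [h0, Prod.norm_def])
    (by
      intro t ht
      have hz' := hz t ⟨ht.1, ht.2.le⟩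
      simp only [Prod.norm_def, add_zero, norm_mul, hε]
      set A := J0 (a + t * ε)
      set B := J1 (a + t * ε)
      have h1 : ‖B / (a + t * ε)‖ ≤ ‖B‖ := by
        rw [norm_div]
        exact div_le_self (norm_nonneg _) hz'
      have h2 : ‖-A - B / (a + t * ε)‖ ≤ ‖A‖ + ‖B / (a + t * ε)‖ := by
        have := norm_sub_le (-A) (B / (a + t * ε))
        rwa [norm_neg] at this
      have h3 := le_max_left ‖A‖ ‖B‖
      have h4 := le_max_right ‖A‖ ‖B‖
      have h5 := norm_nonneg A
      have h6 := norm_nonneg B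
      apply max_le <;> linarith) t ht
  rw [gronwallBound_ε0] at key
  have h1 : ‖J1 (a + t * ε)‖ ≤ ‖(J0 (a + t * ε), J1 (a + t * ε))‖ := by
    rw [Prod.norm_def]; exact le_max_right _ _
  refine (h1.trans key).trans ?_
  gcongr
  linarith [ht.2]

lemma sin_upper (w : ℂ) (hw : ‖w‖ ≤ 1) : ‖Complex.sin w‖ ≤ Real.exp 1 := by
  have hle : ∀ v : ℂ, ‖v‖ ≤ 1 → ‖Complex.exp v‖ ≤ Real.exp 1 := by
    intro v hv
    rw [Complex.norm_exp]
    exact Real.exp_le_exp.mpr ((Complex.re_le_norm v).trans hv)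
  have h1 := hle (-w * I) (by simpa using hw)
  have h2 := hle (w * I) (by simpa using hw)
  have h3 := norm_sub_le (Complex.exp (-w * I)) (Complex.exp (w * I))
  rw [Complex.sin]
  simp only [norm_div, norm_mul, Complex.norm_I, mul_one, Complex.norm_ofNat]
  linarith

lemma sin_lower : ∃ c > (0 : ℝ), ∀ ε : ℂ, ‖ε‖ = 3 / 4 → c ≤ ‖Complex.sin ε‖ := by
  have hK : IsCompact (Metric.sphere (0 : ℂ) (3 / 4)) := isCompact_sphere _ _
  have hne : (Metric.sphere (0 : ℂ) (3 / 4)).Nonempty :=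
    NormedSpace.sphere_nonempty.mpr (by norm_num)
  obtain ⟨w, hw, hmin⟩ := hK.exists_isMinOn hne
    (Complex.continuous_sin.norm.continuousOn)
  refine ⟨‖Complex.sin w‖, ?_, fun ε hε => hmin (by simpa using hε)⟩
  rw [gt_iff_lt, norm_pos_iff]
  intro h
  obtain ⟨k, hk⟩ := Complex.sin_eq_zero_iff.mp h
  have hw' : ‖w‖ = 3 / 4 := by simpa using hw
  rw [hk, norm_mul, Complex.norm_real, Complex.norm_intCast, Real.norm_eq_abs,
    abs_of_pos Real.pi_pos] at hw'
  by_cases hk0 : k = 0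
  · norm_num [hk0] at hw'
  · have h1 : (1 : ℝ) ≤ |(k : ℝ)| := by exact_mod_cast Int.one_le_abs hk0
    nlinarith [Real.pi_gt_three]

lemma J0_approx (a : ℝ) (ha : 2 ≤ a) (h0 : J0 a = 0) (ε : ℂ) (hε : ‖ε‖ = 3 / 4) :
    ‖J0 (a + ε) - J1 a * Complex.sin ε‖ ≤ Real.exp 1 * (‖J1 a‖ * Real.exp 2) / (a - 1) := by
  have hz : ∀ t ∈ Set.Icc (0 : ℝ) 1, a - 1 ≤ ‖(a : ℂ) + t * ε‖ := by
    intro t ht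
    have h1 : ‖(t : ℂ) * ε‖ ≤ 1 := by
      rw [norm_mul, hε, Complex.norm_real, Real.norm_eq_abs, abs_of_nonneg ht.1]
      linarith [ht.2]
    have h2 : ‖(a : ℂ)‖ = a := by
      rw [Complex.norm_real, Real.norm_eq_abs, abs_of_nonneg (by linarith)]
    have h3 := norm_sub_le ((a : ℂ) + t * ε) (t * ε)
    rw [add_sub_cancel_right, h2] at h3
    linarith
  have hd : ∀ t ∈ Set.Icc (0 : ℝ) 1, HasDerivAt
      (fun t : ℝ => J0 (a + t * ε) * Complex.cos ((1 - t) * ε)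
        + J1 (a + t * ε) * Complex.sin ((1 - t) * ε))
      (-(ε * Complex.sin ((1 - t) * ε) * (J1 (a + t * ε) / (a + t * ε)))) t := by
    intro t ht
    have hne : (a : ℂ) + t * ε ≠ 0 := by
      intro h
      have := hz t ht
      rw [h, norm_zero] at this
      linarith
    have hl : HasDerivAt (fun t : ℂ => (a : ℂ) + t * ε) ε (t : ℂ) := by
      simpa using ((hasDerivAt_id (t : ℂ)).mul_const ε).const_add (a : ℂ)
    have hm : HasDerivAt (fun t : ℂ => (1 - t) * ε) (-ε) (t : ℂ) := by
      simpa using ((hasDerivAt_id (t : ℂ)).const_sub 1).mul_const ε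
    have h1 := (J0_hasDerivAt (a + t * ε)).comp (t : ℂ) hl
    have h2 := (J1_hasDerivAt (a + t * ε) hne).comp (t : ℂ) hl
    have h := ((h1.mul hm.ccos).add (h2.mul hm.csin)).comp_ofReal
    refine h.congr_deriv ?_
    simp only [Function.comp]
    ring
  have key := norm_image_sub_le_of_norm_deriv_le_segment_01'
    (C := Real.exp 1 * (‖J1 a‖ * Real.exp 2) / (a - 1))
    (fun t ht => (hd t ht).hasDerivWithinAt) (by
      intro t ht
      have ht' : t ∈ Set.Icc (0 : ℝ) 1 := ⟨ht.1, ht.2.le⟩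
      have hs : ‖Complex.sin ((1 - t) * ε)‖ ≤ Real.exp 1 := by
        apply sin_upper
        rw [norm_mul, hε]
        have : ‖(1 - t : ℂ)‖ = 1 - t := by
          rw [← Complex.ofReal_one, ← Complex.ofReal_sub, Complex.norm_real, Real.norm_eq_abs,
            abs_of_nonneg (by linarith [ht.2])]
        rw [this]; linarith [ht.1]
      have hJ := J1_bound a ha h0 ε hε t ht'
      have hz' := hz t ht'
      have ha1 : 0 < a - 1 := by linarith
      rw [norm_neg, norm_mul, norm_mul, norm_div, hε, mul_div_assoc]
      have h1 : 3 / 4 * ‖Complex.sin ((1 - t) * ε)‖ ≤ Real.exp 1 := by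
        linarith [norm_nonneg (Complex.sin ((1 - t) * ε))]
      gcongr)
  simpa [h0] using key

lemma tendsto_alpha (α : ℕ → ℝ) (hmono : StrictMono α) (hposz : ∀ k, 0 < α k)
    (hzero : ∀ k, j (α k) = 0) (x₁ : ℝ) (hx₁ : 0 < x₁) (hle : x₁ ≤ α 0) (hG : 0 < G x₁) :
    Filter.Tendsto α Filter.atTop Filter.atTop := by
  rcases tendsto_atTop_of_monotone hmono.monotone with h | ⟨l, hl⟩
  · exact h
  exfalso
  have hlt : ∀ k, α k < l := fun k =>
    (hmono (Nat.lt_succ_self k)).trans_le (hmono.monotone.ge_of_tendsto hl _)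
  have hl0 : 0 < l := (hposz 0).trans (hlt 0)
  have hj0 : j l = 0 := by
    have h1 := (j_hasDerivAt l).continuousAt.tendsto.comp hl
    have h2 : j ∘ α = fun _ => 0 := funext hzero
    rw [h2] at h1
    exact tendsto_nhds_unique h1 tendsto_const_nhds |> fun h => h
  have hj1 : j1 l = 0 := by
    have hw : Filter.Tendsto α Filter.atTop (nhdsWithin l {l}ᶜ) :=
      tendsto_nhdsWithin_iff.mpr ⟨hl, Filter.Eventually.of_forall fun k => (hlt k).ne⟩
    have h1 := (j_hasDerivAt l).tendsto_slope.comp hw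
    have h2 : slope j l ∘ α = fun _ => 0 := by
      funext k
      simp [slope, hzero k, hj0]
    rw [h2] at h1
    exact tendsto_nhds_unique h1 tendsto_const_nhds
  have h3 : G x₁ ≤ G l := G_mono hx₁ hl0 (hle.trans (hlt 0).le)
  have h4 : G l = 0 := by simp [G, hj0, hj1]
  linarith

/-- **Lower bound away from the zeros of `J₀`.** Let `α : ℕ → ℝ` enumerate the increasing
sequence of positive zeros of `J₀`. Then there are `K ∈ ℕ` and `c' > 0` such that
`|J₀(α_k + ε)| ≥ c'/√k` for all `k ≥ K` and all `ε ∈ ℂ` with `|ε| = 3/4`. -/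
theorem stmt18 (α : ℕ → ℝ)
    (hmono : StrictMono α) (hposz : ∀ k, 0 < α k)
    (hzero : ∀ k, J0 ((α k : ℂ)) = 0)
    (hall : ∀ x : ℝ, 0 < x → J0 ((x : ℂ)) = 0 → ∃ k, α k = x) :
    ∃ K : ℕ, ∃ c' > (0 : ℝ), ∀ k : ℕ, K ≤ k → ∀ ε : ℂ, ‖ε‖ = 3 / 4 →
      c' / Real.sqrt k ≤ ‖J0 ((α k : ℂ) + ε)‖ := by
  simp only [J0_zero_iff] at hzero hall
  have hα0 := hposz 0
  have hx₁ : 0 < α 0 / 2 := by linarith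
  have hjx : j (α 0 / 2) ≠ 0 := by
    intro h
    obtain ⟨k, hk⟩ := hall _ hx₁ h
    have := hmono.monotone (Nat.zero_le k)
    linarith
  have hG : 0 < G (α 0 / 2) := by
    unfold G
    have : 0 < j (α 0 / 2) ^ 2 := by positivity
    positivity
  set g := G (α 0 / 2) with hg
  have htend := tendsto_alpha α hmono hposz hzero _ hx₁ (by linarith) hG
  have hstep : ∀ k, α (k + 1) ≤ α k + Real.pi := by
    intro k
    obtain ⟨x, h1, h2, h3⟩ := exists_zero (α k) (hposz k)
    obtain ⟨i, rfl⟩ := hall x ((hposz k).trans h1) h3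
    have : k < i := hmono.lt_iff_lt.mp h1
    exact (hmono.monotone this).trans h2.le
  have hlin : ∀ k : ℕ, α k ≤ α 0 + k * Real.pi := by
    intro k
    induction k with
    | zero => simp
    | succ k ih => push_cast; linarith [hstep k]
  obtain ⟨c, hc, hsin⟩ := sin_lower
  set M := Real.exp 1 * Real.exp 2 with hM
  have hM0 : 0 < M := by positivity
  obtain ⟨K, hK⟩ := Filter.eventually_atTop.mp
    (htend.eventually_ge_atTop (max 2 (2 * M / c + 1)))
  have hpi := Real.pi_pos
  set C := α 0 + Real.pi with hC
  have hC0 : 0 < C := by positivity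
  refine ⟨max K 1, c / 2 * √(g / C), by positivity, ?_⟩
  intro k hk ε hε
  have hk1 : (1 : ℝ) ≤ k := by exact_mod_cast (le_max_right K 1).trans hk
  have hk' := hK k ((le_max_left K 1).trans hk)
  have ha2 : 2 ≤ α k := (le_max_left _ _).trans hk'
  have haM : 2 * M / c + 1 ≤ α k := (le_max_right _ _).trans hk'
  have happ := J0_approx (α k) ha2 ((J0_zero_iff _).mpr (hzero k)) ε hε
  have hb : √(g / C) / √k ≤ ‖J1 (α k)‖ := by
    rw [← Real.sqrt_div' _ (by linarith)]
    apply Real.sqrt_le_iff.mpr ⟨norm_nonneg _, ?_⟩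
    have h1 : g ≤ α k * j1 (α k) ^ 2 :=
      (G_mono hx₁ (hposz k) (by linarith [hmono.monotone (Nat.zero_le k)])).trans
        (G_at_zero _ (hposz k) (hzero k))
    have h2 : j1 (α k) ^ 2 ≤ ‖J1 (α k)‖ ^ 2 := by
      rw [← sq_abs]
      gcongr
      exact Complex.abs_re_le_norm _
    have h3 : α k ≤ C * k := by
      have := hlin k
      nlinarith
    rw [div_div, div_le_iff₀ (by positivity)]
    have h4 : α k * j1 (α k) ^ 2 ≤ C * k * ‖J1 (α k)‖ ^ 2 := by gcongr
    linarith
  have h1 : Real.exp 1 * (‖J1 (α k)‖ * Real.exp 2) / (α k - 1) ≤ c / 2 * ‖J1 (α k)‖ := by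
    rw [div_le_iff₀ (by linarith)]
    have h2 : 2 * M / c ≤ α k - 1 := by linarith
    rw [div_le_iff₀ hc] at h2
    have h3 := mul_le_mul_of_nonneg_right h2 (norm_nonneg (J1 (α k)))
    rw [hM] at h3
    linarith
  have h2 : c * ‖J1 (α k)‖ ≤ ‖J1 (α k) * Complex.sin ε‖ := by
    rw [norm_mul, mul_comm]
    gcongr
    exact hsin ε hε
  have h3 : ‖J1 (α k) * Complex.sin ε‖ - ‖J0 (α k + ε)‖
      ≤ ‖J0 (α k + ε) - J1 (α k) * Complex.sin ε‖ := by
    rw [norm_sub_rev]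
    exact norm_sub_norm_le _ _
  have h4 : c / 2 * √(g / C) / √k ≤ c / 2 * ‖J1 (α k)‖ := by
    rw [mul_div_assoc]
    gcongr
  linarith

end
end
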